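/- arXiv:2012.10691 — 4 statements merged into one kernel-verified Lean document; each statement's English description precedes it below -/
import Mathlib

section
/- Let X be a uniformly convex and uniformly smooth real Banach space and let A ⊂ X be proximally smooth with constant R > 0. Let x0, x1 ∈ A be distinct points with ‖x0 − x1‖/R < ω_X^{-1}(1/8). Then P_A([x0, x1]) ⊂ conv{ x0, B_{r′}((x0+x1)/2) ∩ (H_{x1−x0} + (x0+x1)/2), x1 }, where r′ = R′(‖x0 − x1‖, R), B_{r′}(c) is the closed ball of radius r′ centered at c, and H_{x1−x0} is the set of vectors quasi-orthogonal to x1 − x0. -/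
noncomputable section

open Set Metric

/-- The modulus of smoothness of a normed space `X`. -/
def modSmooth (X : Type*) [NormedAddCommGroup X] [NormedSpace ℝ X] (τ : ℝ) : ℝ :=
  sSup {r : ℝ | ∃ x y : X, ‖x‖ = 1 ∧ ‖y‖ = τ ∧ r = (‖x + y‖ + ‖x - y‖) / 2 - 1}

/-- `X` is uniformly smooth: `ρ_X(τ)/τ → 0` as `τ → 0⁺`. -/
def UnifSmooth (X : Type*) [NormedAddCommGroup X] [NormedSpace ℝ X] : Prop :=
  Filter.Tendsto (fun τ => modSmooth X τ / τ) (nhdsWithin 0 (Set.Ioi 0)) (nhds 0)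

/-- The modulus of convexity of a normed space `X`. -/
def modConvex (X : Type*) [NormedAddCommGroup X] [NormedSpace ℝ X] (ε : ℝ) : ℝ :=
  sInf {r : ℝ | ∃ x y : X, ‖x‖ ≤ 1 ∧ ‖y‖ ≤ 1 ∧ ε ≤ ‖x - y‖ ∧ r = 1 - ‖x + y‖ / 2}

/-- A closed set `A` is proximally smooth with constant `R` if the distance function
is continuously (Fréchet) differentiable on the open `R`-neighborhood of `A`. -/
def ProximallySmooth {X : Type*} [NormedAddCommGroup X] [NormedSpace ℝ X]
    (A : Set X) (R : ℝ) : Prop :=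
  IsClosed A ∧ ContDiffOn ℝ 1 (fun x => Metric.infDist x A)
    {x : X | 0 < Metric.infDist x A ∧ Metric.infDist x A < R}

/-- `y` is quasi-orthogonal to `x`: `‖x + λ y‖ ≥ ‖x‖` for all real `λ`
(Birkhoff--James orthogonality of `x` to `y`). -/
def QuasiOrth {X : Type*} [NormedAddCommGroup X] [NormedSpace ℝ X] (y x : X) : Prop :=
  ∀ l : ℝ, ‖x‖ ≤ ‖x + l • y‖

/-- `ζ_X^+(ε) = sup{‖x + ε y‖ : ‖x‖ = ‖y‖ = 1, y ⌐ x}`. -/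
def zetaPlus (X : Type*) [NormedAddCommGroup X] [NormedSpace ℝ X] (ε : ℝ) : ℝ :=
  sSup {r : ℝ | ∃ x y : X, ‖x‖ = 1 ∧ ‖y‖ = 1 ∧ QuasiOrth y x ∧ r = ‖x + ε • y‖}

/-- `ω_X(τ) = ρ_X(τ)/τ`. -/
def omegaX (X : Type*) [NormedAddCommGroup X] [NormedSpace ℝ X] (τ : ℝ) : ℝ :=
  modSmooth X τ / τ

/-- The inverse function of `ω_X`. -/
def omegaInv (X : Type*) [NormedAddCommGroup X] [NormedSpace ℝ X] : ℝ → ℝ :=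
  Function.invFun (omegaX X)

/-- The inverse function of `ζ_X^+`. -/
def zetaPlusInv (X : Type*) [NormedAddCommGroup X] [NormedSpace ℝ X] : ℝ → ℝ :=
  Function.invFun (zetaPlus X)

/-- `R′(τ, R) = 8R·ρ_X(τ/R)/(1 − 8 ω_X(τ/R))`. -/
def Rprime (X : Type*) [NormedAddCommGroup X] [NormedSpace ℝ X] (τ R : ℝ) : ℝ :=
  8 * R * modSmooth X (τ / R) / (1 - 8 * omegaX X (τ / R))

/-- The metric projection of `x` onto `A`. -/
def metricProj {X : Type*} [NormedAddCommGroup X] [NormedSpace ℝ X]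
    (A : Set X) (x : X) : Set X :=
  {a : X | a ∈ A ∧ ‖a - x‖ = Metric.infDist x A}

/-- The metric projection of the segment `[x0, x1]` onto `A`. -/
def metricProjSeg {X : Type*} [NormedAddCommGroup X] [NormedSpace ℝ X]
    (A : Set X) (x0 x1 : X) : Set X :=
  ⋃ x ∈ segment ℝ x0 x1, metricProj A x

/-- A slice-projection of the midpoint of `[x0, x1]` onto `A`. -/
def IsSliceProj {X : Type*} [NormedAddCommGroup X] [NormedSpace ℝ X]
    (A : Set X) (x0 x1 z : X) : Prop :=
  z ∈ metricProjSeg A x0 x1 ∧ QuasiOrth (z - midpoint ℝ x0 x1) (x0 - x1)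

/-- `f` parametrizes a curve in `A` with endpoints `x0` and `x1`. -/
def IsCurveIn {X : Type*} [NormedAddCommGroup X] [NormedSpace ℝ X]
    (A : Set X) (x0 x1 : X) (f : ℝ → X) : Prop :=
  ContinuousOn f (Set.Icc 0 1) ∧ f 0 = x0 ∧ f 1 = x1 ∧ f '' Set.Icc 0 1 ⊆ A

section aux
variable {X : Type*} [NormedAddCommGroup X] [NormedSpace ℝ X]

lemma aux_dir [Nontrivial X] (y : X) : ∃ e : X, ‖e‖ = 1 ∧ y = ‖y‖ • e := by
  by_cases hy : y = 0
  · obtain ⟨e, he⟩ := exists_norm_eq X (zero_le_one)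
    exact ⟨e, he, by simp [hy]⟩
  · have : ‖y‖ ≠ 0 := norm_ne_zero_iff.mpr hy
    refine ⟨‖y‖⁻¹ • y, ?_, ?_⟩
    · rw [norm_smul, norm_inv, norm_norm, inv_mul_cancel₀ this]
    · rw [smul_smul, mul_inv_cancel₀ this, one_smul]

lemma aux_bdd (τ : ℝ) : BddAbove {r : ℝ | ∃ x y : X, ‖x‖ = 1 ∧ ‖y‖ = τ ∧
    r = (‖x + y‖ + ‖x - y‖) / 2 - 1} := by
  refine ⟨τ, ?_⟩
  rintro r ⟨x, y, hx, hy, rfl⟩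
  have h1 := norm_add_le x y
  have h2 := norm_sub_le x y
  linarith

lemma aux_le (p v : X) (hp : ‖p‖ = 1) :
    ‖p + v‖ + ‖p - v‖ ≤ 2 + 2 * modSmooth X ‖v‖ := by
  have := le_csSup (aux_bdd (X := X) ‖v‖) ⟨p, v, hp, rfl, rfl⟩
  unfold modSmooth
  linarith

lemma aux_sup [Nontrivial X] (τ : ℝ) (hτ : 0 ≤ τ) (c : ℝ)
    (h : ∀ p e : X, ‖p‖ = 1 → ‖e‖ = 1 → ‖p + τ • e‖ + ‖p - τ • e‖ ≤ 2 + 2 * c) :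
    modSmooth X τ ≤ c := by
  apply csSup_le
  · obtain ⟨e, he⟩ := exists_norm_eq X (zero_le_one)
    obtain ⟨y, hy⟩ := exists_norm_eq X hτ
    exact ⟨_, e, y, he, hy, rfl⟩
  · rintro r ⟨x, y, hx, hy, rfl⟩
    obtain ⟨e, he, hye⟩ := aux_dir y
    rw [hy] at hye
    have := h x e hx he
    rw [← hye] at this
    linarith

lemma aux_le' (p e : X) (hp : ‖p‖ = 1) (he : ‖e‖ = 1) (τ : ℝ) (hτ : 0 ≤ τ) :
    ‖p + τ • e‖ + ‖p - τ • e‖ ≤ 2 + 2 * modSmooth X τ := by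
  have := aux_le p (τ • e) hp
  rwa [norm_smul, he, mul_one, Real.norm_of_nonneg hτ] at this

lemma aux_convex [Nontrivial X] (a b s t : ℝ) (ha : 0 ≤ a) (hb : 0 ≤ b) (hs : 0 ≤ s) (ht : 0 ≤ t)
    (hst : s + t = 1) :
    modSmooth X (s * a + t * b) ≤ s * modSmooth X a + t * modSmooth X b := by
  apply aux_sup _ (by positivity)
  intro p e hp he
  have h1 := aux_le' p e hp he a ha
  have h2 := aux_le' p e hp he b hb
  have e1 : p + (s * a + t * b) • e = s • (p + a • e) + t • (p + b • e) := by
    have : p = s • p + t • p := by rw [← add_smul, hst, one_smul]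
    nth_rewrite 1 [this]; module
  have e2 : p - (s * a + t * b) • e = s • (p - a • e) + t • (p - b • e) := by
    have : p = s • p + t • p := by rw [← add_smul, hst, one_smul]
    nth_rewrite 1 [this]; module
  have n1 := norm_add_le (s • (p + a • e)) (t • (p + b • e))
  have n2 := norm_add_le (s • (p - a • e)) (t • (p - b • e))
  rw [← e1] at n1
  rw [← e2] at n2
  rw [norm_smul, norm_smul, Real.norm_of_nonneg hs, Real.norm_of_nonneg ht] at n1 n2
  nlinarith [mul_le_mul_of_nonneg_left h1 hs, mul_le_mul_of_nonneg_left h2 ht]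

lemma aux_zero [Nontrivial X] : modSmooth X 0 ≤ 0 := by
  apply aux_sup _ le_rfl
  intro p e hp he
  simp [hp]; norm_num

lemma aux_nonneg [Nontrivial X] (τ : ℝ) (hτ : 0 ≤ τ) : 0 ≤ modSmooth X τ := by
  obtain ⟨e, he⟩ := exists_norm_eq X (zero_le_one)
  have := aux_le' e e he he τ hτ
  have h2 := norm_add_le (e + τ • e) (e - τ • e)
  have h3 : (e + τ • e) + (e - τ • e) = (2 : ℝ) • e := by module
  rw [h3, norm_smul, he] at h2
  norm_num at h2
  linarith

lemma aux_big [Nontrivial X] (τ : ℝ) (hτ : 0 ≤ τ) : τ - 1 ≤ modSmooth X τ := by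
  obtain ⟨e, he⟩ := exists_norm_eq X (zero_le_one)
  have := aux_le' e e he he τ hτ
  have h2 := norm_sub_le (e + τ • e) (e - τ • e)
  have h3 : (e + τ • e) - (e - τ • e) = (2 * τ) • e := by module
  rw [h3, norm_smul, he, Real.norm_of_nonneg (by positivity)] at h2
  linarith

lemma aux_star [Nontrivial X] (s a : ℝ) (ha : 0 ≤ a) (hs : 0 ≤ s) (hs1 : s ≤ 1) :
    modSmooth X (s * a) ≤ s * modSmooth X a := by
  have := aux_convex (X := X) a 0 s (1 - s) ha le_rfl hs (by linarith) (by ring)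
  have h0 := mul_nonpos_of_nonneg_of_nonpos (sub_nonneg.mpr hs1) (aux_zero (X := X))
  simp only [mul_zero, add_zero] at this
  linarith

lemma aux_mono [Nontrivial X] (a b : ℝ) (ha : 0 ≤ a) (hab : a ≤ b) :
    modSmooth X a ≤ modSmooth X b := by
  rcases eq_or_lt_of_le (ha.trans hab) with h | h
  · have : a = b := by linarith
    rw [this]
  have h1 := aux_star (X := X) (a / b) b h.le (by positivity) ((div_le_one h).mpr hab)
  rw [div_mul_cancel₀ _ h.ne'] at h1
  have h2 : a / b * modSmooth X b ≤ 1 * modSmooth X b :=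
    mul_le_mul_of_nonneg_right ((div_le_one h).mpr hab) (aux_nonneg b h.le)
  linarith

lemma aux_lip [Nontrivial X] (a b : ℝ) (ha : 0 ≤ a) (hb : 0 ≤ b) :
    modSmooth X a ≤ modSmooth X b + |a - b| := by
  apply aux_sup _ ha
  intro p e hp he
  have h2 := aux_le' p e hp he b hb
  have n1 := norm_add_le (p + b • e) ((a - b) • e)
  have n2 := norm_sub_le (p - b • e) ((a - b) • e)
  have e1 : p + b • e + (a - b) • e = p + a • e := by module
  have e2 : p - b • e - (a - b) • e = p - a • e := by module
  rw [e1, norm_smul, he, Real.norm_eq_abs] at n1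
  rw [e2, norm_smul, he, Real.norm_eq_abs] at n2
  linarith

lemma aux_cont [Nontrivial X] : ContinuousOn (omegaX X) (Ioi 0) := by
  have : ContinuousOn (modSmooth X) (Ioi 0) := by
    have : LipschitzOnWith 1 (modSmooth X) (Ioi 0) := by
      apply LipschitzOnWith.of_dist_le_mul
      intro a ha b hb
      have h1 := aux_lip (X := X) a b (le_of_lt ha) (le_of_lt hb)
      have h2 := aux_lip (X := X) b a (le_of_lt hb) (le_of_lt ha)
      rw [abs_sub_comm] at h2
      rw [Real.dist_eq, Real.dist_eq, NNReal.coe_one, one_mul, abs_le]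
      constructor <;> linarith
    exact this.continuousOn
  exact this.div continuousOn_id (fun x hx => ne_of_gt hx)

lemma aux_small (hsm : UnifSmooth X) (b : ℝ) (hb : 0 < b) :
    ∃ ε, 0 < ε ∧ ε < b ∧ omegaX X ε < 1 / 8 := by
  have h1 := hsm.eventually (gt_mem_nhds (show (0:ℝ) < 1 / 8 by norm_num))
  have h2 : ∀ᶠ τ in nhdsWithin (0:ℝ) (Ioi 0), τ ∈ Ioo 0 b := Ioo_mem_nhdsGT hb
  obtain ⟨ε, he, he2⟩ := (h1.and h2).exists
  exact ⟨ε, he2.1, he2.2, he⟩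

lemma aux_inv [Nontrivial X] (hsm : UnifSmooth X) : omegaX X (omegaInv X (1 / 8)) = 1 / 8 := by
  apply Function.invFun_eq
  obtain ⟨ε, he, heb, hw⟩ := aux_small hsm (8 / 7) (by norm_num)
  have hbig : 1 / 8 ≤ omegaX X (8 / 7) := by
    have := aux_big (X := X) (8 / 7) (by norm_num)
    unfold omegaX
    rw [le_div_iff₀ (by norm_num)]
    linarith
  have := intermediate_value_Icc heb.le
    ((aux_cont (X := X)).mono (fun x hx => lt_of_lt_of_le he hx.1))
  obtain ⟨c, _, hc⟩ := this ⟨hw.le, hbig⟩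
  exact ⟨c, hc⟩

lemma aux_omega [Nontrivial X] (hsm : UnifSmooth X) (τ : ℝ) (hτ : 0 < τ)
    (hlt : τ < omegaInv X (1 / 8)) : modSmooth X τ < τ / 8 := by
  set T := omegaInv X (1 / 8) with hT
  have hTw : modSmooth X T = T / 8 := by
    have := aux_inv hsm
    rw [← hT] at this
    unfold omegaX at this
    rw [div_eq_iff (by linarith)] at this
    linarith
  obtain ⟨ε, he, heb, hw⟩ := aux_small hsm τ hτ
  unfold omegaX at hw
  rw [div_lt_iff₀ he] at hw
  have hpos : 0 < T - ε := by linarith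
  have hc := aux_convex (X := X) T ε ((τ - ε) / (T - ε)) ((T - τ) / (T - ε)) (by linarith) he.le
    (div_nonneg (by linarith) hpos.le) (div_nonneg (by linarith) hpos.le)
    (by field_simp; ring)
  have e1 : (τ - ε) / (T - ε) * T + (T - τ) / (T - ε) * ε = τ := by field_simp; ring
  rw [e1, hTw] at hc
  have h3 : 0 < (T - τ) / (T - ε) := div_pos (by linarith) hpos
  nlinarith [mul_lt_mul_of_pos_left hw h3]

lemma aux_ascent (A : Set X) (hne : A.Nonempty) (z : X) (hz : 0 < infDist z A)
    (hdiff : DifferentiableAt ℝ (fun x => infDist x A) z) (l r : ℝ) (hl : l < 1) (hr : 0 < r) :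
    ∃ z', z' ≠ z ∧ ‖z' - z‖ ≤ r ∧ infDist z A + l * ‖z' - z‖ ≤ infDist z' A := by
  set D := infDist z A with hD
  set η := (1 - l) / 3 with hη
  have hηp : 0 < η := by rw [hη]; linarith
  have h1 := hdiff.hasFDerivAt.isLittleO.def hηp
  rw [Metric.eventually_nhds_iff] at h1
  obtain ⟨r0, hr0, h1⟩ := h1
  set f := fderiv ℝ (fun x => infDist x A) z
  set t := min 1 (min (r0 / 2) r / (D + 1)) with ht
  have htp : 0 < t := by rw [ht]; positivity
  have ht1 : t ≤ 1 := min_le_left _ _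
  have htm : t * (D + 1) ≤ min (r0 / 2) r := by
    rw [← le_div_iff₀ (by linarith)]; exact min_le_right _ _
  obtain ⟨a, haA, ha⟩ := (infDist_lt_iff (x := z) (r := D + min (η * t * D) 1) hne).mp
    (by have : 0 < min (η * t * D) 1 := by positivity
        linarith)
  have hDa : D ≤ dist z a := infDist_le_dist_of_mem haA
  rw [dist_eq_norm] at ha hDa
  set v := z - a with hv
  have hε1 := min_le_left (η * t * D) 1
  have hε2 := min_le_right (η * t * D) 1
  have hvp : 0 < ‖v‖ := lt_of_lt_of_le hz hDa
  have htv : t * ‖v‖ ≤ min (r0 / 2) r :=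
    (mul_le_mul_of_nonneg_left (by linarith) htp.le).trans htm
  have hn : ‖t • v‖ = t * ‖v‖ := by rw [norm_smul, Real.norm_of_nonneg htp.le]
  have hr0' := htv.trans (min_le_left _ _)
  have hp := h1 (y := z + t • v) (by rw [dist_eq_norm, add_sub_cancel_left, hn]; linarith)
  have hm := h1 (y := z - t • v) (by rw [dist_eq_norm, sub_sub_cancel_left, norm_neg, hn]; linarith)
  simp only [add_sub_cancel_left, sub_sub_cancel_left, norm_neg, map_neg, hn,
    Real.norm_eq_abs, abs_le] at hp hm
  have hup : infDist (z - t • v) A ≤ (1 - t) * ‖v‖ := by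
    have := infDist_le_dist_of_mem (x := z - t • v) haA
    have e : z - t • v - a = (1 - t) • v := by rw [hv]; module
    rwa [dist_eq_norm, e, norm_smul, Real.norm_of_nonneg (by linarith)] at this
  refine ⟨z + t • v, ?_, ?_, ?_⟩
  · intro h
    have : t • v = 0 := by simpa using h
    rw [this, norm_zero] at hn
    nlinarith
  · rw [add_sub_cancel_left, hn]; exact htv.trans (min_le_right _ _)
  · rw [add_sub_cancel_left, hn]
    have h5 : η * t * D ≤ η * t * ‖v‖ := mul_le_mul_of_nonneg_left hDa (by positivity)
    have h6 : l = 1 - 3 * η := by rw [hη]; ring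
    rw [h6]
    nlinarith [hp.1, hm.1]

lemma aux_ekeland [CompleteSpace X] (g : X → ℝ) (hg : Continuous g) (x : X) (s l M : ℝ)
    (hl : 0 < l) (hs : 0 ≤ s)
    (hM : ∀ z, ‖z - x‖ ≤ s → g z ≤ M) :
    ∃ z, ‖z - x‖ ≤ s ∧ g x + l * ‖z - x‖ ≤ g z ∧
      ∀ z', ‖z' - x‖ ≤ s → g z + l * ‖z' - z‖ ≤ g z' → z' = z := by
  let S : X → Set X := fun z => {z' | ‖z' - x‖ ≤ s ∧ g z + l * ‖z' - z‖ ≤ g z'}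
  have step : ∀ (n : ℕ) (z : X), ∃ z', ‖z - x‖ ≤ s →
      (z' ∈ S z ∧ ∀ y ∈ S z, g y ≤ g z' + 1 / ((n : ℝ) + 1)) := by
    intro n z
    by_cases hz : ‖z - x‖ ≤ s
    · have hb : BddAbove (g '' S z) := ⟨M, by rintro _ ⟨y, hy, rfl⟩; exact hM y hy.1⟩
      have hne : (g '' S z).Nonempty := ⟨g z, z, ⟨hz, by simp⟩, rfl⟩
      have hpos : (0:ℝ) < 1 / ((n : ℝ) + 1) := by positivity
      obtain ⟨_, ⟨z', hz', rfl⟩, hlt⟩ := exists_lt_of_lt_csSup hne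
        (show sSup (g '' S z) - 1 / ((n : ℝ) + 1) < sSup (g '' S z) by linarith)
      refine ⟨z', fun _ => ⟨hz', fun y hy => ?_⟩⟩
      have := le_csSup hb ⟨y, hy, rfl⟩
      linarith
    · exact ⟨z, fun h => absurd h hz⟩
  choose F hF using step
  let u : ℕ → X := fun n => Nat.rec x (fun n z => F n z) n
  have hu0 : u 0 = x := rfl
  have hus : ∀ n, u (n + 1) = F n (u n) := fun n => rfl
  have hub : ∀ n, ‖u n - x‖ ≤ s := by
    intro n
    induction n with
    | zero => simp [hu0, hs]
    | succ n ih => rw [hus]; exact (hF n _ ih).1.1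
  have hstep : ∀ n, g (u n) + l * ‖u (n + 1) - u n‖ ≤ g (u (n + 1)) := fun n => by
    rw [hus]; exact (hF n _ (hub n)).1.2
  have hmono : Monotone (fun n => g (u n)) := monotone_nat_of_le_succ fun n => by
    have := hstep n
    have : 0 ≤ l * ‖u (n + 1) - u n‖ := by positivity
    linarith
  have hchain : ∀ n k, g (u n) + l * ‖u (n + k) - u n‖ ≤ g (u (n + k)) := by
    intro n k
    induction k with
    | zero => simp
    | succ k ih =>
      have h1 := hstep (n + k)
      have h2 := norm_sub_le_norm_sub_add_norm_sub (u (n + k + 1)) (u (n + k)) (u n)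
      have := mul_le_mul_of_nonneg_left h2 hl.le
      rw [← add_assoc]
      linarith
  have hbdd : BddAbove (range fun n => g (u n)) :=
    ⟨M, by rintro _ ⟨n, rfl⟩; exact hM _ (hub n)⟩
  have hconv := tendsto_atTop_ciSup hmono hbdd
  set L := ⨆ n, g (u n)
  have hgL : ∀ n, g (u n) ≤ L := fun n => le_ciSup hbdd n
  have hcauchy : CauchySeq u := by
    apply cauchySeq_of_le_tendsto_0 (fun n => 2 * ((L - g (u n)) / l))
    · intro n m N hn hm
      have hh : ∀ k, N ≤ k → ‖u k - u N‖ ≤ (L - g (u N)) / l := by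
        intro k hk
        obtain ⟨j, rfl⟩ := Nat.exists_eq_add_of_le hk
        rw [le_div_iff₀ hl]
        have := hchain N j
        have := hgL (N + j)
        linarith
      have := dist_triangle_right (u n) (u m) (u N)
      rw [dist_eq_norm, dist_eq_norm, dist_eq_norm] at this
      rw [dist_eq_norm]
      linarith [hh n hn, hh m hm]
    · have : Filter.Tendsto (fun n => 2 * ((L - g (u n)) / l)) Filter.atTop
          (nhds (2 * ((L - L) / l))) := ((tendsto_const_nhds.sub hconv).div_const l).const_mul 2
      simpa using this
  obtain ⟨z, hz⟩ := cauchySeq_tendsto_of_complete hcauchy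
  have hgz : g z = L := tendsto_nhds_unique ((hg.tendsto z).comp hz) hconv
  have hzS : ∀ n, g (u n) + l * ‖z - u n‖ ≤ g z := by
    intro n
    have h1 : Filter.Tendsto (fun k => g (u n) + l * ‖u k - u n‖) Filter.atTop
        (nhds (g (u n) + l * ‖z - u n‖)) :=
      (((hz.sub_const (u n)).norm).const_mul l).const_add _
    refine le_of_tendsto h1 ?_
    filter_upwards [Filter.eventually_ge_atTop n] with k hk
    obtain ⟨j, rfl⟩ := Nat.exists_eq_add_of_le hk
    rw [hgz]
    exact (hchain n j).trans (hgL _)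
  refine ⟨z, ?_, ?_, ?_⟩
  · exact le_of_tendsto ((hz.sub_const x).norm) (Filter.Eventually.of_forall hub)
  · simpa [hu0] using hzS 0
  · intro z' hz' hgz'
    have h1 : ∀ n : ℕ, g z' ≤ g z + 1 / ((n : ℝ) + 1) := by
      intro n
      have : z' ∈ S (u n) := by
        refine ⟨hz', ?_⟩
        have h2 := norm_sub_le_norm_sub_add_norm_sub z' z (u n)
        have := mul_le_mul_of_nonneg_left h2 hl.le
        linarith [hzS n]
      have h3 := (hF n _ (hub n)).2 z' this
      rw [← hus] at h3
      have := hgL (n + 1)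
      linarith
    have h2 : g z' ≤ g z := by
      have h3 : Filter.Tendsto (fun n : ℕ => g z + 1 / ((n : ℝ) + 1)) Filter.atTop
        (nhds (g z + 0)) := tendsto_one_div_add_atTop_nhds_zero_nat.const_add _
      rw [add_zero] at h3
      exact ge_of_tendsto' h3 h1
    have h3 : l * ‖z' - z‖ ≤ 0 := by linarith
    have h4 : ‖z' - z‖ ≤ 0 := by
      by_contra h; push Not at h; nlinarith
    exact sub_eq_zero.mp (norm_le_zero_iff.mp h4)

lemma aux_far [CompleteSpace X] (A : Set X) (R : ℝ) (hA : ProximallySmooth A R)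
    (hne : A.Nonempty) (x : X) (hx : 0 < infDist x A) (s l : ℝ) (hs : 0 < s)
    (hsR : infDist x A + s < R) (hl : 0 < l) (hl1 : l < 1) :
    ∃ z, ‖z - x‖ ≤ s ∧ infDist x A + l * s ≤ infDist z A := by
  have hlip : ∀ z, infDist z A ≤ infDist x A + ‖z - x‖ := fun z => by
    rw [← dist_eq_norm]; exact infDist_le_infDist_add_dist
  obtain ⟨z, hz, hgz, hmax⟩ := aux_ekeland (fun x => infDist x A) (continuous_infDist_pt A) x s l
    (infDist x A + s) hl hs.le (fun z hz => (hlip z).trans (by linarith))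
  refine ⟨z, hz, ?_⟩
  rcases eq_or_lt_of_le hz with h | h
  · rw [← h]; exact hgz
  exfalso
  have hzp : 0 < infDist z A := by
    have : 0 ≤ l * ‖z - x‖ := by positivity
    linarith
  have hzR : infDist z A < R := by linarith [hlip z]
  have hopen : IsOpen {x : X | 0 < infDist x A ∧ infDist x A < R} :=
    (isOpen_lt continuous_const (continuous_infDist_pt A)).inter
      (isOpen_lt (continuous_infDist_pt A) continuous_const)
  have hdiff : DifferentiableAt ℝ (fun x => infDist x A) z :=
    ((hA.2.differentiableOn (by norm_num)) z ⟨hzp, hzR⟩).differentiableAt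
      (hopen.mem_nhds ⟨hzp, hzR⟩)
  obtain ⟨z', hz'ne, hz'r, hz'⟩ := aux_ascent A hne z hzp hdiff l (s - ‖z - x‖) hl1 (by linarith)
  refine hz'ne (hmax z' ?_ hz')
  have := norm_sub_le_norm_sub_add_norm_sub z' z x
  linarith

lemma aux_uc [UniformConvexSpace X] (p : X) (hp : ‖p‖ = 1) (D s ε : ℝ) (hD : 0 < D) (hs : 0 < s)
    (hε : 0 < ε) : ∃ η, 0 < η ∧ ∀ q : X, ‖q‖ ≤ 1 → D + s - η ≤ ‖D • p + s • q‖ → ‖p - q‖ < ε := by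
  obtain ⟨δ, hδ, h⟩ := exists_forall_closed_ball_dist_add_le_two_sub X hε
  refine ⟨min D s * (δ / 4), by positivity, fun q hq hle => ?_⟩
  by_contra hcon
  push Not at hcon
  have h1 := h hp.le hq hcon
  obtain ⟨g, hg, hg2⟩ := exists_dual_vector'' ℝ (D • p + s • q)
  simp only [map_add, map_smul, smul_eq_mul, RCLike.ofReal_real_eq_id, id] at hg2
  have hb : ∀ v, g v ≤ ‖v‖ := fun v =>
    (le_abs_self _).trans ((g.le_opNorm v).trans (by nlinarith [norm_nonneg v]))
  have hgp : g p ≤ 1 := hp ▸ hb p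
  have hgq : g q ≤ 1 := (hb q).trans hq
  have hpq := hb (p + q)
  rw [map_add] at hpq
  have m1 : min D s * (δ / 4) ≤ D * (δ / 4) :=
    mul_le_mul_of_nonneg_right (min_le_left _ _) (by positivity)
  have m2 : min D s * (δ / 4) ≤ s * (δ / 4) :=
    mul_le_mul_of_nonneg_right (min_le_right _ _) (by positivity)
  have k1 : 1 - δ / 4 ≤ g p := by
    by_contra hk; push Not at hk
    nlinarith [mul_lt_mul_of_pos_left hk hD, mul_le_mul_of_nonneg_left hgq hs.le]
  have k2 : 1 - δ / 4 ≤ g q := by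
    by_contra hk; push Not at hk
    nlinarith [mul_lt_mul_of_pos_left hk hs, mul_le_mul_of_nonneg_left hgp hD.le]
  linarith

lemma aux_ray [CompleteSpace X] [UniformConvexSpace X] (A : Set X) (R : ℝ)
    (hA : ProximallySmooth A R) (x a p : X) (D : ℝ) (haA : a ∈ A) (hD : D = infDist x A)
    (hDp : 0 < D) (hp : ‖p‖ = 1) (hxa : x = a + D • p) (s : ℝ) (hs : 0 < s) (hsR : D + s < R) :
    D + s ≤ infDist (x + s • p) A := by
  apply le_of_forall_pos_le_add
  intro ε hε
  obtain ⟨η, hη, hq⟩ := aux_uc p hp D s (ε / 2 / s) hDp hs (by positivity)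
  set κ := min (1 / 2) (min η (ε / 2) / s) with hκ
  have hκp : 0 < κ := by rw [hκ]; positivity
  have hκs : κ * s ≤ min η (ε / 2) := by
    rw [← le_div_iff₀ hs]; exact min_le_right _ _
  have hκ1 : κ ≤ 1 / 2 := min_le_left _ _
  obtain ⟨z, hz, hzd⟩ := aux_far A R hA ⟨a, haA⟩ x (hD ▸ hDp) s (1 - κ) hs (hD ▸ hsR)
    (by linarith) (by linarith)
  rw [← hD] at hzd
  have hsq : s • (s⁻¹ • (z - x)) = z - x := by rw [smul_smul, mul_inv_cancel₀ hs.ne', one_smul]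
  have hqn : ‖s⁻¹ • (z - x)‖ ≤ 1 := by
    rw [norm_smul, norm_inv, Real.norm_of_nonneg hs.le, inv_mul_le_one₀ hs]; exact hz
  have hza : infDist z A ≤ ‖D • p + s • (s⁻¹ • (z - x))‖ := by
    rw [hsq]
    have e : D • p + (z - x) = z - a := by rw [hxa]; abel
    rw [e, ← dist_eq_norm]
    exact infDist_le_dist_of_mem haA
  have hclose := hq _ hqn (by linarith [hκs.trans (min_le_left _ _)])
  have hd : ‖z - (x + s • p)‖ ≤ ε / 2 := by
    have e : z - (x + s • p) = - (s • (p - s⁻¹ • (z - x))) := by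
      rw [smul_sub, hsq]; abel
    rw [e, norm_neg, norm_smul, Real.norm_of_nonneg hs.le]
    have := mul_le_mul_of_nonneg_left hclose.le hs.le
    rwa [mul_div_cancel₀ _ hs.ne'] at this
  have := infDist_le_infDist_add_dist (s := A) (x := z) (y := x + s • p)
  rw [dist_eq_norm] at this
  linarith [hκs.trans (min_le_right _ _)]

lemma aux_ball [CompleteSpace X] [UniformConvexSpace X] (A : Set X) (R : ℝ)
    (hA : ProximallySmooth A R) (x a p : X) (D : ℝ) (haA : a ∈ A) (hD : D = infDist x A)
    (hDp : 0 < D) (hDR : D < R) (hp : ‖p‖ = 1) (hxa : x = a + D • p) (y : X) (hy : y ∈ A) :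
    R ≤ ‖R • p - (y - a)‖ := by
  apply le_of_forall_pos_le_add
  intro ε hε
  set s := max ((R - D) / 2) (R - D - ε / 2) with hs
  have hsp : 0 < s := lt_of_lt_of_le (by linarith) (le_max_left _ _)
  have hs2 : R - D - ε / 2 ≤ s := le_max_right _ _
  have hs3 : D + s < R := by
    have : s < R - D := max_lt (by linarith) (by linarith)
    linarith
  have h1 := aux_ray A R hA x a p D haA hD hDp hp hxa s hsp hs3
  have h2 := infDist_le_dist_of_mem (x := x + s • p) hy
  have e : x + s • p - y = (R • p - (y - a)) - (R - D - s) • p := by rw [hxa]; module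
  rw [dist_eq_norm, e] at h2
  have h3 := norm_sub_le (R • p - (y - a)) ((R - D - s) • p)
  rw [norm_smul, hp, Real.norm_of_nonneg (by linarith)] at h3
  linarith

/-- one-sided estimate of the norming functional. -/
lemma aux_func (p v : X) (R : ℝ) (hR : 0 < R) (hp : ‖p‖ = 1) (J : StrongDual ℝ X) (hJ : ‖J‖ = 1)
    (hJp : J p = 1) (h : R ≤ ‖R • p - v‖) : J v ≤ 2 * R * modSmooth X (‖v‖ / R) := by
  have h1 := aux_le p (R⁻¹ • v) hp
  have hn : ‖R⁻¹ • v‖ = ‖v‖ / R := by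
    rw [norm_smul, norm_inv, Real.norm_of_nonneg hR.le]; field_simp
  rw [hn] at h1
  have e : R • p - v = R • (p - R⁻¹ • v) := by
    rw [smul_sub, smul_smul, mul_inv_cancel₀ hR.ne', one_smul]
  rw [e, norm_smul, Real.norm_of_nonneg hR.le] at h
  have h2 : 1 ≤ ‖p - R⁻¹ • v‖ := by
    by_contra hk; push Not at hk; nlinarith
  have h3 : J (p + R⁻¹ • v) ≤ ‖p + R⁻¹ • v‖ := by
    have := (le_abs_self _).trans (J.le_opNorm (p + R⁻¹ • v))
    rwa [hJ, one_mul] at this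
  rw [map_add, map_smul, hJp, smul_eq_mul] at h3
  have h4 : R⁻¹ * J v ≤ 2 * modSmooth X (‖v‖ / R) := by linarith
  rw [inv_mul_le_iff₀ hR] at h4
  linarith

lemma aux_est [Nontrivial X] (x0 x1 x a p : X) (R D t d : ℝ) (hR : 0 < R)
    (hd : d = ‖x0 - x1‖) (ht0 : 0 ≤ t) (ht1 : t ≤ 1 / 2) (hx : x = (1 - t) • x0 + t • x1)
    (hxa : x = a + D • p) (hp : ‖p‖ = 1) (hD0 : 0 ≤ D) (hDt : D ≤ t * d)
    (hb0 : R ≤ ‖R • p - (x0 - a)‖) (hb1 : R ≤ ‖R • p - (x1 - a)‖) :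
    D ≤ 6 * R * modSmooth X (d / R) * t := by
  have hd0 : 0 ≤ d := hd ▸ norm_nonneg _
  obtain ⟨J, hJ, hJp⟩ := exists_dual_vector ℝ p (by rw [hp]; norm_num)
  simp only [hp, RCLike.ofReal_real_eq_id, id] at hJp
  have hDp : ‖D • p‖ = D := by rw [norm_smul, hp, Real.norm_of_nonneg hD0, mul_one]
  have n0 : ‖x0 - a‖ ≤ 2 * t * d := by
    have e : x0 - a = t • (x0 - x1) + D • p := by
      have : a = x - D • p := by rw [hxa]; abel
      rw [this, hx]; module
    have := norm_add_le (t • (x0 - x1)) (D • p)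
    rw [← e, hDp, norm_smul, Real.norm_of_nonneg ht0, ← hd] at this
    linarith
  have n1 : ‖x1 - a‖ ≤ d := by
    have e : x1 - a = D • p - (1 - t) • (x0 - x1) := by
      have : a = x - D • p := by rw [hxa]; abel
      rw [this, hx]; module
    have := norm_sub_le (D • p) ((1 - t) • (x0 - x1))
    rw [← e, hDp, norm_smul, Real.norm_of_nonneg (by linarith), ← hd] at this
    linarith
  have f0 := aux_func p (x0 - a) R hR hp J hJ hJp hb0
  have f1 := aux_func p (x1 - a) R hR hp J hJ hJp hb1
  have hτ : 0 ≤ d / R := by positivity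
  have g0 : modSmooth X (‖x0 - a‖ / R) ≤ 2 * t * modSmooth X (d / R) := by
    refine (aux_mono _ (2 * t * (d / R)) (by positivity) ?_).trans
      (aux_star _ _ hτ (by linarith) (by linarith))
    rw [← mul_div_assoc]
    exact div_le_div_of_nonneg_right n0 hR.le
  have g1 : modSmooth X (‖x1 - a‖ / R) ≤ modSmooth X (d / R) :=
    aux_mono _ _ (by positivity) (div_le_div_of_nonneg_right n1 hR.le)
  have hρ := aux_nonneg (X := X) (d / R) hτ
  set ρ := modSmooth X (d / R)
  have eq : D = (1 - t) * J (x0 - a) + t * J (x1 - a) := by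
    have e : (1 - t) • (x0 - a) + t • (x1 - a) = D • p := by
      have : D • p = x - a := by rw [hxa]; abel
      rw [this, hx]; module
    have := congrArg J e
    simp only [map_add, map_smul, smul_eq_mul, hJp, mul_one] at this
    exact this.symm
  have k0 : J (x0 - a) ≤ 4 * R * ρ * t := by nlinarith
  have k1 : J (x1 - a) ≤ 2 * R * ρ := by nlinarith
  have m0 := mul_le_mul_of_nonneg_left k0 (show 0 ≤ 1 - t by linarith)
  have m1 := mul_le_mul_of_nonneg_left k1 ht0
  have m2 : 0 ≤ R * ρ * t * t := by positivity
  nlinarith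

end aux

theorem statement6 (X : Type*) [NormedAddCommGroup X] [NormedSpace ℝ X]
    [CompleteSpace X] [UniformConvexSpace X] (hsm : UnifSmooth X)
    (A : Set X) (R : ℝ) (hR : 0 < R) (hA : ProximallySmooth A R)
    (x0 x1 : X) (h0 : x0 ∈ A) (h1 : x1 ∈ A) (hne : x0 ≠ x1)
    (hd : ‖x0 - x1‖ / R < omegaInv X (1 / 8)) :
    metricProjSeg A x0 x1 ⊆
      convexHull ℝ ({x0, x1} ∪
        (Metric.closedBall (midpoint ℝ x0 x1) (Rprime X ‖x0 - x1‖ R) ∩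
          {v : X | QuasiOrth (v - midpoint ℝ x0 x1) (x1 - x0)})) := by
  haveI : Nontrivial X := ⟨x0, x1, hne⟩
  set d := ‖x0 - x1‖ with hdd
  have hdp : 0 < d := norm_pos_iff.mpr (sub_ne_zero.mpr hne)
  have hτ : 0 < d / R := by positivity
  have hw := aux_omega hsm (d / R) hτ hd
  have hbig := aux_big (X := X) (d / R) hτ.le
  have hρ := aux_nonneg (X := X) (d / R) hτ.le
  have hdR : d < 2 * R := by
    have : d / R < 2 := by linarith
    rwa [div_lt_iff₀ hR] at this
  have hσ8 : 8 * (R * modSmooth X (d / R)) < d := by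
    have := mul_lt_mul_of_pos_left hw hR
    have e : R * (d / R / 8) = d / 8 := by field_simp
    linarith
  have hr' : Rprime X d R = 8 * (R * modSmooth X (d / R)) * d / (d - 8 * (R * modSmooth X (d / R))) := by
    unfold Rprime omegaX
    have : d - 8 * (R * modSmooth X (d / R)) ≠ 0 := by linarith
    have h2 : 1 - 8 * (modSmooth X (d / R) / (d / R)) = (d - 8 * (R * modSmooth X (d / R))) / d := by
      field_simp
    rw [h2]
    field_simp
  have hσ0 : 0 ≤ R * modSmooth X (d / R) := by positivity
  have hest' : ∀ (y0 y1 x a p : X) (D t : ℝ), d = ‖y0 - y1‖ → 0 ≤ t → t ≤ 1 / 2 →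
      x = (1 - t) • y0 + t • y1 → x = a + D • p → ‖p‖ = 1 → 0 ≤ D → D ≤ t * d →
      R ≤ ‖R • p - (y0 - a)‖ → R ≤ ‖R • p - (y1 - a)‖ → D ≤ 6 * (R * modSmooth X (d / R)) * t := by
    intro y0 y1 x a p D t q1 q2 q3 q4 q5 q6 q7 q8 q9 q10
    have := aux_est y0 y1 x a p R D t d hR q1 q2 q3 q4 q5 q6 q7 q8 q9 q10
    linarith
  set σ := R * modSmooth X (d / R) with hσ
  have hr0 : 0 ≤ Rprime X d R := by
    rw [hr']; exact div_nonneg (by positivity) (by linarith)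
  intro a ha
  simp only [metricProjSeg, mem_iUnion] at ha
  obtain ⟨x, hx, haA, hax⟩ := ha
  obtain ⟨α, t, hα, ht, hαt, hxe⟩ := hx
  have hα' : α = 1 - t := by linarith
  subst hα'
  set D := infDist x A with hD
  have hD0 : 0 ≤ D := infDist_nonneg
  have hDt : D ≤ t * d := by
    have := infDist_le_dist_of_mem (x := x) h0
    have e : x - x0 = -(t • (x0 - x1)) := by rw [← hxe]; module
    rwa [dist_eq_norm, e, norm_neg, norm_smul, Real.norm_of_nonneg ht] at this
  have hDt' : D ≤ (1 - t) * d := by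
    have := infDist_le_dist_of_mem (x := x) h1
    have e : x - x1 = (1 - t) • (x0 - x1) := by rw [← hxe]; module
    rwa [dist_eq_norm, e, norm_smul, Real.norm_of_nonneg hα] at this
  have hDR : D < R := by nlinarith
  have hmain : D ≤ 6 * σ * t ∧ D ≤ 6 * σ * (1 - t) := by
    rcases eq_or_lt_of_le hD0 with hz | hpos
    · rw [← hz]; constructor <;> positivity
    have hn : ‖x - a‖ = D := by rw [norm_sub_rev]; exact hax
    have hp : ‖D⁻¹ • (x - a)‖ = 1 := by
      rw [norm_smul, hn, norm_inv, Real.norm_of_nonneg hD0, inv_mul_cancel₀ hpos.ne']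
    have hxa : x = a + D • (D⁻¹ • (x - a)) := by
      rw [smul_smul, mul_inv_cancel₀ hpos.ne', one_smul]; abel
    have b0 := aux_ball A R hA x a _ D haA hD hpos hDR hp hxa x0 h0
    have b1 := aux_ball A R hA x a _ D haA hD hpos hDR hp hxa x1 h1
    rcases le_total t (1 / 2) with hh | hh
    · have := hest' x0 x1 x a _ D t hdd ht hh hxe.symm hxa hp hD0 hDt b0 b1
      exact ⟨this, this.trans (mul_le_mul_of_nonneg_left (by linarith) (by positivity))⟩
    · have := hest' x1 x0 x a _ D (1 - t) (by rw [hdd, norm_sub_rev]) hα (by linarith)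
        (by rw [← hxe]; module) hxa hp hD0 hDt' b1 b0
      exact ⟨this.trans (mul_le_mul_of_nonneg_left (by linarith) (by positivity)), this⟩
  -- decomposition
  set c := midpoint ℝ x0 x1 with hc
  have hcm : c = (1 / 2 : ℝ) • x0 + (1 / 2 : ℝ) • x1 := by
    rw [hc, midpoint_eq_smul_add, smul_add]; norm_num
  have hen : ‖x1 - x0‖ = d := by rw [hdd, norm_sub_rev]
  obtain ⟨J, hJ, hJe⟩ := exists_dual_vector ℝ (x1 - x0) (by rw [hen]; exact hdp.ne')
  simp only [hen, RCLike.ofReal_real_eq_id, id] at hJe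
  have hJb : ∀ v, |J v| ≤ ‖v‖ := fun v => by
    have := J.le_opNorm v
    rwa [hJ, one_mul] at this
  set j := J (a - x) with hj
  have hjD : |j| ≤ D := (hJb _).trans_eq hax
  set w := (a - x) - (j / d) • (x1 - x0) with hwdef
  have hJw : J w = 0 := by
    rw [hwdef, map_sub, map_smul, hJe, smul_eq_mul, ← hj]; field_simp; ring
  have hwn : ‖w‖ ≤ 2 * D := by
    have := norm_sub_le (a - x) ((j / d) • (x1 - x0))
    rw [norm_smul, hen, Real.norm_eq_abs, abs_div, abs_of_pos hdp, div_mul_cancel₀ _ hdp.ne', hax]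
      at this
    linarith
  set k := t - 1 / 2 + j / d with hk
  have hak : a = c + k • (x1 - x0) + w := by
    rw [hwdef, hk, hcm, ← hxe]; module
  have hjd : |j / d| ≤ D / d := by
    rw [abs_div, abs_of_pos hdp]; exact div_le_div_of_nonneg_right hjD hdp.le
  rw [abs_le] at hjd
  have hkk : 2 * D ≤ (1 - 2 * |k|) * Rprime X d R ∧ 0 ≤ 1 - 2 * |k| := by
    have key : ∀ m : ℝ, D ≤ 6 * σ * m → D ≤ m * d → 0 ≤ m → |k| ≤ 1 / 2 - m + D / d →
        2 * D ≤ (1 - 2 * |k|) * Rprime X d R ∧ 0 ≤ 1 - 2 * |k| := by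
      intro m e1 e2 e3 e4
      have e5 : D / d ≤ m := (div_le_iff₀ hdp).mpr e2
      refine ⟨?_, by linarith⟩
      refine le_trans ?_ (mul_le_mul_of_nonneg_right
        (show 2 * m - 2 * (D / d) ≤ 1 - 2 * |k| by linarith) hr0)
      have e6 : (2 * m - 2 * (D / d)) * Rprime X d R = (2 * m * d - 2 * D) * (8 * σ) / (d - 8 * σ) := by
        rw [hr']
        field_simp
      rw [e6, le_div_iff₀ (by linarith)]
      have e7 : D ≤ 8 * σ * m := by nlinarith [mul_nonneg hσ0 e3]
      nlinarith [mul_le_mul_of_nonneg_right e7 hdp.le]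
    rcases le_total t (1 / 2) with hh | hh
    · refine key t hmain.1 hDt ht ?_
      have := hjd.2; have := hjd.1
      rw [abs_le]
      constructor
      · rw [hk]; linarith
      · rw [hk]; linarith
    · refine key (1 - t) hmain.2 hDt' hα ?_
      rw [abs_le]
      constructor
      · rw [hk]; linarith [hjd.1]
      · rw [hk]; linarith [hjd.2]
  obtain ⟨hk1, hk2⟩ := hkk
  set θ := 1 - 2 * |k| with hθ
  have hwθ : θ • (θ⁻¹ • w) = w := by
    by_cases h : θ = 0
    · have : ‖w‖ ≤ 0 := by rw [h] at hk1; linarith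
      rw [norm_le_zero_iff.mp this]; simp
    · rw [smul_smul, mul_inv_cancel₀ h, one_smul]
  have hwθn : ‖θ⁻¹ • w‖ ≤ Rprime X d R := by
    rw [norm_smul, norm_inv, Real.norm_of_nonneg hk2]
    rcases eq_or_lt_of_le hk2 with h | h
    · rw [← h]; simpa using hr0
    · rw [inv_mul_le_iff₀ h]; linarith
  set S := ({x0, x1} ∪
        (Metric.closedBall c (Rprime X d R) ∩ {v : X | QuasiOrth (v - c) (x1 - x0)})) with hS
  have hy : c + θ⁻¹ • w ∈ convexHull ℝ S := by
    apply subset_convexHull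
    refine Or.inr ⟨?_, ?_⟩
    · rw [mem_closedBall, dist_eq_norm, add_sub_cancel_left]; exact hwθn
    · intro l
      rw [add_sub_cancel_left, hen]
      have := (le_abs_self _).trans (hJb ((x1 - x0) + l • θ⁻¹ • w))
      rw [map_add, map_smul, map_smul, hJw, hJe] at this
      simpa using this
  have hx0 : x0 ∈ convexHull ℝ S := subset_convexHull _ _ (by simp [hS])
  have hx1 : x1 ∈ convexHull ℝ S := subset_convexHull _ _ (by simp [hS])
  have hcv := convex_convexHull ℝ S
  rcases le_total 0 k with hk0 | hk0
  · have := hcv hy hx1 hk2 (show 0 ≤ 2 * k by linarith) (by rw [hθ, abs_of_nonneg hk0]; ring)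
    have e : θ • (c + θ⁻¹ • w) + (2 * k) • x1 = a := by
      rw [smul_add, hwθ, hak, hθ, abs_of_nonneg hk0, hcm]; module
    rwa [e] at this
  · have := hcv hy hx0 hk2 (show 0 ≤ -(2 * k) by linarith) (by rw [hθ, abs_of_nonpos hk0]; ring)
    have e : θ • (c + θ⁻¹ • w) + (-(2 * k)) • x0 = a := by
      rw [smul_add, hwθ, hak, hθ, abs_of_nonpos hk0, hcm]; module
    rwa [e] at this
end
end

section
/- Let X be a uniformly convex and uniformly smooth real Banach space and let A ⊂ X be proximally smooth with constant R > 0. Let x0, x1 ∈ A be distinct points with ‖x0 − x1‖/R < ω_X^{-1}(1/8), fix λ ∈ [0, 1], and set x_λ = λx0 + (1 − λ)x1. Then there exists a point z_λ ∈ P_A([x0, x1]) such that ‖z_λ − x_λ‖ ≤ 4λ(1 − λ)·R′(‖x0 − x1‖, R) and z_λ − x_λ is quasi-orthogonal to x1 − x0. Moreover, the distance between (x0 + x1)/2 and any slice-projection of the midpoint (x0 + x1)/2 of [x0, x1] onto A is at most R′(‖x0 − x1‖, R). -/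
noncomputable section

open Set Metric

theorem ekeland_max {E : Type*} [MetricSpace E] [CompleteSpace E] (K : Set E) (hK : IsClosed K)
    (f : E → ℝ) (hf : Continuous f) (M : ℝ) (hM : ∀ x ∈ K, f x ≤ M) (c : ℝ) (hc : 0 < c)
    (x : E) (hx : x ∈ K) :
    ∃ w ∈ K, f x + c * dist x w ≤ f w ∧ ∀ w' ∈ K, f w + c * dist w w' ≤ f w' → w' = w := by
  let S : E → Set E := fun y => {w | w ∈ K ∧ f y + c * dist y w ≤ f w}
  have hSc : ∀ y, IsClosed (S y) := fun y =>
    hK.inter (isClosed_le (by fun_prop) hf)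
  have hself : ∀ y ∈ K, y ∈ S y := fun y hy => ⟨hy, by simp⟩
  have htr : ∀ y z w, z ∈ S y → w ∈ S z → w ∈ S y := by
    rintro y z w ⟨_, h1⟩ ⟨h2, h3⟩
    refine ⟨h2, ?_⟩
    have := mul_le_mul_of_nonneg_left (dist_triangle y z w) hc.le
    linarith
  have hstep : ∀ y : K, ∃ y' : K, y'.1 ∈ S y.1 ∧ ∀ w ∈ S y.1, f w - f y'.1 ≤ f y'.1 - f y.1 := by
    rintro ⟨y, hy⟩
    have hb : BddAbove (f '' S y) := ⟨M, by rintro _ ⟨w, hw, rfl⟩; exact hM w hw.1⟩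
    have hle : ∀ w ∈ S y, f w ≤ sSup (f '' S y) := fun w hw => le_csSup hb ⟨w, hw, rfl⟩
    rcases (hle y (hself y hy)).eq_or_lt with h | h
    · refine ⟨⟨y, hy⟩, hself y hy, fun w hw => ?_⟩
      have := hle w hw
      simp only
      linarith
    · obtain ⟨_, ⟨y', hy', rfl⟩, h'⟩ := exists_lt_of_lt_csSup (s := f '' S y)
        (b := (f y + sSup (f '' S y)) / 2) ⟨_, y, hself y hy, rfl⟩ (by linarith)
      refine ⟨⟨y', hy'.1⟩, hy', fun w hw => ?_⟩
      have := hle w hw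
      simp only
      linarith
  choose g hg1 hg2 using hstep
  let u : ℕ → K := fun n => g^[n] ⟨x, hx⟩
  have hu : ∀ n, u (n + 1) = g (u n) := fun n => Function.iterate_succ_apply' g n _
  have hmem : ∀ n m, n ≤ m → (u m).1 ∈ S (u n).1 := by
    intro n m h
    induction m, h using Nat.le_induction with
    | base => exact hself _ (u n).2
    | succ m hm ih => exact htr _ _ _ ih (by rw [hu]; exact hg1 _)
  have hmono : Monotone (fun n => f (u n).1) := by
    intro n m h
    have := (hmem n m h).2
    have h2 := mul_nonneg hc.le (dist_nonneg (x := (u n).1) (y := (u m).1))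
    simp only
    linarith
  have hlim := tendsto_atTop_ciSup hmono ⟨M, by rintro _ ⟨n, rfl⟩; exact hM _ (u n).2⟩
  set L := ⨆ n, f (u n).1 with hL
  have hleL : ∀ n, f (u n).1 ≤ L := fun n => hmono.ge_of_tendsto hlim n
  have hcs : CauchySeq (fun n => (u n).1) := by
    refine cauchySeq_of_le_tendsto_0' (fun n => (L - f (u n).1) / c) ?_ ?_
    · intro n m h
      rw [le_div_iff₀ hc]
      have := (hmem n m h).2
      have := hleL m
      linarith
    · have := (hlim.const_sub L).div_const c
      simpa using this
  obtain ⟨w, hw⟩ := cauchySeq_tendsto_of_complete hcs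
  have hwS : ∀ n, w ∈ S (u n).1 := fun n =>
    (hSc _).mem_of_tendsto hw (Filter.eventually_atTop.2 ⟨n, fun m hm => hmem n m hm⟩)
  have hfw : f w = L := tendsto_nhds_unique ((hf.tendsto w).comp hw) hlim
  refine ⟨w, (hwS 0).1, (hwS 0).2, fun w' hw' h => ?_⟩
  have h1 : ∀ n, f w' - f (u (n+1)).1 ≤ f (u (n+1)).1 - f (u n).1 := fun n => by
    have := hg2 (u n) w' (htr _ _ _ (hwS n) ⟨hw', h⟩)
    rwa [← hu] at this
  have h2 : f w' - L ≤ L - L := by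
    have hs := hlim.comp (Filter.tendsto_add_atTop_nat 1)
    exact le_of_tendsto_of_tendsto' (hs.const_sub (f w')) (hs.sub hlim) h1
  have h3 : dist w w' = 0 := by
    have := dist_nonneg (x := w) (y := w')
    nlinarith
  exact (dist_eq_zero.1 h3).symm

theorem uc_dual {X : Type*} [NormedAddCommGroup X] [NormedSpace ℝ X] [UniformConvexSpace X]
    (ε : ℝ) (hε : 0 < ε) : ∃ δ > 0, ∀ (φ : X →L[ℝ] ℝ) (u v : X), ‖φ‖ ≤ 1 → ‖u‖ = 1 → ‖v‖ = 1 →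
      1 - δ ≤ φ u → 1 - δ ≤ φ v → ‖u - v‖ < ε := by
  obtain ⟨δ, hδ, h⟩ := exists_forall_sphere_dist_add_le_two_sub X hε
  refine ⟨δ / 3, by positivity, fun φ u v hφ hu hv h1 h2 => ?_⟩
  by_contra! hc
  have h3 := h hu hv hc
  have h4 : φ (u + v) ≤ ‖u + v‖ := (le_abs_self _).trans
    ((φ.le_opNorm _).trans (mul_le_of_le_one_left (norm_nonneg _) hφ))
  rw [map_add] at h4
  linarith

theorem near_min {X : Type*} [NormedAddCommGroup X] [NormedSpace ℝ X]
    {A : Set X} {x : X} {φ : X →L[ℝ] ℝ} (hφ : HasFDerivAt (fun x => Metric.infDist x A) φ x)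
    (η : ℝ) (hη : 0 < η) : ∃ δ > 0, ∀ a ∈ A, ‖x - a‖ < Metric.infDist x A + δ →
      ‖x - a‖ - η ≤ φ (x - a) := by
  set D := Metric.infDist x A with hD
  have hD0 : 0 ≤ D := Metric.infDist_nonneg
  have hη' : 0 < η / (2 * (D + 1)) := by positivity
  have h1 := (hasFDerivAt_iff_isLittleO_nhds_zero.1 hφ).def hη'
  obtain ⟨r, hr, h2⟩ := Metric.eventually_nhds_iff.1 h1
  set t := min 1 (r / (2 * (D + 1))) with ht
  have ht0 : 0 < t := by positivity
  have ht1 : t ≤ 1 := min_le_left _ _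
  have htr : t * (D + 1) < r := by
    have : t ≤ r / (2 * (D + 1)) := min_le_right _ _
    rw [le_div_iff₀ (by positivity)] at this
    linarith
  refine ⟨min 1 (t * η / 2), by positivity, fun a ha hxa => ?_⟩
  have hxa1 : ‖x - a‖ < D + 1 := hxa.trans_le (by gcongr; exact min_le_left _ _)
  have hxa2 : ‖x - a‖ < D + t * η / 2 := hxa.trans_le (by gcongr; exact min_le_right _ _)
  have hn : ‖t • (a - x)‖ = t * ‖x - a‖ := by
    rw [norm_smul, Real.norm_of_nonneg ht0.le, norm_sub_rev]
  have h3 := h2 (y := t • (a - x)) (by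
    rw [dist_zero_right, hn]
    exact (mul_le_mul_of_nonneg_left hxa1.le ht0.le).trans_lt htr)
  rw [hn, Real.norm_eq_abs] at h3
  have h4 := (abs_le.1 h3).1
  have h5 : Metric.infDist (x + t • (a - x)) A ≤ (1 - t) * ‖x - a‖ := by
    refine (Metric.infDist_le_dist_of_mem ha).trans ?_
    rw [dist_eq_norm, show x + t • (a - x) - a = (1 - t) • (x - a) by module, norm_smul,
      Real.norm_of_nonneg (by linarith)]
  have h6 : φ (t • (a - x)) = - (t * φ (x - a)) := by
    rw [map_smul, smul_eq_mul, ← neg_sub x a, map_neg]; ring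
  have h7 : η / (2 * (D + 1)) * (t * ‖x - a‖) ≤ t * η / 2 := by
    calc _ ≤ η / (2 * (D + 1)) * (t * (D + 1)) := by gcongr
      _ = _ := by field_simp
  have h8 : t * (‖x - a‖ - η) ≤ t * φ (x - a) := by
    have : Metric.infDist x A = D := rfl
    simp only [this] at h4
    rw [h6] at h4
    nlinarith
  exact le_of_mul_le_mul_left h8 ht0

theorem norm_le_one_of {X : Type*} [NormedAddCommGroup X] [NormedSpace ℝ X]
    {A : Set X} {x : X} {φ : X →L[ℝ] ℝ} (hφ : HasFDerivAt (fun x => Metric.infDist x A) φ x) :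
    ‖φ‖ ≤ 1 := by
  rw [← hφ.fderiv]
  exact_mod_cast norm_fderiv_le_of_lipschitz ℝ (Metric.lipschitz_infDist_pt A)

theorem near_unit {X : Type*} [NormedAddCommGroup X] [NormedSpace ℝ X]
    {A : Set X} (hA : A.Nonempty) {x : X} {φ : X →L[ℝ] ℝ} (hx : 0 < Metric.infDist x A)
    (hφ : HasFDerivAt (fun x => Metric.infDist x A) φ x)
    (η : ℝ) (hη : 0 < η) : ∃ e : X, ‖e‖ = 1 ∧ 1 - η ≤ φ e := by
  obtain ⟨δ, hδ, h⟩ := near_min hφ (η * Metric.infDist x A) (by positivity)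
  obtain ⟨a, ha, hxa⟩ := (Metric.infDist_lt_iff hA).1
    (show Metric.infDist x A < Metric.infDist x A + δ by linarith)
  rw [dist_eq_norm] at hxa
  have h1 : Metric.infDist x A ≤ ‖x - a‖ := by
    rw [← dist_eq_norm]; exact Metric.infDist_le_dist_of_mem ha
  have hpos : 0 < ‖x - a‖ := by linarith
  refine ⟨‖x - a‖⁻¹ • (x - a), norm_smul_inv_norm (norm_pos_iff.1 hpos), ?_⟩
  rw [map_smul, smul_eq_mul, ← div_eq_inv_mul, le_div_iff₀ hpos]
  have := h a ha hxa
  nlinarith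

theorem well_posed {X : Type*} [NormedAddCommGroup X] [NormedSpace ℝ X] [UniformConvexSpace X]
    {A : Set X} {x : X} {φ : X →L[ℝ] ℝ} (hx : 0 < Metric.infDist x A)
    (hφ : HasFDerivAt (fun x => Metric.infDist x A) φ x)
    (ε : ℝ) (hε : 0 < ε) : ∃ δ > 0, ∀ a ∈ A, ∀ b ∈ A, ‖x - a‖ < Metric.infDist x A + δ →
      ‖x - b‖ < Metric.infDist x A + δ → ‖a - b‖ < ε := by
  set D := Metric.infDist x A with hD
  obtain ⟨δ₁, hδ₁, h1⟩ := uc_dual (X := X) (ε / (2 * (D + 1))) (by positivity)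
  obtain ⟨δ₂, hδ₂, h2⟩ := near_min hφ (δ₁ * D) (by positivity)
  have key : ∀ a ∈ A, ‖x - a‖ < D + δ₂ → ‖‖x - a‖⁻¹ • (x - a)‖ = 1 ∧
      1 - δ₁ ≤ φ (‖x - a‖⁻¹ • (x - a)) := by
    intro a ha hxa
    have h1 : D ≤ ‖x - a‖ := by
      rw [← dist_eq_norm]; exact Metric.infDist_le_dist_of_mem ha
    have hpos : 0 < ‖x - a‖ := by linarith
    refine ⟨norm_smul_inv_norm (norm_pos_iff.1 hpos), ?_⟩
    rw [map_smul, smul_eq_mul, ← div_eq_inv_mul, le_div_iff₀ hpos]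
    have := h2 a ha hxa
    nlinarith
  refine ⟨min δ₂ (min 1 (ε / 2)), by positivity, fun a ha b hb hxa hxb => ?_⟩
  have m1 : min δ₂ (min 1 (ε / 2)) ≤ δ₂ := min_le_left _ _
  have m2 : min δ₂ (min 1 (ε / 2)) ≤ 1 := (min_le_right _ _).trans (min_le_left _ _)
  have m3 : min δ₂ (min 1 (ε / 2)) ≤ ε / 2 := (min_le_right _ _).trans (min_le_right _ _)
  have ha0 : D ≤ ‖x - a‖ := by
    rw [← dist_eq_norm]; exact Metric.infDist_le_dist_of_mem ha
  have hb0 : D ≤ ‖x - b‖ := by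
    rw [← dist_eq_norm]; exact Metric.infDist_le_dist_of_mem hb
  obtain ⟨ka1, ka2⟩ := key a ha (by linarith)
  obtain ⟨kb1, kb2⟩ := key b hb (by linarith)
  have h3 := h1 φ _ _ (norm_le_one_of hφ) ka1 kb1 ka2 kb2
  have hna : ‖x - a‖ ≠ 0 := by linarith
  have hnb : ‖x - b‖ ≠ 0 := by linarith
  set u := ‖x - a‖⁻¹ • (x - a) with hu
  set v := ‖x - b‖⁻¹ • (x - b) with hv
  have hau : x - a = ‖x - a‖ • u := by rw [hu, smul_smul, mul_inv_cancel₀ hna, one_smul]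
  have hbv : x - b = ‖x - b‖ • v := by rw [hv, smul_smul, mul_inv_cancel₀ hnb, one_smul]
  have h4 : a - b = -(‖x - a‖ • (u - v) + (‖x - a‖ - ‖x - b‖) • v) := by
    have : -(‖x - a‖ • (u - v) + (‖x - a‖ - ‖x - b‖) • v) = ‖x - b‖ • v - ‖x - a‖ • u := by module
    rw [this, ← hau, ← hbv]; abel
  rw [h4, norm_neg]
  have h5 : |‖x - a‖ - ‖x - b‖| ≤ ε / 2 := by rw [abs_le]; constructor <;> linarith
  calc _ ≤ ‖x - a‖ * ‖u - v‖ + |‖x - a‖ - ‖x - b‖| * ‖v‖ := by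
        refine (norm_add_le _ _).trans ?_
        rw [norm_smul, norm_smul, Real.norm_eq_abs, Real.norm_eq_abs, abs_norm]
    _ ≤ ‖x - a‖ * ‖u - v‖ + ε / 2 := by rw [kb1, mul_one]; gcongr
    _ < (D + 1) * (ε / (2 * (D + 1))) + ε / 2 := by
        gcongr
        linarith
    _ = ε := by field_simp; ring

theorem proj_exists {X : Type*} [NormedAddCommGroup X] [NormedSpace ℝ X] [CompleteSpace X]
    [UniformConvexSpace X] {A : Set X} (hA : A.Nonempty) (hAc : IsClosed A) {x : X}
    {φ : X →L[ℝ] ℝ} (hx : 0 < Metric.infDist x A)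
    (hφ : HasFDerivAt (fun x => Metric.infDist x A) φ x) :
    ∃ a ∈ A, ‖x - a‖ = Metric.infDist x A := by
  have : ∀ n : ℕ, ∃ a ∈ A, dist x a < Metric.infDist x A + 1 / ((n : ℝ) + 1) := fun n =>
    (Metric.infDist_lt_iff hA).1 (by have : 0 < 1 / ((n : ℝ) + 1) := by positivity
                                     linarith)
  choose a ha hxa using this
  have hcs : CauchySeq a := by
    rw [Metric.cauchySeq_iff]
    intro ε hε
    obtain ⟨δ, hδ, h⟩ := well_posed hx hφ ε hε
    obtain ⟨N, hN⟩ := exists_nat_one_div_lt hδ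
    have hh : ∀ n ≥ N, ‖x - a n‖ < Metric.infDist x A + δ := fun n hn => by
      rw [← dist_eq_norm]
      have : 1 / ((n : ℝ) + 1) ≤ 1 / ((N : ℝ) + 1) := by
        gcongr
      linarith [hxa n]
    refine ⟨N, fun m hm n hn => ?_⟩
    rw [dist_eq_norm]
    exact h _ (ha m) _ (ha n) (hh m hm) (hh n hn)
  obtain ⟨w, hw⟩ := cauchySeq_tendsto_of_complete hcs
  have hwA := hAc.mem_of_tendsto hw (Filter.Eventually.of_forall ha)
  refine ⟨w, hwA, ?_⟩
  rw [← dist_eq_norm]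
  refine le_antisymm ?_ (Metric.infDist_le_dist_of_mem hwA)
  have h1 : Filter.Tendsto (fun n => dist x (a n)) Filter.atTop (nhds (dist x w)) :=
    tendsto_const_nhds.dist hw
  have h2 := (tendsto_const_nhds (x := Metric.infDist x A)).add
    tendsto_one_div_add_atTop_nhds_zero_nat
  have := le_of_tendsto_of_tendsto' h1 h2 (fun n => (hxa n).le)
  simpa using this

theorem climb {X : Type*} [NormedAddCommGroup X] [NormedSpace ℝ X] [CompleteSpace X]
    {A : Set X} (hA : A.Nonempty) {R : ℝ}
    (hdiff : ∀ y, 0 < Metric.infDist y A → Metric.infDist y A < R →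
      DifferentiableAt ℝ (fun x => Metric.infDist x A) y)
    {x : X} (hx : 0 < Metric.infDist x A) {s : ℝ} (hs : 0 < s) (hsR : Metric.infDist x A + s < R)
    {ε : ℝ} (hε : 0 < ε) (hε1 : ε < 1) :
    ∃ w, ‖w - x‖ = s ∧ Metric.infDist x A + (1 - ε) * s ≤ Metric.infDist w A := by
  have hbd : ∀ y ∈ Metric.closedBall x s, Metric.infDist y A ≤ Metric.infDist x A + s := by
    intro y hy
    exact (Metric.infDist_le_infDist_add_dist (x := y) (y := x)).trans (by gcongr; exact hy)
  obtain ⟨w, hwK, hw1, hw2⟩ := ekeland_max (Metric.closedBall x s) Metric.isClosed_closedBall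
    (fun y => Metric.infDist y A) (Metric.continuous_infDist_pt A) _ hbd (1 - ε) (by linarith) x
    (Metric.mem_closedBall_self hs.le)
  have hc : 0 ≤ (1 - ε) * dist x w := mul_nonneg (by linarith) dist_nonneg
  have hws : dist w x ≤ s := hwK
  have hw0 : dist w x = s := by
    by_contra hne
    have hlt : dist w x < s := lt_of_le_of_ne hws hne
    have hpos : 0 < Metric.infDist w A := by linarith
    have hd := (hdiff w hpos (by linarith [hbd w hwK])).hasFDerivAt
    obtain ⟨e, he1, he2⟩ := near_unit hA hpos hd (ε / 2) (by positivity)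
    obtain ⟨r, hr, h2⟩ := Metric.eventually_nhds_iff.1
      ((hasFDerivAt_iff_isLittleO_nhds_zero.1 hd).def (show 0 < ε / 2 by positivity))
    set t := min (r / 2) (s - dist w x) with ht
    have ht0 : 0 < t := lt_min (by positivity) (by linarith)
    have htr : t ≤ r / 2 := min_le_left _ _
    have hts : t ≤ s - dist w x := min_le_right _ _
    have hn : ‖t • e‖ = t := by rw [norm_smul, he1, Real.norm_of_nonneg ht0.le, mul_one]
    have h3 := h2 (y := t • e) (by rw [dist_zero_right, hn]; linarith)
    rw [hn, Real.norm_eq_abs, map_smul, smul_eq_mul] at h3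
    have h4 := (abs_le.1 h3).1
    have hdw : dist w (w + t • e) = t := by rw [dist_self_add_right, hn]
    have h5 := hw2 (w + t • e) (by
      rw [Metric.mem_closedBall]
      have := dist_triangle (w + t • e) w x
      rw [dist_comm _ w, hdw] at this
      linarith) (by
      rw [hdw]
      have := mul_le_mul_of_nonneg_left he2 ht0.le
      linarith)
    rw [h5, dist_self] at hdw
    linarith
  refine ⟨w, by rw [← dist_eq_norm, hw0], ?_⟩
  rw [dist_comm, hw0] at hw1
  exact hw1

theorem ray {X : Type*} [NormedAddCommGroup X] [NormedSpace ℝ X] [CompleteSpace X]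
    [UniformConvexSpace X]
    {A : Set X} (hA : A.Nonempty) {R : ℝ}
    (hdiff : ∀ y, 0 < Metric.infDist y A → Metric.infDist y A < R →
      DifferentiableAt ℝ (fun x => Metric.infDist x A) y)
    {x z v : X} {D : ℝ} (hD : Metric.infDist x A = D) (hx : 0 < D) (hz : z ∈ A)
    (hv : ‖v‖ = 1) (hxz : x - z = D • v)
    {s : ℝ} (hs : 0 < s) (hsR : D + s < R) :
    D + s ≤ Metric.infDist (x + s • v) A := by
  by_contra! hlt
  set g := D + s - Metric.infDist (x + s • v) A with hg
  have hg0 : 0 < g := by linarith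
  obtain ⟨δ, hδ, hu⟩ := uc_dual (X := X) (g / (2 * s)) (by positivity)
  set ε := min (min (1 / 2) δ) (min (δ * D / s) (g / (2 * s))) with hε
  have hε0 : 0 < ε := by positivity
  have e1 : ε ≤ 1 / 2 := (min_le_left _ _).trans (min_le_left _ _)
  have e2 : ε ≤ δ := (min_le_left _ _).trans (min_le_right _ _)
  have e3 : ε ≤ δ * D / s := (min_le_right _ _).trans (min_le_left _ _)
  have e4 : ε ≤ g / (2 * s) := (min_le_right _ _).trans (min_le_right _ _)
  rw [le_div_iff₀ hs] at e3
  rw [le_div_iff₀ (by positivity)] at e4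
  obtain ⟨w, hw1, hw2⟩ := climb hA hdiff (x := x) (by rw [hD]; exact hx) hs (by rwa [hD]) hε0
    (by linarith)
  rw [hD] at hw2
  obtain ⟨ψ, hψ, hψw⟩ := exists_dual_vector'' ℝ (w - z)
  have hle : ∀ y, ψ y ≤ ‖y‖ := fun y => (le_abs_self _).trans
    ((ψ.le_opNorm _).trans (mul_le_of_le_one_left (norm_nonneg _) hψ))
  have h1 : Metric.infDist w A ≤ ‖w - z‖ := by
    rw [← dist_eq_norm]; exact Metric.infDist_le_dist_of_mem hz
  have hψw' : ψ (w - z) = ‖w - z‖ := hψw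
  have h2 : ψ (w - z) = ψ (w - x) + D * ψ v := by
    rw [show w - z = (w - x) + (x - z) by abel, map_add, hxz, map_smul, smul_eq_mul]
  have h3 := hle (w - x)
  have h4 := hle v
  rw [hw1] at h3
  rw [hv] at h4
  have h5 : 1 - δ ≤ ψ v := by
    have : D * (1 - δ) ≤ D * ψ v := by nlinarith
    exact le_of_mul_le_mul_left this hx
  have hw1' : ‖s⁻¹ • (w - x)‖ = 1 := by
    rw [norm_smul, hw1, Real.norm_of_nonneg (by positivity), inv_mul_cancel₀ hs.ne']
  have h6 : 1 - δ ≤ ψ (s⁻¹ • (w - x)) := by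
    rw [map_smul, smul_eq_mul, ← div_eq_inv_mul, le_div_iff₀ hs]
    nlinarith
  have h7 := hu ψ _ _ hψ hw1' hv h6 h5
  have h8 : dist (x + s • v) w = s * ‖s⁻¹ • (w - x) - v‖ := by
    rw [dist_eq_norm, norm_sub_rev, ← Real.norm_of_nonneg hs.le, ← norm_smul, 
      Real.norm_of_nonneg hs.le, smul_sub, smul_smul, mul_inv_cancel₀ hs.ne', one_smul]
    congr 1; abel
  have h9 : s * ‖s⁻¹ • (w - x) - v‖ < s * (g / (2 * s)) := by gcongr
  have h10 : s * (g / (2 * s)) = g / 2 := by field_simp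
  have h11 := Metric.infDist_le_infDist_add_dist (s := A) (x := w) (y := x + s • v)
  rw [dist_comm, h8] at h11
  linarith

theorem supp_ball {X : Type*} [NormedAddCommGroup X] [NormedSpace ℝ X] [CompleteSpace X]
    [UniformConvexSpace X]
    {A : Set X} (hA : A.Nonempty) {R : ℝ}
    (hdiff : ∀ y, 0 < Metric.infDist y A → Metric.infDist y A < R →
      DifferentiableAt ℝ (fun x => Metric.infDist x A) y)
    {x z v : X} {D : ℝ} (hD : Metric.infDist x A = D) (hx : 0 < D) (hDR : D < R) (hz : z ∈ A)
    (hv : ‖v‖ = 1) (hxz : x - z = D • v) {b : X} (hb : b ∈ A) :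
    R ≤ ‖x + (R - D) • v - b‖ := by
  by_contra! hlt
  set g := R - ‖x + (R - D) • v - b‖ with hg
  have hg0 : 0 < g := by linarith
  set η := min (g / 4) ((R - D) / 2) with hη
  have hη0 : 0 < η := lt_min (by linarith) (by linarith)
  have e1 : η ≤ g / 4 := min_le_left _ _
  have e2 : η ≤ (R - D) / 2 := min_le_right _ _
  have h1 := ray hA hdiff hD hx hz hv hxz (s := R - D - η) (by linarith) (by linarith)
  have h2 := Metric.infDist_le_dist_of_mem (x := x + (R - D - η) • v) hb
  have h3 : dist (x + (R - D - η) • v) b ≤ ‖x + (R - D) • v - b‖ + η := by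
    rw [dist_eq_norm, show x + (R - D - η) • v - b = (x + (R - D) • v - b) - η • v by module]
    refine (norm_sub_le _ _).trans ?_
    rw [norm_smul, hv, Real.norm_of_nonneg hη0.le, mul_one]
  linarith

theorem ms_bdd (X : Type*) [NormedAddCommGroup X] [NormedSpace ℝ X] (τ : ℝ) :
    BddAbove {r : ℝ | ∃ x y : X, ‖x‖ = 1 ∧ ‖y‖ = τ ∧ r = (‖x + y‖ + ‖x - y‖) / 2 - 1} := by
  refine ⟨τ, ?_⟩
  rintro _ ⟨x, y, hx, hy, rfl⟩
  have := norm_add_le x y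
  have := norm_sub_le x y
  linarith

theorem le_ms {X : Type*} [NormedAddCommGroup X] [NormedSpace ℝ X] (x y : X) (hx : ‖x‖ = 1) :
    (‖x + y‖ + ‖x - y‖) / 2 - 1 ≤ modSmooth X ‖y‖ :=
  le_csSup (ms_bdd X _) ⟨x, y, hx, rfl, rfl⟩

theorem exists_unit (X : Type*) [NormedAddCommGroup X] [NormedSpace ℝ X] [Nontrivial X] :
    ∃ x : X, ‖x‖ = 1 := exists_norm_eq X zero_le_one

theorem ms_ge (X : Type*) [NormedAddCommGroup X] [NormedSpace ℝ X] [Nontrivial X] {τ : ℝ}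
    (hτ : 0 ≤ τ) : τ - 1 ≤ modSmooth X τ ∧ 0 ≤ modSmooth X τ := by
  obtain ⟨x, hx⟩ := exists_unit X
  have h1 : ‖τ • x‖ = τ := by rw [norm_smul, hx, Real.norm_of_nonneg hτ, mul_one]
  have h := le_ms x (τ • x) hx
  rw [h1] at h
  have h2 : ‖x + τ • x‖ = 1 + τ := by
    rw [show x + τ • x = (1 + τ) • x by module, norm_smul, hx, Real.norm_of_nonneg (by linarith),
      mul_one]
  have h3 : ‖x - τ • x‖ = |1 - τ| := by
    rw [show x - τ • x = (1 - τ) • x by module, norm_smul, hx, Real.norm_eq_abs, mul_one]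
  rw [h2, h3] at h
  have := le_abs_self (1 - τ)
  have := neg_le_abs (1 - τ)
  constructor <;> linarith

theorem ms_zero (X : Type*) [NormedAddCommGroup X] [NormedSpace ℝ X] [Nontrivial X] :
    modSmooth X 0 = 0 := by
  refine le_antisymm ?_ (ms_ge X le_rfl).2
  obtain ⟨x, hx⟩ := exists_unit X
  refine csSup_le ⟨_, x, 0, hx, norm_zero, rfl⟩ ?_
  rintro _ ⟨x, y, hx, hy, rfl⟩
  rw [norm_eq_zero] at hy
  simp [hy, hx]

theorem ms_convex (X : Type*) [NormedAddCommGroup X] [NormedSpace ℝ X] [Nontrivial X] :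
    ConvexOn ℝ (Set.Ici 0) (modSmooth X) := by
  refine ⟨convex_Ici 0, ?_⟩
  intro σ hσ τ hτ a b ha hb hab
  simp only [Set.mem_Ici, smul_eq_mul] at *
  have ht : 0 ≤ a * σ + b * τ := by positivity
  have hr : 0 ≤ a * modSmooth X σ + b * modSmooth X τ :=
    add_nonneg (mul_nonneg ha (ms_ge X hσ).2) (mul_nonneg hb (ms_ge X hτ).2)
  rcases ht.eq_or_lt with h | h
  · rw [← h, ms_zero]; exact hr
  obtain ⟨x, hx⟩ := exists_unit X
  refine csSup_le ⟨_, x, (a * σ + b * τ) • x, hx,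
    by rw [norm_smul, hx, Real.norm_of_nonneg ht, mul_one], rfl⟩ ?_
  rintro _ ⟨x, y, hx, hy, rfl⟩
  obtain ⟨e, he, hye⟩ : ∃ e : X, ‖e‖ = 1 ∧ y = (a * σ + b * τ) • e := by
    refine ⟨(a * σ + b * τ)⁻¹ • y, ?_, ?_⟩
    · rw [norm_smul, hy, Real.norm_of_nonneg (by positivity), inv_mul_cancel₀ h.ne']
    · rw [smul_smul, mul_inv_cancel₀ h.ne', one_smul]
  have h1 := le_ms x (σ • e) hx
  have h2 := le_ms x (τ • e) hx
  rw [norm_smul, he, Real.norm_of_nonneg hσ, mul_one] at h1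
  rw [norm_smul, he, Real.norm_of_nonneg hτ, mul_one] at h2
  have hb' : b = 1 - a := by linarith
  have h3 : ‖x + y‖ ≤ a * ‖x + σ • e‖ + b * ‖x + τ • e‖ := by
    rw [hye, show x + (a * σ + b * τ) • e = a • (x + σ • e) + b • (x + τ • e) by
      rw [hb']; module]
    refine (norm_add_le _ _).trans ?_
    rw [norm_smul, norm_smul, Real.norm_of_nonneg ha, Real.norm_of_nonneg hb]
  have h4 : ‖x - y‖ ≤ a * ‖x - σ • e‖ + b * ‖x - τ • e‖ := by
    rw [hye, show x - (a * σ + b * τ) • e = a • (x - σ • e) + b • (x - τ • e) by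
      rw [hb']; module]
    refine (norm_add_le _ _).trans ?_
    rw [norm_smul, norm_smul, Real.norm_of_nonneg ha, Real.norm_of_nonneg hb]
  have h5 := mul_le_mul_of_nonneg_left h1 ha
  have h6 := mul_le_mul_of_nonneg_left h2 hb
  nlinarith

theorem ms_scale (X : Type*) [NormedAddCommGroup X] [NormedSpace ℝ X] [Nontrivial X] {θ τ : ℝ}
    (hτ : 0 ≤ τ) (h0 : 0 ≤ θ) (h1 : θ ≤ 1) : modSmooth X (θ * τ) ≤ θ * modSmooth X τ := by
  have := (ms_convex X).2 (x := τ) hτ (y := 0) (Set.mem_Ici.2 le_rfl) h0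
    (show 0 ≤ 1 - θ by linarith) (by ring)
  simpa [ms_zero] using this

theorem omega_spec (X : Type*) [NormedAddCommGroup X] [NormedSpace ℝ X] [Nontrivial X]
    (hsm : UnifSmooth X) {t : ℝ} (ht : 0 < t) (htt : t < omegaInv X (1 / 8)) :
    omegaX X t < 1 / 8 := by
  have hsmall : ∀ r > 0, ∃ s, 0 < s ∧ s < r ∧ omegaX X s < 1 / 8 := by
    intro r hr
    have h1 : ∀ᶠ s in nhdsWithin (0 : ℝ) (Set.Ioi 0), omegaX X s < 1 / 8 :=
      hsm.eventually_lt_const (by norm_num)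
    have h2 : ∀ᶠ s in nhdsWithin (0 : ℝ) (Set.Ioi 0), s ∈ Set.Ioo 0 r := Ioo_mem_nhdsGT hr
    obtain ⟨s, hs1, hs2⟩ := (h1.and h2).exists
    exact ⟨s, hs2.1, hs2.2, hs1⟩
  have hcont : ContinuousOn (omegaX X) (Set.Ioi 0) := by
    have h1 : ContinuousOn (modSmooth X) (Set.Ioi 0) :=
      ((ms_convex X).subset Set.Ioi_subset_Ici_self (convex_Ioi 0)).continuousOn isOpen_Ioi
    exact h1.div continuousOn_id (fun x hx => (ne_of_gt hx))
  have hex : ∃ r, omegaX X r = 1 / 8 := by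
    obtain ⟨s, hs0, hs2, hs⟩ := hsmall 2 (by norm_num)
    have h2 : 1 / 8 ≤ omegaX X 2 := by
      unfold omegaX
      have := (ms_ge X (show (0:ℝ) ≤ 2 by norm_num)).1
      linarith
    obtain ⟨r, _, hr⟩ := intermediate_value_Icc hs2.le
      (hcont.mono (fun y hy => lt_of_lt_of_le hs0 hy.1)) ⟨hs.le, h2⟩
    exact ⟨r, hr⟩
  have hT : omegaX X (omegaInv X (1 / 8)) = 1 / 8 := Function.invFun_eq hex
  set T := omegaInv X (1 / 8)
  obtain ⟨s, hs0, hst, hs⟩ := hsmall t ht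
  unfold omegaX at *
  have hT0 : 0 < T := ht.trans htt
  rw [div_lt_iff₀ hs0] at hs
  rw [div_eq_iff hT0.ne'] at hT
  rw [div_lt_iff₀ ht]
  have hTs : 0 < T - s := by linarith
  have := (ms_convex X).2 (Set.mem_Ici.2 hs0.le) (Set.mem_Ici.2 hT0.le)
    (show 0 ≤ (T - t) / (T - s) from div_nonneg (by linarith) hTs.le)
    (show 0 ≤ (t - s) / (T - s) from div_nonneg (by linarith) hTs.le) (by field_simp; ring)
  simp only [smul_eq_mul] at this
  have e : (T - t) / (T - s) * s + (t - s) / (T - s) * T = t := by field_simp; ring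
  rw [e, hT] at this
  have h3 : (T - t) / (T - s) * modSmooth X s < (T - t) / (T - s) * (1 / 8 * s) :=
    mul_lt_mul_of_pos_left hs (div_pos (by linarith) hTs)
  linarith

theorem smooth_est {X : Type*} [NormedAddCommGroup X] [NormedSpace ℝ X] (v w : X) (hv : ‖v‖ = 1)
    (ψ : X →L[ℝ] ℝ) (hψ : ‖ψ‖ ≤ 1) (hψv : ψ v = 1) :
    ‖v + w‖ ≤ 1 + ψ w + 2 * modSmooth X ‖w‖ := by
  have h1 := le_ms v w hv
  have h2 : ψ (v - w) ≤ ‖v - w‖ := (le_abs_self _).trans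
    ((ψ.le_opNorm _).trans (mul_le_of_le_one_left (norm_nonneg _) hψ))
  rw [map_sub, hψv] at h2
  linarith

theorem D_bound {X : Type*} [NormedAddCommGroup X] [NormedSpace ℝ X] [Nontrivial X]
    {R D μ : ℝ} (hR : 0 < R) (hD : 0 < D) (hDR : D < R) (h0 : 0 ≤ μ) (h1 : μ ≤ 1)
    {v w : X} (hv : ‖v‖ = 1) 
    (ha : R ≤ ‖(R - D) • v - (1 - μ) • w‖) (hb : R ≤ ‖(R - D) • v + μ • w‖) :
    D ≤ 8 * (μ * (1 - μ)) * (R * modSmooth X (‖w‖ / R)) := by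
  obtain ⟨ψ, hψ, hψv'⟩ := exists_dual_vector'' ℝ v
  have hψv : ψ v = 1 := by rw [hψv', hv]; rfl
  set w' := R⁻¹ • w with hw'
  have hww : w = R • w' := by rw [hw', smul_smul, mul_inv_cancel₀ hR.ne', one_smul]
  have hnw : ‖w'‖ = ‖w‖ / R := by
    rw [hw', norm_smul, Real.norm_of_nonneg (by positivity), div_eq_inv_mul]
  set τ := ‖w‖ / R with hτ
  have hτ0 : 0 ≤ τ := by positivity
  set ρ := modSmooth X τ with hρ
  obtain ⟨hρ1, hρ0⟩ := ms_ge X hτ0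
  have est : ∀ s : ℝ, |s| ≤ 1 → ‖(R - D) • v + s • w‖ ≤
      (R - D) * (1 + s * ψ w' + 2 * (|s| * ρ)) + D * (|s| * τ) := by
    intro s hs
    have e : (R - D) • v + s • w = (R - D) • (v + s • w') + (D * s) • w' := by
      rw [hww]; module
    have k1 := smooth_est v (s • w') hv ψ hψ hψv
    rw [norm_smul, hnw, Real.norm_eq_abs, map_smul, smul_eq_mul] at k1
    have k2 := ms_scale X hτ0 (abs_nonneg s) hs
    rw [e]
    refine (norm_add_le _ _).trans ?_
    rw [norm_smul, norm_smul, Real.norm_of_nonneg (show 0 ≤ R - D by linarith), Real.norm_eq_abs,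
      abs_mul, abs_of_pos hD, hnw, mul_assoc]
    have : ‖v + s • w'‖ ≤ 1 + s * ψ w' + 2 * (|s| * ρ) := by linarith
    have hRD : 0 ≤ R - D := by linarith
    gcongr
  have ea := est (-(1 - μ)) (by rw [abs_neg, abs_of_nonneg (by linarith)]; linarith)
  have eb := est μ (by rw [abs_of_nonneg h0]; linarith)
  rw [neg_smul, ← sub_eq_add_neg, abs_neg, abs_of_nonneg (show 0 ≤ 1 - μ by linarith)] at ea
  rw [abs_of_nonneg h0] at eb
  have ea' := mul_le_mul_of_nonneg_left (ha.trans ea) h0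
  have eb' := mul_le_mul_of_nonneg_left (hb.trans eb) (show 0 ≤ 1 - μ by linarith)
  set m := μ * (1 - μ) with hm
  have hm0 : 0 ≤ m := mul_nonneg h0 (by linarith)
  have hm1 : 4 * m ≤ 1 := by nlinarith [sq_nonneg (2 * μ - 1)]
  have key : D * (1 + 4 * m * ρ - 2 * m * τ) ≤ 4 * m * (R * ρ) := by
    have : R ≤ (R - D) * (1 + 4 * m * ρ) + D * (2 * m * τ) := by
      rw [hm]; linarith
    linarith
  have h2 : 1 / 2 ≤ 1 + 4 * m * ρ - 2 * m * τ := by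
    have : τ - 2 * ρ ≤ 1 := by
      rcases le_total τ 1 with h | h <;> linarith
    nlinarith
  have h3 : D * (1 / 2) ≤ D * (1 + 4 * m * ρ - 2 * m * τ) := mul_le_mul_of_nonneg_left h2 hD.le
  linarith

theorem tau_lt {X : Type*} [NormedAddCommGroup X] [NormedSpace ℝ X] [Nontrivial X] {t : ℝ}
    (ht : 0 < t) (h : omegaX X t < 1 / 8) : t < 2 := by
  unfold omegaX at h
  rw [div_lt_iff₀ ht] at h
  have := (ms_ge X ht.le).1
  linarith

theorem final_bound {X : Type*} [NormedAddCommGroup X] [NormedSpace ℝ X] [CompleteSpace X]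
    [UniformConvexSpace X] [Nontrivial X] {A : Set X} {R : ℝ} (hR : 0 < R)
    (hdiff : ∀ y, 0 < Metric.infDist y A → Metric.infDist y A < R →
      DifferentiableAt ℝ (fun x => Metric.infDist x A) y)
    {x0 x1 : X} (h0 : x0 ∈ A) (h1 : x1 ∈ A) (hne : x0 ≠ x1)
    (hω : omegaX X (‖x0 - x1‖ / R) < 1 / 8)
    (hsmall : ∀ x ∈ segment ℝ x0 x1, Metric.infDist x A < R)
    {l : ℝ} (hl : l ∈ Set.Icc (0 : ℝ) 1) {z : X} (hz : z ∈ metricProjSeg A x0 x1)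
    (hq : QuasiOrth (z - (l • x0 + (1 - l) • x1)) (x0 - x1)) :
    ‖z - (l • x0 + (1 - l) • x1)‖ ≤ 4 * l * (1 - l) * Rprime X ‖x0 - x1‖ R := by
  simp only [metricProjSeg, Set.mem_iUnion] at hz
  obtain ⟨x, hxs, hzA, hzx⟩ := hz
  have hDR := hsmall x hxs
  obtain ⟨μ, b, hμ0, hb0, hab, hx⟩ := hxs
  obtain rfl : b = 1 - μ := by linarith
  set d := ‖x0 - x1‖ with hd
  have hd0 : 0 < d := norm_pos_iff.2 (sub_ne_zero.2 hne)
  set D := Metric.infDist x A with hD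
  have hD0 : 0 ≤ D := Metric.infDist_nonneg
  set y := z - (l • x0 + (1 - l) • x1) with hy
  have hzxy : z - x = y + (l - μ) • (x0 - x1) := by rw [hy, ← hx]; module
  have hlm : |l - μ| * d ≤ D := by
    rcases eq_or_ne (l - μ) 0 with h | h
    · rw [h]; simpa using hD0
    · have := hq (l - μ)⁻¹
      rw [← hzx, hzxy]
      calc |l - μ| * d ≤ |l - μ| * ‖x0 - x1 + (l - μ)⁻¹ • y‖ := by gcongr
        _ = ‖(l - μ) • (x0 - x1 + (l - μ)⁻¹ • y)‖ := by rw [norm_smul, Real.norm_eq_abs]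
        _ = _ := by rw [smul_add, smul_smul, mul_inv_cancel₀ h, one_smul, add_comm]
  have hyD : ‖y‖ ≤ 2 * D := by
    have : y = (z - x) - (l - μ) • (x0 - x1) := by rw [hzxy]; abel
    rw [this]
    refine (norm_sub_le _ _).trans ?_
    rw [norm_smul, Real.norm_eq_abs, hzx]
    linarith
  set ρ := modSmooth X (d / R) with hρ
  have hρ0 : 0 ≤ ρ := (ms_ge X (show 0 ≤ d / R by positivity)).2
  set ω := omegaX X (d / R) with hωd
  have hω0 : 0 ≤ ω := div_nonneg hρ0 (by positivity)
  have hRρ : R * ρ = d * ω := by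
    rw [hωd, omegaX, ← hρ]; field_simp
  have hDb : D ≤ 8 * (μ * (1 - μ)) * (R * ρ) := by
    rcases hD0.eq_or_lt with h | h
    · rw [← h]
      have : 0 ≤ 1 - μ := hb0
      positivity
    · have hn : ‖x - z‖ = D := by rw [norm_sub_rev, hzx]
      set v := D⁻¹ • (x - z) with hv
      have hv1 : ‖v‖ = 1 := by
        rw [hv, norm_smul, hn, Real.norm_of_nonneg (by positivity), inv_mul_cancel₀ h.ne']
      have hxz : x - z = D • v := by rw [hv, smul_smul, mul_inv_cancel₀ h.ne', one_smul]
      have s0 := supp_ball ⟨x0, h0⟩ hdiff hD.symm h hDR hzA hv1 hxz h0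
      have s1 := supp_ball ⟨x0, h0⟩ hdiff hD.symm h hDR hzA hv1 hxz h1
      refine D_bound hR h hDR hμ0 (by linarith) hv1 (w := x0 - x1) ?_ ?_
      · convert s0 using 2; rw [← hx]; module
      · convert s1 using 2; rw [← hx]; module
  rw [hRρ] at hDb
  have hmk : μ * (1 - μ) ≤ l * (1 - l) + |l - μ| := by
    have e : μ * (1 - μ) - l * (1 - l) = (l - μ) * (l + μ - 1) := by ring
    have e2 : (l - μ) * (l + μ - 1) ≤ |l - μ| := by
      refine (le_abs_self _).trans ?_
      rw [abs_mul]
      refine mul_le_of_le_one_right (abs_nonneg _) ?_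
      rw [abs_le]; constructor <;> linarith [hl.1, hl.2]
    linarith
  have hk0 : 0 ≤ l * (1 - l) := mul_nonneg hl.1 (by linarith [hl.2])
  set m := μ * (1 - μ)
  have h8 : 0 < 1 - 8 * ω := by linarith
  have hm : m * (1 - 8 * ω) ≤ l * (1 - l) := by
    have : d * (m * (1 - 8 * ω)) ≤ d * (l * (1 - l)) := by nlinarith
    exact le_of_mul_le_mul_left this hd0
  have hRp : 4 * l * (1 - l) * Rprime X d R = 32 * (l * (1 - l)) * (d * ω) / (1 - 8 * ω) := by
    rw [Rprime, mul_assoc 8 R, ← hρ, hRρ, ← hωd]; ring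
  rw [hRp, le_div_iff₀ h8]
  have hdω : 0 ≤ d * ω := by positivity
  calc ‖y‖ * (1 - 8 * ω) ≤ (16 * m * (d * ω)) * (1 - 8 * ω) := by
        gcongr; linarith
    _ = 16 * (m * (1 - 8 * ω)) * (d * ω) := by ring
    _ ≤ 16 * (l * (1 - l)) * (d * ω) := by gcongr
    _ ≤ 32 * (l * (1 - l)) * (d * ω) := by gcongr; norm_num

theorem proj_cont {X : Type*} [NormedAddCommGroup X] [NormedSpace ℝ X] [UniformConvexSpace X]
    {A : Set X} {R : ℝ}
    (hdiff : ∀ y, 0 < Metric.infDist y A → Metric.infDist y A < R →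
      DifferentiableAt ℝ (fun x => Metric.infDist x A) y)
    (P : X → X) (hP : ∀ x, Metric.infDist x A < R → P x ∈ A ∧ ‖x - P x‖ = Metric.infDist x A) :
    ContinuousOn P {x | Metric.infDist x A < R} := by
  intro x hx
  have hx : Metric.infDist x A < R := hx
  obtain ⟨hPA, hPx⟩ := hP x hx
  rw [Metric.continuousWithinAt_iff]
  intro ε hε
  have hn : ∀ y, Metric.infDist y A < R → ‖x - P y‖ ≤ Metric.infDist x A + 2 * dist y x := by
    intro y hy
    have h1 := Metric.infDist_le_infDist_add_dist (s := A) (x := y) (y := x)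
    have h2 : ‖x - P y‖ ≤ ‖x - y‖ + ‖y - P y‖ := norm_sub_le_norm_sub_add_norm_sub x y (P y)
    rw [(hP y hy).2, ← dist_eq_norm x y, dist_comm] at h2
    linarith
  rcases (Metric.infDist_nonneg (x := x) (s := A)).eq_or_lt with h | h
  · rw [← h] at hPx
    have hxP : P x = x := (sub_eq_zero.1 (norm_eq_zero.1 hPx)).symm
    refine ⟨ε / 2, by positivity, fun y hy hyx => ?_⟩
    rw [hxP, dist_comm, dist_eq_norm]
    have := hn y hy
    linarith
  · obtain ⟨δ, hδ, hw⟩ := well_posed h (hdiff x h hx).hasFDerivAt ε hε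
    refine ⟨δ / 2, by positivity, fun y hy hyx => ?_⟩
    rw [dist_eq_norm]
    exact hw _ (hP y hy).1 _ hPA (by linarith [hn y hy]) (by linarith)

theorem statement7 (X : Type*) [NormedAddCommGroup X] [NormedSpace ℝ X]
    [CompleteSpace X] [UniformConvexSpace X] (hsm : UnifSmooth X)
    (A : Set X) (R : ℝ) (hR : 0 < R) (hA : ProximallySmooth A R)
    (x0 x1 : X) (h0 : x0 ∈ A) (h1 : x1 ∈ A) (hne : x0 ≠ x1)
    (hd : ‖x0 - x1‖ / R < omegaInv X (1 / 8))
    (l : ℝ) (hl : l ∈ Set.Icc (0 : ℝ) 1) :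
    (∃ z ∈ metricProjSeg A x0 x1,
        ‖z - (l • x0 + (1 - l) • x1)‖ ≤ 4 * l * (1 - l) * Rprime X ‖x0 - x1‖ R ∧
        QuasiOrth (z - (l • x0 + (1 - l) • x1)) (x1 - x0)) ∧
      ∀ z : X, IsSliceProj A x0 x1 z →
        ‖z - midpoint ℝ x0 x1‖ ≤ Rprime X ‖x0 - x1‖ R := by
  have hnt : Nontrivial X := ⟨x0, x1, hne⟩
  have hd0 : 0 < ‖x0 - x1‖ := norm_pos_iff.2 (sub_ne_zero.2 hne)
  have ht : 0 < ‖x0 - x1‖ / R := by positivity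
  have hω := omega_spec X hsm ht hd
  have ht2 := tau_lt ht hω
  rw [div_lt_iff₀ hR] at ht2
  have hAn : A.Nonempty := ⟨x0, h0⟩
  obtain ⟨hAc, hC⟩ := hA
  have hdiff : ∀ y, 0 < Metric.infDist y A → Metric.infDist y A < R →
      DifferentiableAt ℝ (fun x => Metric.infDist x A) y := by
    intro y hy1 hy2
    have hc := Metric.continuous_infDist_pt A
    have ho : IsOpen {x : X | 0 < Metric.infDist x A ∧ Metric.infDist x A < R} :=
      (isOpen_lt continuous_const hc).inter (isOpen_lt hc continuous_const)
    exact (hC.contDiffAt (ho.mem_nhds ⟨hy1, hy2⟩)).differentiableAt (by norm_num)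
  have hsmall : ∀ x ∈ segment ℝ x0 x1, Metric.infDist x A < R := by
    rintro x ⟨a, b, ha, hb, hab, rfl⟩
    obtain rfl : b = 1 - a := by linarith
    rcases le_total a (1 / 2) with h | h
    · refine (Metric.infDist_le_dist_of_mem h1).trans_lt ?_
      rw [dist_eq_norm, show a • x0 + (1 - a) • x1 - x1 = a • (x0 - x1) by module, norm_smul,
        Real.norm_of_nonneg ha]
      nlinarith
    · refine (Metric.infDist_le_dist_of_mem h0).trans_lt ?_
      rw [dist_eq_norm, show a • x0 + (1 - a) • x1 - x0 = -((1 - a) • (x0 - x1)) by module,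
        norm_neg, norm_smul, Real.norm_of_nonneg hb]
      nlinarith
  constructor
  · have hex : ∀ x, ∃ a, Metric.infDist x A < R → a ∈ A ∧ ‖x - a‖ = Metric.infDist x A := by
      intro x
      by_cases hx : Metric.infDist x A < R
      · rcases (Metric.infDist_nonneg (x := x) (s := A)).eq_or_lt with h | h
        · exact ⟨x, fun _ => ⟨(hAc.mem_iff_infDist_zero hAn).2 h.symm, by simp [← h]⟩⟩
        · obtain ⟨a, ha, hxa⟩ := proj_exists hAn hAc h (hdiff x h hx).hasFDerivAt
          exact ⟨a, fun _ => ⟨ha, hxa⟩⟩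
      · exact ⟨x, fun h => absurd h hx⟩
    choose P hP using hex
    have hPc := proj_cont hdiff P hP
    have hPfix : ∀ x ∈ A, P x = x := by
      intro x hx
      have hz := (hAc.mem_iff_infDist_zero hAn).1 hx
      have := (hP x (by rw [hz]; exact hR)).2
      rw [hz] at this
      exact (sub_eq_zero.1 (norm_eq_zero.1 this)).symm
    obtain ⟨p, hp, hpd⟩ := exists_dual_vector'' ℝ (x0 - x1)
    have hpd' : p x0 - p x1 = ‖x0 - x1‖ := by rw [← map_sub]; exact hpd
    have hseg : ∀ t ∈ Set.Icc (0 : ℝ) 1, t • x0 + (1 - t) • x1 ∈ segment ℝ x0 x1 := fun t ht =>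
      ⟨t, 1 - t, ht.1, by linarith [ht.2], by ring, rfl⟩
    have hgc : ContinuousOn (fun t : ℝ => p (P (t • x0 + (1 - t) • x1))) (Set.Icc 0 1) := by
      refine p.continuous.comp_continuousOn (hPc.comp (by fun_prop) ?_)
      intro t ht
      exact hsmall _ (hseg t ht)
    obtain ⟨t, htI, hpt⟩ := intermediate_value_Icc zero_le_one hgc
      (show p (l • x0 + (1 - l) • x1) ∈ _ by
        simp only [zero_smul, one_smul, sub_zero, sub_self, zero_add, add_zero, hPfix x0 h0,
          hPfix x1 h1, map_add, map_smul, smul_eq_mul]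
        constructor <;> nlinarith [hl.1, hl.2])
    simp only at hpt
    have hxt := hsmall _ (hseg t htI)
    set z := P (t • x0 + (1 - t) • x1) with hz
    have hzs : z ∈ metricProjSeg A x0 x1 := by
      simp only [metricProjSeg, Set.mem_iUnion]
      exact ⟨_, hseg t htI, (hP _ hxt).1, by rw [norm_sub_rev]; exact (hP _ hxt).2⟩
    have hq : QuasiOrth (z - (l • x0 + (1 - l) • x1)) (x0 - x1) := by
      intro r
      have hz0 : p (z - (l • x0 + (1 - l) • x1)) = 0 := by rw [map_sub, hpt, sub_self]
      have h2 : p (x0 - x1 + r • (z - (l • x0 + (1 - l) • x1))) = ‖x0 - x1‖ := by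
        rw [map_add, map_smul, hz0, smul_zero, add_zero]; exact hpd
      rw [← h2]
      exact (le_abs_self _).trans
        ((p.le_opNorm _).trans (mul_le_of_le_one_left (norm_nonneg _) hp))
    refine ⟨z, hzs, final_bound hR hdiff h0 h1 hne hω hsmall hl hzs hq, fun r => ?_⟩
    have := hq (-r)
    rw [norm_sub_rev x1 x0]
    refine this.trans (le_of_eq ?_)
    rw [← norm_neg]
    congr 1
    module
  · rintro z ⟨hzs, hq⟩
    have hm : midpoint ℝ x0 x1 = (1 / 2 : ℝ) • x0 + (1 - 1 / 2 : ℝ) • x1 := by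
      rw [midpoint_eq_smul_add, smul_add]; norm_num
    rw [hm] at hq ⊢
    have := final_bound hR hdiff h0 h1 hne hω hsmall (l := 1 / 2) (by constructor <;> norm_num)
      hzs hq
    refine this.trans (le_of_eq (by ring))
end
end

section
/- Let X be a uniformly convex and uniformly smooth real Banach space whose modulus of smoothness is of power type s. Then there exist positive constants β_L and L with the following property: for every set A ⊂ X that is proximally smooth with constant R > 0 and every pair of points x0, x1 ∈ A with ‖x0 − x1‖/R < β_L, there exists a rectifiable curve γ contained in A with endpoints x0 and x1 whose length satisfies length(γ) ≤ ‖x0 − x1‖·(1 + L·(‖x0 − x1‖/R)^{s(s−1)}). -/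
noncomputable section

open Set Metric

/-- Power type smoothness in homogeneous form. -/
lemma aux_smooth {X : Type*} [NormedAddCommGroup X] [NormedSpace ℝ X] {s C : ℝ}
    (hpow : ∀ τ : ℝ, 0 ≤ τ → modSmooth X τ ≤ C * τ ^ s) (v u : X) (hv : v ≠ 0) :
    ‖v + u‖ + ‖v - u‖ ≤ 2 * ‖v‖ * (1 + C * (‖u‖ / ‖v‖) ^ s) := by
  have hv' : 0 < ‖v‖ := norm_pos_iff.2 hv
  have hbdd : BddAbove {r : ℝ | ∃ x y : X, ‖x‖ = 1 ∧ ‖y‖ = ‖u‖ / ‖v‖ ∧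
      r = (‖x + y‖ + ‖x - y‖) / 2 - 1} := by
    refine ⟨‖u‖ / ‖v‖, ?_⟩
    rintro r ⟨x, y, hx, hy, rfl⟩
    have h1 := norm_add_le x y
    have h2 := norm_sub_le x y
    rw [hx, hy] at h1 h2
    linarith
  have key := le_csSup hbdd (show (‖‖v‖⁻¹ • v + ‖v‖⁻¹ • u‖ + ‖‖v‖⁻¹ • v - ‖v‖⁻¹ • u‖) / 2 - 1 ∈ _
    from ⟨‖v‖⁻¹ • v, ‖v‖⁻¹ • u, by rw [norm_smul, norm_inv, norm_norm]; field_simp,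
      by rw [norm_smul, norm_inv, norm_norm]; field_simp, rfl⟩)
  have h2 := key.trans (hpow (‖u‖ / ‖v‖) (by positivity))
  rw [← smul_add, ← smul_sub, norm_smul, norm_smul, norm_inv, norm_norm] at h2
  have h3 : ‖v‖⁻¹ * (‖v + u‖ + ‖v - u‖) ≤ 2 * (1 + C * (‖u‖ / ‖v‖) ^ s) := by linarith
  rw [inv_mul_le_iff₀ hv'] at h3
  linarith

/-- Ascent step: differentiability of the distance function forces slope one. -/
lemma aux_step {X : Type*} [NormedAddCommGroup X] [NormedSpace ℝ X] {A : Set X}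
    (hA : A.Nonempty) (x : X) (hx : 0 < infDist x A)
    (hd : DifferentiableAt ℝ (fun x => infDist x A) x) {c ε : ℝ} (hc0 : 0 < c) (hc : c < 1)
    (hε : 0 < ε) :
    ∃ y, y ≠ x ∧ c * ‖y - x‖ ≤ infDist y A - infDist x A ∧ ‖y - x‖ < ε := by
  obtain ⟨f', hf'⟩ := hd
  set d := infDist x A with hdd
  obtain ⟨κ, hκ⟩ : ∃ κ, κ = (1 - c) / 6 := ⟨_, rfl⟩
  have hκ0 : 0 < κ := by rw [hκ]; linarith
  have h1 := hf'.isLittleO.def hκ0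
  rw [Metric.eventually_nhds_iff] at h1
  obtain ⟨ρ, hρ, h1⟩ := h1
  obtain ⟨t, ht⟩ : ∃ t, t = min 1 (min ρ ε / (4 * d)) := ⟨_, rfl⟩
  have hm : 0 < min ρ ε := lt_min hρ hε
  have ht0 : 0 < t := by rw [ht]; exact lt_min one_pos (by positivity)
  have ht1 : t ≤ 1 := by rw [ht]; exact min_le_left _ _
  have ht2 : 4 * d * t ≤ min ρ ε := by
    have : t ≤ min ρ ε / (4 * d) := by rw [ht]; exact min_le_right _ _
    rw [le_div_iff₀ (by positivity)] at this
    linarith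
  have ht3 := ht2.trans (min_le_left _ _)
  have ht4 := ht2.trans (min_le_right _ _)
  obtain ⟨a, haA, ha⟩ := (infDist_lt_iff hA).1 (show infDist x A < d + κ * t * d by
    have : 0 < κ * t * d := by positivity
    linarith)
  have ha' : d ≤ ‖a - x‖ := by
    rw [← dist_eq_norm, dist_comm]; exact infDist_le_dist_of_mem haA
  rw [dist_comm, dist_eq_norm] at ha
  set N := ‖a - x‖ with hN
  have hκ6 : κ < 1 / 6 := by rw [hκ]; linarith
  have hN2 : N ≤ d * (1 + κ) := by
    have : κ * t * d ≤ κ * 1 * d := by gcongr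
    linarith
  have hN3 : N ≤ 2 * d := by nlinarith
  have htN : t * N ≤ 2 * d * t := by nlinarith
  have hdt : 0 < d * t := by positivity
  have hn : ‖t • (a - x)‖ = t * N := by rw [norm_smul, Real.norm_of_nonneg ht0.le]
  have e1 := h1 (y := x + t • (a - x)) (by
    rw [dist_eq_norm, add_sub_cancel_left, hn]; linarith)
  have e2 := h1 (y := x - t • (a - x)) (by
    rw [dist_eq_norm, sub_sub_cancel_left, norm_neg, hn]; linarith)
  rw [add_sub_cancel_left, hn, Real.norm_eq_abs, abs_le] at e1
  rw [sub_sub_cancel_left, norm_neg, hn, Real.norm_eq_abs, abs_le, map_neg] at e2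
  have e3 : infDist (x + t • (a - x)) A ≤ (1 - t) * N := by
    refine (infDist_le_dist_of_mem haA).trans ?_
    rw [dist_eq_norm, show x + t • (a - x) - a = -((1 - t) • (a - x)) by module, norm_neg,
      norm_smul, Real.norm_of_nonneg (by linarith)]
  have e4 : κ * (t * N) ≤ κ * (2 * d * t) := by gcongr
  have e5 : t * d ≤ t * N := by gcongr
  refine ⟨x - t • (a - x), ?_, ?_, ?_⟩
  · intro h
    have : ‖t • (a - x)‖ = 0 := by
      rw [sub_eq_self.1 h, norm_zero]
    rw [hn] at this
    nlinarith
  · rw [sub_sub_cancel_left, norm_neg, hn]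
    have e6 : c * (t * N) ≤ c * (t * (d * (1 + κ))) := by gcongr
    have e7 : c * (t * (d * (1 + κ))) ≤ d * t * (1 - 5 * κ) := by
      have : c * (1 + κ) ≤ 1 - 5 * κ := by nlinarith
      nlinarith
    have f1 := e1.1
    have f2 := e2.1
    simp only [← hdd] at f1 f2
    nlinarith
  · rw [sub_sub_cancel_left, norm_neg, hn]; linarith

/-- Ekeland-type ascent principle. -/
lemma aux_ekeland_s10 {X : Type*} [NormedAddCommGroup X] [CompleteSpace X] {d : X → ℝ}
    (hd : Continuous d) {c r R : ℝ} (hc : 0 < c) (hrR : r < R) (x0 : X) (hx0 : d x0 < r)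
    (hstep : ∀ x, d x0 ≤ d x → d x < r → ∃ y, y ≠ x ∧ c * ‖y - x‖ ≤ d y - d x ∧ d y < R) :
    ∃ y, c * ‖y - x0‖ ≤ d y - d x0 ∧ r ≤ d y ∧ d y < R := by
  by_contra! hcon
  have hS : ∀ y, c * ‖y - x0‖ ≤ d y - d x0 → d y < R → d y < r := by
    intro y hy hyR
    by_contra! h
    exact absurd hyR (not_lt.2 (hcon y hy h))
  have htr : ∀ x y z, c * ‖y - x‖ ≤ d y - d x → c * ‖z - y‖ ≤ d z - d y →
      c * ‖z - x‖ ≤ d z - d x := by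
    intro x y z h1 h2
    have : ‖z - x‖ ≤ ‖z - y‖ + ‖y - x‖ := norm_sub_le_norm_sub_add_norm_sub z y x
    nlinarith
  have hF : ∀ x : {x : X // c * ‖x - x0‖ ≤ d x - d x0 ∧ d x < r},
      ∃ y : {x : X // c * ‖x - x0‖ ≤ d x - d x0 ∧ d x < r},
        c * ‖y.1 - x.1‖ ≤ d y.1 - d x.1 ∧
        ∀ z, c * ‖z - x.1‖ ≤ d z - d x.1 → d z < R → d z - d y.1 ≤ d y.1 - d x.1 := by
    rintro ⟨x, hx1, hx2⟩
    let T := d '' {z | c * ‖z - x‖ ≤ d z - d x ∧ d z < R}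
    have hT : BddAbove T := by
      refine ⟨r, ?_⟩
      rintro _ ⟨z, ⟨hz1, hz2⟩, rfl⟩
      exact (hS z (htr _ _ _ hx1 hz1) hz2).le
    have hxT : d x ∈ T := ⟨x, ⟨by simp, hx2.trans hrR⟩, rfl⟩
    rcases lt_or_ge (d x) (sSup T) with h | h
    · obtain ⟨_, ⟨y, ⟨hy1, hy2⟩, rfl⟩, hy⟩ :=
        exists_lt_of_lt_csSup ⟨_, hxT⟩ (show (d x + sSup T) / 2 < sSup T by linarith)
      refine ⟨⟨y, htr _ _ _ hx1 hy1, hS y (htr _ _ _ hx1 hy1) hy2⟩, hy1, ?_⟩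
      intro z hz1 hz2
      have := le_csSup hT ⟨z, ⟨hz1, hz2⟩, rfl⟩
      dsimp only
      linarith
    · refine ⟨⟨x, hx1, hx2⟩, by simp, ?_⟩
      intro z hz1 hz2
      have := le_csSup hT ⟨z, ⟨hz1, hz2⟩, rfl⟩
      dsimp only at *
      linarith
  choose F hF1 hF2 using hF
  let u : ℕ → {x : X // c * ‖x - x0‖ ≤ d x - d x0 ∧ d x < r} :=
    fun n => F^[n] ⟨x0, by simp, hx0⟩
  have hu : ∀ n, u (n + 1) = F (u n) := fun n => Function.iterate_succ_apply' _ _ _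
  have hmono : Monotone (fun n => d (u n).1) := by
    refine monotone_nat_of_le_succ fun n => ?_
    rw [hu]
    have := hF1 (u n)
    have h0 : 0 ≤ c * ‖(F (u n)).1 - (u n).1‖ := by positivity
    linarith
  have hbd : BddAbove (range (fun n => d (u n).1)) := by
    refine ⟨r, ?_⟩
    rintro _ ⟨n, rfl⟩
    exact (u n).2.2.le
  have hlim := tendsto_atTop_ciSup hmono hbd
  set l := ⨆ n, d (u n).1 with hl
  have hnm : ∀ n m, n ≤ m → c * ‖(u m).1 - (u n).1‖ ≤ d (u m).1 - d (u n).1 := by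
    intro n m hm
    induction m, hm using Nat.le_induction with
    | base => simp
    | succ m hm ih =>
      refine htr _ _ _ ih ?_
      rw [hu]; exact hF1 _
  have hcau : CauchySeq (fun n => (u n).1) := by
    refine cauchySeq_of_le_tendsto_0' (fun n => (l - d (u n).1) / c) ?_ ?_
    · intro n m hm
      rw [dist_comm, dist_eq_norm, le_div_iff₀ hc]
      have := hnm n m hm
      have h2 := le_ciSup hbd m
      linarith
    · have : Filter.Tendsto (fun n => (l - d (u n).1) / c) Filter.atTop (nhds ((l - l) / c)) :=
        (tendsto_const_nhds.sub hlim).div_const c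
      simpa using this
  obtain ⟨x, hx⟩ := cauchySeq_tendsto_of_complete hcau
  have hdx : Filter.Tendsto (fun n => d (u n).1) Filter.atTop (nhds (d x)) :=
    (hd.tendsto x).comp hx
  have hxn : ∀ n, c * ‖x - (u n).1‖ ≤ d x - d (u n).1 := by
    intro n
    refine le_of_tendsto_of_tendsto ((hx.sub_const _).norm.const_mul c) (hdx.sub_const _) ?_
    filter_upwards [Filter.eventually_ge_atTop n] with m hm using hnm n m hm
  have hxr : d x ≤ r := le_of_tendsto' hdx fun n => (u n).2.2.le
  have hx0' := hxn 0
  have hu0 : (u 0).1 = x0 := rfl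
  rw [hu0] at hx0'
  have hxr' := hS x hx0' (hxr.trans_lt hrR)
  obtain ⟨y, hyx, hy1, hy2⟩ := hstep x (by
    have : 0 ≤ c * ‖x - x0‖ := by positivity
    linarith) hxr'
  have hle : d y - d x ≤ d x - d x := by
    refine le_of_tendsto_of_tendsto' (tendsto_const_nhds.sub
      (hdx.comp (Filter.tendsto_add_atTop_nat 1)))
      ((hdx.comp (Filter.tendsto_add_atTop_nat 1)).sub hdx) fun n => ?_
    have := hF2 (u n) y (htr _ _ _ (hxn n) hy1) hy2
    rw [← hu] at this
    exact this
  have : 0 < c * ‖y - x‖ := mul_pos hc (norm_pos_iff.2 (sub_ne_zero.2 hyx))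
  linarith

/-- Distance from the midpoint to a proximally smooth set. -/
lemma aux_mid {X : Type*} [NormedAddCommGroup X] [NormedSpace ℝ X] [CompleteSpace X]
    {s C : ℝ} (hs1 : 1 < s) (hs2 : s ≤ 2) (hC : 0 < C)
    (hpow : ∀ τ : ℝ, 0 ≤ τ → modSmooth X τ ≤ C * τ ^ s) {A : Set X} {R : ℝ} (hR : 0 < R)
    (hA : ProximallySmooth A R) {a b : X} (ha : a ∈ A) (hb : b ∈ A) (hab : ‖a - b‖ ≤ R / 2) :
    infDist (midpoint ℝ a b) A ≤ C * ‖a - b‖ * (‖a - b‖ / R) ^ (s - 1) := by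
  set m := midpoint ℝ a b with hm
  set δ := infDist m A with hδ
  set τ := ‖a - b‖ with hτ
  have hE : 0 ≤ C * τ * (τ / R) ^ (s - 1) := by positivity
  rcases (infDist_nonneg (x := m) (s := A)).eq_or_lt with h0 | h0
  · rw [hδ, ← h0]; exact hE
  rw [← hδ] at h0
  obtain ⟨u, hu⟩ : ∃ u : X, u = (1 / 2 : ℝ) • (a - b) := ⟨_, rfl⟩
  have hun : ‖u‖ = τ / 2 := by
    rw [hu, norm_smul]; norm_num; linarith
  have hau : a = m + u := by rw [hu, hm, midpoint_eq_smul_add]; simp only [invOf_eq_inv]; module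
  have hbu : b = m - u := by rw [hu, hm, midpoint_eq_smul_add]; simp only [invOf_eq_inv]; module
  have hδτ : δ ≤ τ / 2 := by
    refine (infDist_le_dist_of_mem ha).trans ?_
    rw [dist_comm, dist_eq_norm, hau, add_sub_cancel_left, hun]
  have hcont : Continuous (fun x => infDist x A) := continuous_infDist_pt A
  have hopen : IsOpen {x : X | 0 < infDist x A ∧ infDist x A < R} :=
    (isOpen_lt continuous_const hcont).inter (isOpen_lt hcont continuous_const)
  have key : ∀ c : ℝ, 0 < c → c < 1 → δ ≤ R * (1 / c - 1) + C * τ * (τ / R) ^ (s - 1) := by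
    intro c hc0 hc1
    obtain ⟨y, hy1, hy2, hy3⟩ := aux_ekeland_s10 hcont hc0 (show R / 2 < R by linarith) m
      (show infDist m A < R / 2 by linarith) (by
        intro x hx1 hx2
        have hx0 : 0 < infDist x A := h0.trans_le hx1
        have hdiff : DifferentiableAt ℝ (fun x => infDist x A) x :=
          ((hA.2.contDiffAt (hopen.mem_nhds ⟨hx0, by linarith⟩))).differentiableAt (by norm_num)
        obtain ⟨y, hy1, hy2, hy3⟩ := aux_step ⟨a, ha⟩ x hx0 hdiff hc0 hc1
          (show 0 < R / 2 by linarith)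
        refine ⟨y, hy1, hy2, ?_⟩
        have := infDist_le_infDist_add_dist (s := A) (x := y) (y := x)
        rw [dist_eq_norm] at this
        linarith)
    set D := infDist y A with hD
    have hvlow : D - δ ≤ ‖y - m‖ := by
      have := infDist_le_infDist_add_dist (s := A) (x := y) (y := m)
      rw [dist_eq_norm] at this
      linarith
    have hv4 : R / 4 ≤ ‖y - m‖ := by linarith
    have hv0 : 0 < ‖y - m‖ := by linarith
    have hsm := aux_smooth hpow (y - m) u (norm_pos_iff.1 hv0)
    have h1 : D ≤ ‖y - m + u‖ := by
      rw [show y - m + u = y - b by rw [hbu]; abel, ← dist_eq_norm]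
      exact infDist_le_dist_of_mem hb
    have h2 : D ≤ ‖y - m - u‖ := by
      rw [show y - m - u = y - a by rw [hau]; abel, ← dist_eq_norm]
      exact infDist_le_dist_of_mem ha
    have h3 : ‖y - m‖ ≤ (D - δ) / c := by rw [le_div_iff₀ hc0]; linarith
    set V := ‖y - m‖ with hV
    have h4 : V * (C * (‖u‖ / V) ^ s) ≤ C * τ * (τ / R) ^ (s - 1) := by
      have e1 : (‖u‖ / V) ^ s = (‖u‖ / V) * (‖u‖ / V) ^ (s - 1) := by
        rw [← Real.rpow_one_add' (by positivity) (by linarith)]; congr 1; ring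
      have e2 : (‖u‖ / V) ^ (s - 1) ≤ (2 * (τ / R)) ^ (s - 1) := by
        refine Real.rpow_le_rpow (by positivity) ?_ (by linarith)
        rw [div_le_iff₀ hv0, hun]
        calc τ / 2 = 2 * (τ / R) * (R / 4) := by field_simp; norm_num
          _ ≤ _ := by gcongr
      have e3 : (2 * (τ / R)) ^ (s - 1) ≤ 2 * (τ / R) ^ (s - 1) := by
        rw [Real.mul_rpow (by norm_num) (by positivity)]
        gcongr
        calc (2 : ℝ) ^ (s - 1) ≤ 2 ^ (1 : ℝ) :=
              Real.rpow_le_rpow_of_exponent_le (by norm_num) (by linarith)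
          _ = 2 := by norm_num
      calc V * (C * (‖u‖ / V) ^ s) = C * ‖u‖ * (‖u‖ / V) ^ (s - 1) := by
            rw [e1]; field_simp
        _ ≤ C * ‖u‖ * (2 * (τ / R) ^ (s - 1)) := by gcongr; exact e2.trans e3
        _ = _ := by rw [hun]; ring
    have h5 : D ≤ (D - δ) / c + C * τ * (τ / R) ^ (s - 1) := by linarith
    have h6 : 1 < 1 / c := by rw [lt_div_iff₀ hc0]; linarith
    have h7 : (D - δ) / c = D * (1 / c - 1) + D - δ * (1 / c) := by field_simp; ring
    have h8 : D * (1 / c - 1) ≤ R * (1 / c - 1) := by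
      apply mul_le_mul_of_nonneg_right hy3.le; linarith
    nlinarith
  have ht : Filter.Tendsto (fun c : ℝ => R * (1 / c - 1) + C * τ * (τ / R) ^ (s - 1))
      (nhdsWithin 1 (Iio 1)) (nhds (R * (1 / 1 - 1) + C * τ * (τ / R) ^ (s - 1))) := by
    have : ContinuousAt (fun c : ℝ => R * (1 / c - 1) + C * τ * (τ / R) ^ (s - 1)) 1 := by
      fun_prop (disch := norm_num)
    exact this.tendsto.mono_left nhdsWithin_le_nhds
  have := ge_of_tendsto ht (b := δ) (by
    filter_upwards [Ioo_mem_nhdsLT (show (0 : ℝ) < 1 by norm_num)] with c hc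
    exact key c hc.1 hc.2)
  simpa using this

/-- Approximating polygons. -/
def auxG {X : Type*} [NormedAddCommGroup X] [NormedSpace ℝ X] (Z : X → X → X) :
    ℕ → X → X → ℝ → X
  | 0, a, b => fun t => a + t • (b - a)
  | k + 1, a, b => fun t => if t ≤ 1 / 2 then auxG Z k a (Z a b) (2 * t)
      else auxG Z k (Z a b) b (2 * t - 1)

lemma auxG_ends {X : Type*} [NormedAddCommGroup X] [NormedSpace ℝ X] (Z : X → X → X) (k : ℕ) :
    ∀ a b : X, auxG Z k a b 0 = a ∧ auxG Z k a b 1 = b := by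
  induction k with
  | zero => intro a b; simp [auxG]
  | succ k ih =>
    intro a b
    constructor
    · simp [auxG, (ih _ _).1]
    · have : ¬ ((1 : ℝ) ≤ 1 / 2) := by norm_num
      simp only [auxG, if_neg this]
      norm_num [(ih _ _).2]

lemma auxG_cont {X : Type*} [NormedAddCommGroup X] [NormedSpace ℝ X] (Z : X → X → X) (k : ℕ) :
    ∀ a b : X, Continuous (auxG Z k a b) := by
  induction k with
  | zero => intro a b; simp only [auxG]; fun_prop
  | succ k ih =>
    intro a b
    simp only [auxG]
    refine Continuous.if_le ((ih _ _).comp (by fun_prop)) ((ih _ _).comp (by fun_prop))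
      continuous_id continuous_const ?_
    intro t ht
    subst ht
    norm_num [(auxG_ends Z k _ _).1, (auxG_ends Z k _ _).2]

lemma auxG_var {X : Type*} [NormedAddCommGroup X] [NormedSpace ℝ X] (Z : X → X → X) (k : ℕ)
    (a b : X) :
    eVariationOn (auxG Z (k + 1) a b) (Icc 0 1) ≤
      eVariationOn (auxG Z k a (Z a b)) (Icc 0 1) + eVariationOn (auxG Z k (Z a b) b) (Icc 0 1) := by
  have h := eVariationOn.Icc_add_Icc (auxG Z (k + 1) a b) (s := univ) (a := (0 : ℝ)) (b := 1 / 2)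
    (c := 1) (by norm_num) (by norm_num) (mem_univ _)
  simp only [univ_inter] at h
  rw [← h]
  gcongr
  · rw [eVariationOn.congr (g := auxG Z k a (Z a b) ∘ fun t => 2 * t)
      (fun t ht => by simp only [auxG, if_pos ht.2, Function.comp])]
    refine eVariationOn.comp_le_of_monotoneOn _ _ ?_ ?_
    · intro x _ y _ hxy; dsimp only; linarith
    · intro x hx; constructor <;> [linarith [hx.1]; linarith [hx.2]]
  · rw [eVariationOn.congr (g := auxG Z k (Z a b) b ∘ fun t => 2 * t - 1) (s := Icc (1 / 2) 1) ?_]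
    · refine eVariationOn.comp_le_of_monotoneOn _ _ ?_ ?_
      · intro x _ y _ hxy; dsimp only; linarith
      · intro x hx; constructor <;> [linarith [hx.1]; linarith [hx.2]]
    · intro t ht
      rcases ht.1.eq_or_lt with h | h
      · subst h
        norm_num [auxG, (auxG_ends Z k _ _).1, (auxG_ends Z k _ _).2]
      · simp only [auxG, if_neg (not_le.2 h), Function.comp]

lemma aux_curve {X : Type*} [NormedAddCommGroup X] [NormedSpace ℝ X] [CompleteSpace X]
    {A : Set X} (hA : IsClosed A) {B : ℝ} {Φ : ℝ → ℝ} (hΦ : ∀ t, 0 ≤ t → t ≤ Φ t)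
    (Z : X → X → X)
    (hZ : ∀ a ∈ A, ∀ b ∈ A, ‖a - b‖ < B → Z a b ∈ A ∧ ‖a - Z a b‖ ≤ 2 / 3 * ‖a - b‖ ∧
      ‖Z a b - b‖ ≤ 2 / 3 * ‖a - b‖ ∧ Φ ‖a - Z a b‖ + Φ ‖Z a b - b‖ ≤ Φ ‖a - b‖)
    (x0 x1 : X) (h0 : x0 ∈ A) (h1 : x1 ∈ A) (h01 : ‖x0 - x1‖ < B) :
    ∃ f : ℝ → X, IsCurveIn A x0 x1 f ∧ eVariationOn f (Icc 0 1) ≤ ENNReal.ofReal (Φ ‖x0 - x1‖) := by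
  have hvar : ∀ k, ∀ a ∈ A, ∀ b ∈ A, ‖a - b‖ < B →
      eVariationOn (auxG Z k a b) (Icc 0 1) ≤ ENNReal.ofReal (Φ ‖a - b‖) := by
    intro k
    induction k with
    | zero =>
      intro a _ b _ _
      have hL : LipschitzOnWith ‖a - b‖₊ (auxG Z 0 a b) univ := by
        refine LipschitzOnWith.of_dist_le_mul fun x _ y _ => ?_
        simp only [auxG]
        rw [dist_add_left, dist_eq_norm, ← sub_smul, norm_smul, norm_sub_rev b a, dist_eq_norm,
          mul_comm, coe_nnnorm]
      have h := hL.comp_eVariationOn_le (g := id) (s := Icc (0 : ℝ) 1) (mapsTo_univ _ _)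
      have h2 := (monotone_id.monotoneOn (univ : Set ℝ)).eVariationOn_le (mem_univ (0 : ℝ))
        (mem_univ 1)
      simp only [univ_inter, id, sub_zero, ENNReal.ofReal_one] at h2
      calc eVariationOn (auxG Z 0 a b) (Icc 0 1) ≤ _ := h
        _ ≤ (‖a - b‖₊ : ENNReal) * 1 := by gcongr
        _ = ENNReal.ofReal ‖a - b‖ := by
          rw [mul_one, ← coe_nnnorm, ENNReal.ofReal_coe_nnreal]
        _ ≤ _ := ENNReal.ofReal_le_ofReal (hΦ _ (norm_nonneg _))
    | succ k ih =>
      intro a ha b hb hab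
      obtain ⟨z1, z2, z3, z4⟩ := hZ a ha b hb hab
      have hn := norm_nonneg (a - b)
      refine (auxG_var Z k a b).trans ?_
      refine (add_le_add (ih a ha _ z1 (by linarith)) (ih _ z1 b hb (by linarith))).trans ?_
      rw [← ENNReal.ofReal_add ((norm_nonneg _).trans (hΦ _ (norm_nonneg _)))
        ((norm_nonneg _).trans (hΦ _ (norm_nonneg _)))]
      exact ENNReal.ofReal_le_ofReal z4
  have hbase : ∀ a b : X, ∀ t ∈ Icc (0 : ℝ) 1, ‖auxG Z 0 a b t - a‖ ≤ ‖a - b‖ ∧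
      ‖auxG Z 0 a b t - b‖ ≤ ‖a - b‖ := by
    intro a b t ht
    have hn := norm_nonneg (a - b)
    simp only [auxG]
    constructor
    · rw [add_sub_cancel_left, norm_smul, Real.norm_of_nonneg ht.1, norm_sub_rev b a]
      nlinarith [ht.2]
    · rw [show a + t • (b - a) - b = (1 - t) • (a - b) by module, norm_smul,
        Real.norm_of_nonneg (by linarith [ht.2])]
      nlinarith [ht.1]
  have hdiff : ∀ k, ∀ a ∈ A, ∀ b ∈ A, ‖a - b‖ < B → ∀ t ∈ Icc (0 : ℝ) 1,
      ‖auxG Z k a b t - auxG Z (k + 1) a b t‖ ≤ 2 * ‖a - b‖ * (2 / 3) ^ k := by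
    intro k
    induction k with
    | zero =>
      intro a ha b hb hab t ht
      obtain ⟨z1, z2, z3, z4⟩ := hZ a ha b hb hab
      have hn := norm_nonneg (a - b)
      have hh := hbase a b t ht
      rw [auxG.eq_2]
      simp only [pow_zero, mul_one]
      split_ifs with htt
      · have := (hbase a (Z a b) (2 * t) ⟨by linarith [ht.1], by linarith⟩).1
        have h3 := norm_sub_le_norm_sub_add_norm_sub (auxG Z 0 a b t) a
          (auxG Z 0 a (Z a b) (2 * t))
        rw [norm_sub_rev a] at h3
        linarith
      · push Not at htt
        have := (hbase (Z a b) b (2 * t - 1) ⟨by linarith, by linarith [ht.2]⟩).2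
        have h3 := norm_sub_le_norm_sub_add_norm_sub (auxG Z 0 a b t) b
          (auxG Z 0 (Z a b) b (2 * t - 1))
        rw [norm_sub_rev b] at h3
        linarith
    | succ k ih =>
      intro a ha b hb hab t ht
      obtain ⟨z1, z2, z3, z4⟩ := hZ a ha b hb hab
      have hn := norm_nonneg (a - b)
      have hp : (0 : ℝ) ≤ (2 / 3) ^ k := by positivity
      rw [auxG.eq_2, auxG.eq_2, pow_succ]
      dsimp only
      split_ifs with htt
      · have := ih a ha _ z1 (by linarith) (2 * t) ⟨by linarith [ht.1], by linarith⟩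
        nlinarith
      · push Not at htt
        have := ih _ z1 b hb (by linarith) (2 * t - 1) ⟨by linarith, by linarith [ht.2]⟩
        nlinarith
  have hnear : ∀ k, ∀ a ∈ A, ∀ b ∈ A, ‖a - b‖ < B → ∀ t ∈ Icc (0 : ℝ) 1,
      ∃ p ∈ A, dist (auxG Z k a b t) p ≤ ‖a - b‖ * (2 / 3) ^ k := by
    intro k
    induction k with
    | zero =>
      intro a ha b hb hab t ht
      refine ⟨a, ha, ?_⟩
      rw [dist_eq_norm]; simpa using (hbase a b t ht).1
    | succ k ih =>
      intro a ha b hb hab t ht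
      obtain ⟨z1, z2, z3, z4⟩ := hZ a ha b hb hab
      have hn := norm_nonneg (a - b)
      have hp : (0 : ℝ) ≤ (2 / 3) ^ k := by positivity
      rw [auxG.eq_2, pow_succ]
      dsimp only
      split_ifs with htt
      · obtain ⟨p, hp1, hp2⟩ :=
          ih a ha _ z1 (by linarith) (2 * t) ⟨by linarith [ht.1], by linarith⟩
        exact ⟨p, hp1, by nlinarith⟩
      · push Not at htt
        obtain ⟨p, hp1, hp2⟩ :=
          ih _ z1 b hb (by linarith) (2 * t - 1) ⟨by linarith, by linarith [ht.2]⟩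
        exact ⟨p, hp1, by nlinarith⟩
  have hd : ∀ t ∈ Icc (0 : ℝ) 1, ∀ n, dist (auxG Z n x0 x1 t) (auxG Z (n + 1) x0 x1 t) ≤
      2 * ‖x0 - x1‖ * (2 / 3) ^ n := by
    intro t ht n
    rw [dist_eq_norm]; exact hdiff n x0 h0 x1 h1 h01 t ht
  have hex : ∀ t, ∃ y, t ∈ Icc (0 : ℝ) 1 →
      Filter.Tendsto (fun n => auxG Z n x0 x1 t) Filter.atTop (nhds y) := by
    intro t
    by_cases ht : t ∈ Icc (0 : ℝ) 1
    · obtain ⟨y, hy⟩ := cauchySeq_tendsto_of_complete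
        (cauchySeq_of_le_geometric (2 / 3) _ (by norm_num) (hd t ht))
      exact ⟨y, fun _ => hy⟩
    · exact ⟨x0, fun h => absurd h ht⟩
  choose f hf using hex
  have hpw : Filter.Tendsto (fun n : ℕ => ((2 : ℝ) / 3) ^ n) Filter.atTop (nhds 0) :=
    tendsto_pow_atTop_nhds_zero_of_lt_one (by norm_num) (by norm_num)
  have hunif : TendstoUniformlyOn (fun n => auxG Z n x0 x1) f Filter.atTop (Icc 0 1) := by
    rw [Metric.tendstoUniformlyOn_iff]
    intro ε hε
    have h2 : Filter.Tendsto (fun n : ℕ => 2 * ‖x0 - x1‖ * (2 / 3 : ℝ) ^ n / (1 - 2 / 3))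
        Filter.atTop (nhds 0) := by
      simpa using (hpw.const_mul (2 * ‖x0 - x1‖)).div_const (1 - 2 / 3)
    filter_upwards [h2.eventually_lt_const hε] with n hn t ht
    rw [dist_comm]
    exact (dist_le_of_le_geometric_of_tendsto (2 / 3) _ (by norm_num) (hd t ht) (hf t ht) n).trans_lt
      hn
  have m0 : (0 : ℝ) ∈ Icc (0 : ℝ) 1 := by simp
  have m1 : (1 : ℝ) ∈ Icc (0 : ℝ) 1 := by simp
  refine ⟨f, ⟨?_, ?_, ?_, ?_⟩, ?_⟩
  · exact hunif.continuousOn (Filter.Frequently.of_forall fun n => (auxG_cont Z n _ _).continuousOn)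
  · refine tendsto_nhds_unique (hf 0 m0) ?_
    simp only [(auxG_ends Z _ x0 x1).1]; exact tendsto_const_nhds
  · refine tendsto_nhds_unique (hf 1 m1) ?_
    simp only [(auxG_ends Z _ x0 x1).2]; exact tendsto_const_nhds
  · rintro _ ⟨t, ht, rfl⟩
    choose p hp1 hp2 using fun k => hnear k x0 h0 x1 h1 h01 t ht
    have hdist : Filter.Tendsto (fun n => dist (auxG Z n x0 x1 t) (p n)) Filter.atTop (nhds 0) :=
      squeeze_zero (fun _ => dist_nonneg) hp2 (by simpa using hpw.const_mul ‖x0 - x1‖)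
    have hpt := (tendsto_iff_of_dist hdist).1 (hf t ht)
    exact hA.mem_of_tendsto hpt (Filter.Eventually.of_forall hp1)
  · by_contra! h
    obtain ⟨n, hn⟩ := (eVariationOn.lowerSemicontinuous_aux
      (F := fun n => auxG Z n x0 x1) (p := Filter.atTop) (fun t ht => hf t ht) h).exists
    exact absurd hn (not_lt.2 (hvar n x0 h0 x1 h1 h01))

/-- Good approximate midpoints in `A`. -/
lemma aux_sel {X : Type*} [NormedAddCommGroup X] [NormedSpace ℝ X] [CompleteSpace X]
    {s C : ℝ} (hs1 : 1 < s) (hs2 : s ≤ 2) (hC : 0 < C)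
    (hpow : ∀ τ : ℝ, 0 ≤ τ → modSmooth X τ ≤ C * τ ^ s) {A : Set X} {R : ℝ} (hR : 0 < R)
    (hA : ProximallySmooth A R) {a b : X} (ha : a ∈ A) (hb : b ∈ A) (hab : ‖a - b‖ ≤ R / 2)
    (hsmall : 2 * C * (‖a - b‖ / R) ^ (s - 1) ≤ 1 / 6) :
    ∃ z ∈ A, ‖a - z‖ ≤ 2 / 3 * ‖a - b‖ ∧ ‖z - b‖ ≤ 2 / 3 * ‖a - b‖ ∧
      ‖a - z‖ + ‖z - b‖ ≤
        ‖a - b‖ * (1 + C * (4 * C) ^ s * (‖a - b‖ / R) ^ (s * (s - 1))) := by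
  rcases eq_or_ne a b with rfl | hne
  · exact ⟨a, ha, by simp, by simp, by simp⟩
  have hτ0 : 0 < ‖a - b‖ := norm_pos_iff.2 (sub_ne_zero.2 hne)
  have hmid := aux_mid hs1 hs2 hC hpow hR hA ha hb hab
  obtain ⟨u, hu⟩ : ∃ u : X, u = (1 / 2 : ℝ) • (a - b) := ⟨_, rfl⟩
  have hun : ‖u‖ = ‖a - b‖ / 2 := by
    rw [hu, norm_smul]; norm_num; linarith
  have hau : a = midpoint ℝ a b + u := by
    rw [hu, midpoint_eq_smul_add]; simp only [invOf_eq_inv]; module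
  have hbu : b = midpoint ℝ a b - u := by
    rw [hu, midpoint_eq_smul_add]; simp only [invOf_eq_inv]; module
  set τ := ‖a - b‖ with hτ
  set m := midpoint ℝ a b with hm
  have hβ : 0 < (τ / R) ^ (s - 1) := by positivity
  have hE : 0 < C * τ * (τ / R) ^ (s - 1) := by positivity
  obtain ⟨z, hzA, hz⟩ := (infDist_lt_iff ⟨a, ha⟩).1
    (show infDist m A < 2 * (C * τ * (τ / R) ^ (s - 1)) by linarith)
  rw [dist_eq_norm] at hz
  set w := m - z with hw
  have hw6 : ‖w‖ ≤ τ / 6 := by nlinarith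
  have haz : a - z = u + w := by rw [hw]; nth_rewrite 1 [hau]; abel
  have hzb : z - b = u - w := by rw [hw]; nth_rewrite 1 [hbu]; abel
  refine ⟨z, hzA, ?_, ?_, ?_⟩
  · rw [haz]; have := norm_add_le u w; linarith
  · rw [hzb]; have := norm_sub_le u w; linarith
  · rw [haz, hzb]
    have hu0 : 0 < ‖u‖ := by rw [hun]; linarith
    refine (aux_smooth hpow u w (norm_pos_iff.1 hu0)).trans ?_
    have e1 : ‖w‖ / ‖u‖ ≤ 4 * C * (τ / R) ^ (s - 1) := by
      rw [div_le_iff₀ hu0, hun]; linarith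
    have e2 : (‖w‖ / ‖u‖) ^ s ≤ (4 * C) ^ s * (τ / R) ^ (s * (s - 1)) := by
      refine (Real.rpow_le_rpow (by positivity) e1 (by linarith)).trans_eq ?_
      rw [Real.mul_rpow (by positivity) hβ.le, ← Real.rpow_mul (by positivity), mul_comm (s - 1)]
    have e3 : 2 * ‖u‖ = τ := by rw [hun]; ring
    rw [e3]
    have : C * (‖w‖ / ‖u‖) ^ s ≤ C * ((4 * C) ^ s * (τ / R) ^ (s * (s - 1))) := by gcongr
    nlinarith

/-- The recursive length estimate. -/
lemma aux_num {c L α q R τ τ1 τ2 : ℝ} (hc : 0 < c) (hL : 0 < L) (hα : 0 < α) (hR : 0 < R)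
    (hq : q = (2 / 3 : ℝ) ^ α) (hτ : 0 ≤ τ) (h1 : 0 ≤ τ1) (h2 : 0 ≤ τ2)
    (h13 : τ1 ≤ 2 / 3 * τ) (h23 : τ2 ≤ 2 / 3 * τ)
    (hsum : τ1 + τ2 ≤ τ * (1 + c * (τ / R) ^ α))
    (hsm : c * (τ / R) ^ α ≤ (1 - q) / 2) (hLc : c ≤ L * ((1 - q) / 2)) (hq1 : q < 1) :
    τ1 * (1 + L * (τ1 / R) ^ α) + τ2 * (1 + L * (τ2 / R) ^ α) ≤
      τ * (1 + L * (τ / R) ^ α) := by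
  have hq0 : 0 < q := by rw [hq]; positivity
  have hpw : ∀ t, 0 ≤ t → t ≤ 2 / 3 * τ → (t / R) ^ α ≤ q * (τ / R) ^ α := by
    intro t ht htt
    rw [hq, ← Real.mul_rpow (by norm_num) (by positivity)]
    refine Real.rpow_le_rpow (by positivity) ?_ hα.le
    rw [← mul_div_assoc]; gcongr
  have p1 := hpw τ1 h1 h13
  have p2 := hpw τ2 h2 h23
  set b := (τ / R) ^ α with hb
  have hb0 : 0 ≤ b := by positivity
  calc _ ≤ τ1 * (1 + L * (q * b)) + τ2 * (1 + L * (q * b)) := by gcongr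
    _ = (τ1 + τ2) * (1 + L * (q * b)) := by ring
    _ ≤ τ * (1 + c * b) * (1 + L * (q * b)) := by gcongr
    _ = τ * (1 + (c + L * q + c * b * (L * q)) * b) := by ring
    _ ≤ τ * (1 + L * b) := by
      gcongr
      have : c * b * (L * q) ≤ (1 - q) / 2 * (L * q) := by gcongr
      have h3 : (1 - q) / 2 * (L * q) ≤ (1 - q) / 2 * (L * 1) := by
        have : 0 ≤ (1 - q) / 2 := by linarith
        gcongr
      nlinarith

theorem statement10 (X : Type*) [NormedAddCommGroup X] [NormedSpace ℝ X]
    [CompleteSpace X] [UniformConvexSpace X] (hsm : UnifSmooth X)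
    (s : ℝ) (hs1 : 1 < s) (hs2 : s ≤ 2)
    (hpow : ∃ C : ℝ, ∀ τ : ℝ, 0 ≤ τ → modSmooth X τ ≤ C * τ ^ s) :
    ∃ βL L : ℝ, 0 < βL ∧ 0 < L ∧
      ∀ (A : Set X) (R : ℝ), 0 < R → ProximallySmooth A R →
        ∀ x0 ∈ A, ∀ x1 ∈ A, ‖x0 - x1‖ / R < βL →
          ∃ f : ℝ → X, IsCurveIn A x0 x1 f ∧
            eVariationOn f (Set.Icc 0 1) ≤
              ENNReal.ofReal
                (‖x0 - x1‖ * (1 + L * (‖x0 - x1‖ / R) ^ (s * (s - 1)))) := by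
  obtain ⟨C0, hC0⟩ := hpow
  obtain ⟨C, hCdef⟩ : ∃ C, C = max C0 1 := ⟨_, rfl⟩
  have hC : 0 < C := by rw [hCdef]; exact lt_max_of_lt_right one_pos
  have hpow : ∀ τ : ℝ, 0 ≤ τ → modSmooth X τ ≤ C * τ ^ s := by
    intro τ hτ
    refine (hC0 τ hτ).trans ?_
    gcongr
    rw [hCdef]; exact le_max_left _ _
  have hs0 : 0 < s - 1 := by linarith
  have hα : 0 < s * (s - 1) := by positivity
  obtain ⟨q, hq⟩ : ∃ q : ℝ, q = (2 / 3 : ℝ) ^ (s * (s - 1)) := ⟨_, rfl⟩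
  have hq1 : q < 1 := by
    rw [hq]; exact Real.rpow_lt_one (by norm_num) (by norm_num) hα
  obtain ⟨c, hc⟩ : ∃ c, c = C * (4 * C) ^ s := ⟨_, rfl⟩
  have hc0 : 0 < c := by rw [hc]; positivity
  have ev1 : ∀ᶠ β : ℝ in nhds 0, 2 * C * β ^ (s - 1) < 1 / 6 := by
    have : ContinuousAt (fun β : ℝ => 2 * C * β ^ (s - 1)) 0 :=
      continuousAt_const.mul (Real.continuousAt_rpow_const _ _ (Or.inr hs0.le))
    refine this.eventually_lt_const ?_
    dsimp only
    rw [Real.zero_rpow hs0.ne']; norm_num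
  have ev2 : ∀ᶠ β : ℝ in nhds 0, c * β ^ (s * (s - 1)) < (1 - q) / 2 := by
    have : ContinuousAt (fun β : ℝ => c * β ^ (s * (s - 1))) 0 :=
      continuousAt_const.mul (Real.continuousAt_rpow_const _ _ (Or.inr hα.le))
    refine this.eventually_lt_const ?_
    dsimp only
    rw [Real.zero_rpow hα.ne']; linarith
  obtain ⟨β1, hβ1, hev⟩ := Metric.eventually_nhds_iff.1 (ev1.and ev2)
  have hβ : ∀ β : ℝ, 0 ≤ β → β < β1 → 2 * C * β ^ (s - 1) ≤ 1 / 6 ∧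
      c * β ^ (s * (s - 1)) ≤ (1 - q) / 2 := by
    intro β h0 h1
    have := hev (y := β) (by rw [Real.dist_eq, sub_zero, abs_of_nonneg h0]; exact h1)
    exact ⟨this.1.le, this.2.le⟩
  have hq2 : 0 < (1 - q) / 2 := by linarith
  obtain ⟨L, hLdef⟩ : ∃ L, L = c / ((1 - q) / 2) := ⟨_, rfl⟩
  have hL : 0 < L := by rw [hLdef]; positivity
  have hLc : c ≤ L * ((1 - q) / 2) := by
    rw [hLdef, div_mul_cancel₀ _ hq2.ne']
  refine ⟨min β1 (1 / 2), L, lt_min hβ1 (by norm_num), hL, ?_⟩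
  intro A R hR hA x0 hx0 x1 hx1 h01
  have hsel : ∀ a b : X, ∃ z, a ∈ A → b ∈ A → ‖a - b‖ < min β1 (1 / 2) * R →
      z ∈ A ∧ ‖a - z‖ ≤ 2 / 3 * ‖a - b‖ ∧ ‖z - b‖ ≤ 2 / 3 * ‖a - b‖ ∧
      ‖a - z‖ * (1 + L * (‖a - z‖ / R) ^ (s * (s - 1))) +
        ‖z - b‖ * (1 + L * (‖z - b‖ / R) ^ (s * (s - 1))) ≤
        ‖a - b‖ * (1 + L * (‖a - b‖ / R) ^ (s * (s - 1))) := by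
    intro a b
    by_cases h : a ∈ A ∧ b ∈ A ∧ ‖a - b‖ < min β1 (1 / 2) * R
    · obtain ⟨ha, hb, hab⟩ := h
      have hab' : ‖a - b‖ / R < min β1 (1 / 2) := by rwa [div_lt_iff₀ hR]
      obtain ⟨k1, k2⟩ := hβ (‖a - b‖ / R) (by positivity) (hab'.trans_le (min_le_left _ _))
      have k3 := hab'.trans_le (min_le_right _ _)
      rw [div_lt_iff₀ hR] at k3
      obtain ⟨z, hz, z1, z2, z3⟩ := aux_sel hs1 hs2 hC hpow hR hA ha hb (by linarith) k1
      rw [← hc] at z3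
      exact ⟨z, fun _ _ _ => ⟨hz, z1, z2, aux_num hc0 hL hα hR hq (norm_nonneg _) (norm_nonneg _)
        (norm_nonneg _) z1 z2 z3 k2 hLc hq1⟩⟩
    · exact ⟨a, fun h1 h2 h3 => absurd ⟨h1, h2, h3⟩ h⟩
  choose Z hZ using hsel
  exact aux_curve (Φ := fun t => t * (1 + L * (t / R) ^ (s * (s - 1)))) hA.1
    (fun t ht => by
      have : 0 ≤ t * (L * (t / R) ^ (s * (s - 1))) := by positivity
      linarith) Z (fun a ha b hb hab => hZ a b ha hb hab) x0 x1 hx0 hx1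
    (by rwa [div_lt_iff₀ hR] at h01)
end
end

section
/- Let X be a uniformly convex and uniformly smooth real Banach space whose modulus of smoothness is of power type s. Then there exist positive constants β_I and L_I with the following property: for every set A ⊂ X that is proximally smooth with constant R > 0 and every pair of points x0, x1 ∈ A with ‖x0 − x1‖/R < β_I, there exists a rectifiable curve γ contained in A with endpoints x0 and x1 such that γ ⊂ conv{ x0, B_r((x0+x1)/2), x1 }, where B_r((x0+x1)/2) is the closed ball centered at (x0+x1)/2 of radius r = L_I·‖x0 − x1‖·(‖x0 − x1‖/R)^{s−1}. -/
noncomputable section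

open Set Metric

section aux
variable {X : Type*} [NormedAddCommGroup X] [NormedSpace ℝ X]

lemma uc_aux [UniformConvexSpace X] {r ε : ℝ} (hr : 0 < r) (hε : 0 < ε) :
    ∃ δ > 0, ∀ x y : X, ‖x‖ ≤ r + δ → ‖y‖ ≤ r + δ → 2 * r - δ ≤ ‖x + y‖ → ‖x - y‖ < ε := by
  obtain ⟨δ, hδ, h⟩ := exists_forall_closed_ball_dist_add_le_two_sub X
    (show 0 < ε / (2 * r) by positivity)
  set δ' := min r (δ * r / 4) with hδ'
  have h0 : 0 < δ' := lt_min hr (by positivity)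
  have h1 : δ' ≤ r := min_le_left _ _
  have h2 : δ' ≤ δ * r / 4 := min_le_right _ _
  refine ⟨δ', h0, fun x y hx hy hxy => ?_⟩
  by_contra! hc
  have hk : 0 < r + δ' := by linarith
  have hki : 0 < (r + δ')⁻¹ := by positivity
  have key := @h ((r + δ')⁻¹ • x) (by
      rw [norm_smul, Real.norm_of_nonneg hki.le, inv_mul_le_iff₀ hk]; linarith)
    ((r + δ')⁻¹ • y) (by
      rw [norm_smul, Real.norm_of_nonneg hki.le, inv_mul_le_iff₀ hk]; linarith)
    (by
      rw [← smul_sub, norm_smul, Real.norm_of_nonneg hki.le, le_inv_mul_iff₀ hk]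
      refine le_trans ?_ hc
      rw [mul_div_assoc', div_le_iff₀ (by positivity)]
      nlinarith)
  rw [← smul_add, norm_smul, Real.norm_of_nonneg hki.le, inv_mul_le_iff₀ hk] at key
  nlinarith [mul_pos hδ h0, mul_pos hδ hr]

/-- almost minimizers are almost normed by the derivative -/
lemma deriv_aux {A : Set X} {x : X} {p : X →L[ℝ] ℝ}
    (hp : HasFDerivAt (fun z => Metric.infDist z A) p x) {ε : ℝ} (hε : 0 < ε) :
    ∃ η > 0, ∀ a ∈ A, ‖x - a‖ ≤ Metric.infDist x A + η →
      Metric.infDist x A - ε ≤ p (x - a) := by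
  set d := Metric.infDist x A with hd
  have hd0 : 0 ≤ d := Metric.infDist_nonneg
  have hε' : 0 < ε / (2 * (d + 1)) := by positivity
  have h1 := (hasFDerivAt_iff_isLittleO_nhds_zero.1 hp).def hε'
  obtain ⟨κ, hκ, hb⟩ := Metric.eventually_nhds_iff.1 h1
  set t := min (1 / 2) (κ / (2 * (d + 1))) with ht
  have ht0 : 0 < t := lt_min (by norm_num) (by positivity)
  have ht1 : t ≤ 1 / 2 := min_le_left _ _
  have ht2 : t * (2 * (d + 1)) ≤ κ := by
    rw [← le_div_iff₀ (by positivity)]; exact min_le_right _ _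
  set η := min 1 (t * ε / 2) with hη
  have hη0 : 0 < η := lt_min one_pos (by positivity)
  have hη1 : η ≤ 1 := min_le_left _ _
  have hη2 : η ≤ t * ε / 2 := min_le_right _ _
  refine ⟨η, hη0, fun a ha hxa => ?_⟩
  have hn : ‖t • (a - x)‖ ≤ t * (d + 1) := by
    rw [norm_smul, Real.norm_of_nonneg ht0.le, norm_sub_rev]
    gcongr; linarith
  have h2 := @hb (t • (a - x)) (by
    rw [dist_zero_right]; nlinarith [mul_pos ht0 (show 0 < d + 1 by linarith)])
  have h3 : Metric.infDist (x + t • (a - x)) A ≤ (1 - t) * ‖x - a‖ := by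
    refine (Metric.infDist_le_dist_of_mem ha).trans ?_
    rw [dist_eq_norm, show x + t • (a - x) - a = (1 - t) • (x - a) by module, norm_smul,
      Real.norm_of_nonneg (by linarith)]
  have h4 := neg_le_of_abs_le (show |_| ≤ _ from h2)
  rw [map_smul, smul_eq_mul, show a - x = -(x - a) by abel, map_neg] at h4
  rw [show a - x = -(x - a) by abel] at hn h3
  have h5 : ε / (2 * (d + 1)) * ‖t • -(x - a)‖ ≤ t * ε / 2 := by
    calc _ ≤ ε / (2 * (d + 1)) * (t * (d + 1)) := by gcongr
      _ = _ := by field_simp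
  have h6 : (1 - t) * ‖x - a‖ ≤ (1 - t) * (d + η) := by
    gcongr; linarith
  have h7 : t * (d - ε) ≤ t * p (x - a) := by nlinarith [mul_pos ht0 hη0]
  exact le_of_mul_le_mul_left h7 ht0

lemma near_aux [CompleteSpace X] [UniformConvexSpace X] {A : Set X} (hA : IsClosed A)
    (hne : A.Nonempty) {x : X} (hx : 0 < Metric.infDist x A)
    (hd : DifferentiableAt ℝ (fun z => Metric.infDist z A) x) :
    ∃ a ∈ A, ‖x - a‖ = Metric.infDist x A ∧
      fderiv ℝ (fun z => Metric.infDist z A) x (x - a) = ‖x - a‖ := by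
  set d := Metric.infDist x A with hdd
  set p := fderiv ℝ (fun z => Metric.infDist z A) x with hp
  have hpn : ‖p‖ ≤ 1 := by
    simpa using norm_fderiv_le_of_lipschitz ℝ (x₀ := x) (Metric.lipschitz_infDist_pt A)
  have hpb : ∀ v, p v ≤ ‖v‖ := fun v => by
    calc p v ≤ ‖p v‖ := le_abs_self _
      _ ≤ ‖p‖ * ‖v‖ := p.le_opNorm v
      _ ≤ 1 * ‖v‖ := by gcongr
      _ = _ := one_mul _
  have hda := fun ε hε => deriv_aux hd.hasFDerivAt (ε := ε) hε
  have hex : ∀ n : ℕ, ∃ a ∈ A, ‖x - a‖ < d + 1 / (n + 1) := fun n => by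
    have := (Metric.infDist_lt_iff (x := x) (r := d + 1 / (n + 1)) hne).1
      (by have : (0 : ℝ) < 1 / (n + 1) := by positivity
          linarith)
    simpa [dist_eq_norm] using this
  choose a haA ha using hex
  have hev : ∀ η > 0, ∃ N : ℕ, ∀ n ≥ N, ‖x - a n‖ ≤ d + η := fun η hη => by
    obtain ⟨N, hN⟩ := exists_nat_one_div_lt hη
    refine ⟨N, fun n hn => (ha n).le.trans ?_⟩
    have : (1 : ℝ) / (n + 1) ≤ 1 / (N + 1) := by gcongr
    linarith
  have hcau : CauchySeq a := by
    rw [Metric.cauchySeq_iff]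
    intro ε hε
    obtain ⟨δ, hδ, hu⟩ := uc_aux (X := X) hx hε
    obtain ⟨η, hη, hq⟩ := hda (δ / 2) (by positivity)
    obtain ⟨N, hN⟩ := hev (min δ η) (lt_min hδ hη)
    refine ⟨N, fun m hm n hn => ?_⟩
    have b1 := hN m hm
    have b2 := hN n hn
    have c1 := min_le_left δ η
    have c2 := min_le_right δ η
    have e1 := hq (a m) (haA m) (by linarith)
    have e2 := hq (a n) (haA n) (by linarith)
    have e3 := hpb ((x - a m) + (x - a n))
    rw [map_add] at e3
    have := hu (x - a m) (x - a n) (by linarith) (by linarith) (by linarith)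
    rw [dist_comm, dist_eq_norm]
    simpa using this
  obtain ⟨b, hb⟩ := cauchySeq_tendsto_of_complete hcau
  have hbA : b ∈ A := hA.mem_of_tendsto hb (Filter.Eventually.of_forall haA)
  have hxb : ‖x - b‖ = d := by
    refine le_antisymm ?_ (by rw [← dist_eq_norm]; exact Metric.infDist_le_dist_of_mem hbA)
    refine le_of_forall_pos_le_add fun η hη => ?_
    obtain ⟨N, hN⟩ := hev η hη
    have ht : Filter.Tendsto (fun n => ‖x - a n‖) Filter.atTop (nhds ‖x - b‖) :=
      (tendsto_const_nhds.sub hb).norm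
    exact le_of_tendsto ht (Filter.eventually_atTop.2 ⟨N, hN⟩)
  refine ⟨b, hbA, hxb, le_antisymm (hpb _) ?_⟩
  refine le_of_forall_sub_le fun ε hε => ?_
  obtain ⟨η, hη, hq⟩ := hda ε hε
  rw [hxb]
  exact hq b hbA (by linarith)

/-- a form of Ekeland's principle -/
lemma ekeland_aux [CompleteSpace X] {K : Set X} (hK : IsClosed K) {g : X → ℝ}
    (hg : Continuous g) {M : ℝ} (hM : ∀ z ∈ K, g z ≤ M) {c : ℝ} (hc : 0 < c) {x : X}
    (hx : x ∈ K) :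
    ∃ z ∈ K, c * ‖z - x‖ ≤ g z - g x ∧ ∀ w ∈ K, c * ‖w - z‖ ≤ g w - g z → w = z := by
  let S : X → Set X := fun z => {w | w ∈ K ∧ c * ‖w - z‖ ≤ g w - g z}
  have hself : ∀ z ∈ K, z ∈ S z := fun z hz => ⟨hz, by simp⟩
  have hbdd : ∀ z, BddAbove (g '' S z) := fun z => ⟨M, by rintro _ ⟨w, hw, rfl⟩; exact hM w hw.1⟩
  have htrans : ∀ z w v, w ∈ S z → v ∈ S w → v ∈ S z := fun z w v hw hv => ⟨hv.1, by
    have h1 := hw.2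
    have h2 := hv.2
    have h3 : ‖v - z‖ ≤ ‖v - w‖ + ‖w - z‖ := norm_sub_le_norm_sub_add_norm_sub v w z
    nlinarith⟩
  have hstep : ∀ z, ∃ w, z ∈ K → w ∈ S z ∧ ∀ v ∈ S z, g v ≤ 2 * g w - g z := fun z => by
    by_cases hz : z ∈ K
    · have hle : g z ≤ sSup (g '' S z) := le_csSup (hbdd z) ⟨z, hself z hz, rfl⟩
      rcases hle.eq_or_lt with h | h
      · refine ⟨z, fun _ => ⟨hself z hz, fun v hv => ?_⟩⟩
        have := le_csSup (hbdd z) ⟨v, hv, rfl⟩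
        linarith
      · obtain ⟨_, ⟨w, hw, rfl⟩, hlt⟩ := exists_lt_of_lt_csSup
          (show (g '' S z).Nonempty from ⟨_, z, hself z hz, rfl⟩)
          (show (g z + sSup (g '' S z)) / 2 < sSup (g '' S z) by linarith)
        refine ⟨w, fun _ => ⟨hw, fun v hv => ?_⟩⟩
        have := le_csSup (hbdd z) ⟨v, hv, rfl⟩
        linarith
    · exact ⟨z, fun h => absurd h hz⟩
  choose T hT using hstep
  let u : ℕ → X := fun n => T^[n] x
  have hu1 : ∀ n, u (n + 1) = T (u n) := fun n => Function.iterate_succ_apply' _ _ _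
  have huK : ∀ n, u n ∈ K := fun n => by
    induction n with
    | zero => exact hx
    | succ n ih => rw [hu1]; exact (hT _ ih).1.1
  have hmem : ∀ n k, u (n + k) ∈ S (u n) := fun n k => by
    induction k with
    | zero => exact hself _ (huK n)
    | succ k ih =>
      rw [← add_assoc, hu1]
      exact htrans _ _ _ ih (hT _ (huK _)).1
  have hmono : Monotone (fun n => g (u n)) := fun m n hmn => by
    obtain ⟨k, rfl⟩ := Nat.exists_eq_add_of_le hmn
    have := (hmem m k).2
    have h2 : 0 ≤ c * ‖u (m + k) - u m‖ := by positivity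
    show g (u m) ≤ g (u (m + k))
    linarith
  have hbd : BddAbove (Set.range fun n => g (u n)) := ⟨M, by rintro _ ⟨n, rfl⟩; exact hM _ (huK n)⟩
  have hlim := tendsto_atTop_ciSup hmono hbd
  set G := ⨆ n, g (u n) with hG
  have hle : ∀ n, g (u n) ≤ G := fun n => le_ciSup hbd n
  have hcau : CauchySeq u := by
    refine Metric.cauchySeq_iff'.2 fun ε hε => ?_
    have := hlim.eventually (lt_mem_nhds (show G - c * ε < G by nlinarith [mul_pos hc hε]))
    obtain ⟨N, hN⟩ := this.exists
    refine ⟨N, fun n hn => ?_⟩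
    obtain ⟨k, rfl⟩ := Nat.exists_eq_add_of_le hn
    have h1 := (hmem N k).2
    have h2 := hle (N + k)
    rw [dist_eq_norm]
    refine lt_of_mul_lt_mul_left ?_ hc.le
    linarith
  obtain ⟨z, hz⟩ := cauchySeq_tendsto_of_complete hcau
  have hgz : Filter.Tendsto (fun n => g (u n)) Filter.atTop (nhds (g z)) := (hg.tendsto z).comp hz
  have hGz : G = g z := tendsto_nhds_unique hlim hgz
  have hzK : z ∈ K := hK.mem_of_tendsto hz (Filter.Eventually.of_forall huK)
  have hzS : ∀ n, z ∈ S (u n) := fun n => ⟨hzK, by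
    have t1 : Filter.Tendsto (fun k => c * ‖u k - u n‖) Filter.atTop (nhds (c * ‖z - u n‖)) :=
      ((hz.sub_const _).norm).const_mul c
    have t2 := hgz.sub_const (g (u n))
    refine le_of_tendsto_of_tendsto t1 t2 (Filter.eventually_atTop.2 ⟨n, fun k hk => ?_⟩)
    obtain ⟨j, rfl⟩ := Nat.exists_eq_add_of_le hk
    exact (hmem n j).2⟩
  refine ⟨z, hzK, (hzS 0).2, fun w hw hwz => ?_⟩
  have h1 : ∀ n, g w ≤ 2 * g (u (n + 1)) - g (u n) := fun n => by
    rw [hu1]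
    exact (hT _ (huK n)).2 w (htrans _ _ _ (hzS n) ⟨hw, hwz⟩)
  have h2 : g w ≤ 2 * g z - g z :=
    ge_of_tendsto' (((hgz.comp (Filter.tendsto_add_atTop_nat 1)).const_mul 2).sub hgz) h1
  have h3 : ‖w - z‖ ≤ 0 := by
    by_contra! h
    nlinarith [mul_pos hc h]
  exact sub_eq_zero.1 (norm_le_zero_iff.1 h3)

lemma ray_aux [CompleteSpace X] [UniformConvexSpace X] {A : Set X} {R : ℝ}
    (hP : ProximallySmooth A R) (hne : A.Nonempty) {x : X} (hx : 0 < Metric.infDist x A)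
    {t : ℝ} (ht : 0 < t) (hxt : Metric.infDist x A + t < R) {a : X} (ha : a ∈ A)
    (hxa : ‖x - a‖ = Metric.infDist x A) :
    Metric.infDist (x + (t / Metric.infDist x A) • (x - a)) A = Metric.infDist x A + t := by
  set d : X → ℝ := fun z => Metric.infDist z A with hd
  have hdc : Continuous d := Metric.continuous_infDist_pt A
  have hopen : IsOpen {z : X | 0 < Metric.infDist z A ∧ Metric.infDist z A < R} :=
    (isOpen_lt continuous_const hdc).inter (isOpen_lt hdc continuous_const)
  have hdiff : ∀ z, 0 < d z → d z < R → DifferentiableAt ℝ d z := fun z h1 h2 =>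
    (hP.2.differentiableOn one_ne_zero).differentiableAt (hopen.mem_nhds ⟨h1, h2⟩)
  have hlip : ∀ z w, d z ≤ d w + ‖z - w‖ := fun z w => by
    rw [← dist_eq_norm]; exact Metric.infDist_le_infDist_add_dist
  -- slope one
  have hslope : ∀ z, 0 < d z → d z < R → ∀ ε > 0, ∀ r > 0, ∃ w, w ≠ z ∧ ‖w - z‖ < r ∧
      (1 - ε) * ‖w - z‖ ≤ d w - d z := by
    intro z h1 h2 ε hε r hr
    obtain ⟨b, hb, hzb, hpb⟩ := near_aux hP.1 hne h1 (hdiff z h1 h2)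
    have h3 := (hasFDerivAt_iff_isLittleO_nhds_zero.1 (hdiff z h1 h2).hasFDerivAt).def hε
    obtain ⟨κ, hκ, hball⟩ := Metric.eventually_nhds_iff.1 h3
    have hpos : 0 < ‖z - b‖ := by rw [hzb]; exact h1
    set τ := min r κ / (2 * ‖z - b‖) with hτ
    have hτ0 : 0 < τ := div_pos (lt_min hr hκ) (by positivity)
    have hτn : τ * ‖z - b‖ = min r κ / 2 := by rw [hτ]; field_simp
    have hnn : ‖τ • (z - b)‖ = τ * ‖z - b‖ := by
      rw [norm_smul, Real.norm_of_nonneg hτ0.le]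
    have hmin := lt_min hr hκ
    refine ⟨z + τ • (z - b), ?_, ?_, ?_⟩
    · intro h
      have : ‖τ • (z - b)‖ = 0 := by rw [norm_eq_zero]; simpa using h
      rw [hnn] at this
      nlinarith
    · rw [add_sub_cancel_left, hnn, hτn]
      have := min_le_left r κ
      linarith
    · have h4 := @hball (τ • (z - b)) (by
        rw [dist_zero_right, hnn, hτn]
        have := min_le_right r κ
        linarith)
      have h5 := neg_le_of_abs_le (show |_| ≤ _ from h4)
      rw [map_smul, hpb, smul_eq_mul, ← hnn] at h5
      rw [add_sub_cancel_left]
      linarith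
  have hball : ∀ ε > 0, ε < 1 → ∃ z, ‖z - x‖ ≤ t ∧ d x + (1 - ε) * t ≤ d z := by
    intro ε hε hε1
    obtain ⟨z, hzK, hzx, hmax⟩ := ekeland_aux (Metric.isClosed_closedBall (x := x) (ε := t)) hdc
      (M := d x + t) (fun z hz => by
        have := hlip z x
        rw [Metric.mem_closedBall, dist_eq_norm] at hz
        linarith) (c := 1 - ε) (by linarith) (Metric.mem_closedBall_self ht.le)
    rw [Metric.mem_closedBall, dist_eq_norm] at hzK
    refine ⟨z, hzK, ?_⟩
    have hnn : 0 ≤ (1 - ε) * ‖z - x‖ := mul_nonneg (by linarith) (norm_nonneg _)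
    have hzt : ‖z - x‖ = t := by
      by_contra hne'
      have hlt := lt_of_le_of_ne hzK hne'
      have hl := hlip z x
      obtain ⟨w, hw1, hw2, hw3⟩ := hslope z (by
        have : 0 < d x := hx
        linarith) (by
        have : d x + t < R := hxt
        linarith) ε hε (t - ‖z - x‖) (by linarith)
      refine hw1 (hmax w ?_ hw3)
      rw [Metric.mem_closedBall, dist_eq_norm]
      have : ‖w - x‖ ≤ ‖w - z‖ + ‖z - x‖ := norm_sub_le_norm_sub_add_norm_sub w z x
      linarith
    rw [hzt] at hzx
    linarith
  set δ := Metric.infDist x A with hδ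
  set u := (1 / δ) • (x - a) with hu
  have hun : ‖u‖ = 1 := by
    rw [hu, norm_smul, hxa, Real.norm_of_nonneg (by positivity)]; field_simp
  have hgoal : x + (t / δ) • (x - a) = x + t • u := by
    rw [hu, smul_smul]; congr 2; ring
  rw [hgoal]
  refine le_antisymm ?_ ?_
  · have := hlip (x + t • u) x
    rw [add_sub_cancel_left, norm_smul, hun, Real.norm_of_nonneg ht.le] at this
    simpa using this
  · refine le_of_forall_sub_le fun ε hε => ?_
    obtain ⟨δ', hδ', huc⟩ := uc_aux (X := X) one_pos (show 0 < ε / (2 * t) by positivity)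
    set μ := min δ t with hμ
    have hμ0 : 0 < μ := lt_min hx ht
    have hμ1 : μ ≤ δ := min_le_left _ _
    have hμ2 : μ ≤ t := min_le_right _ _
    set e := min (1 / 2) (min (ε / (2 * t)) (μ * δ' / t)) with he
    have he0 : 0 < e := lt_min (by norm_num) (lt_min (by positivity) (by positivity))
    have he1 : e ≤ 1 / 2 := min_le_left _ _
    have he2 : e * t ≤ ε / 2 := by
      have : e ≤ ε / (2 * t) := (min_le_right _ _).trans (min_le_left _ _)
      calc e * t ≤ ε / (2 * t) * t := by gcongr
        _ = _ := by field_simp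
    have he3 : e * t ≤ μ * δ' := by
      have : e ≤ μ * δ' / t := (min_le_right _ _).trans (min_le_right _ _)
      rwa [le_div_iff₀ ht] at this
    obtain ⟨z, hz1, hz2⟩ := hball e he0 (by linarith)
    have hz3 : d z ≤ ‖z - a‖ := by rw [← dist_eq_norm]; exact Metric.infDist_le_dist_of_mem ha
    set V := (1 / t) • (z - x) with hV
    have hVn : ‖V‖ ≤ 1 := by
      rw [hV, norm_smul, Real.norm_of_nonneg (by positivity), one_div, inv_mul_le_iff₀ ht]
      linarith
    have hza : z - a = μ • (u + V) + (δ - μ) • u + (t - μ) • V := by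
      have e1 : t • V = z - x := by rw [hV, smul_smul, mul_one_div_cancel ht.ne', one_smul]
      have e2 : δ • u = x - a := by rw [hu, smul_smul, mul_one_div_cancel hx.ne', one_smul]
      calc z - a = t • V + δ • u := by rw [e1, e2]; abel
        _ = _ := by module
    have hn : ‖z - a‖ ≤ μ * ‖u + V‖ + (δ - μ) + (t - μ) := by
      rw [hza]
      refine norm_add₃_le.trans ?_
      rw [norm_smul μ, norm_smul (δ - μ) u, norm_smul (t - μ) V, hun, Real.norm_of_nonneg hμ0.le,
        Real.norm_of_nonneg (sub_nonneg.2 hμ1), Real.norm_of_nonneg (sub_nonneg.2 hμ2)]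
      nlinarith [mul_nonneg (sub_nonneg.2 hμ2) (sub_nonneg.2 hVn)]
    have hdx : d x = δ := rfl
    have h5 : μ * (2 - δ') ≤ μ * ‖u + V‖ := by nlinarith
    have h6 := le_of_mul_le_mul_left h5 hμ0
    have h7 := huc u V (by rw [hun]; linarith) (by linarith) (by linarith)
    have h8 := hlip z (x + t • u)
    have h9 : ‖z - (x + t • u)‖ ≤ ε / 2 := by
      have : z - (x + t • u) = (-t) • (u - V) := by
        have e1 : t • V = z - x := by rw [hV, smul_smul, mul_one_div_cancel ht.ne', one_smul]
        rw [show (-t) • (u - V) = t • V - t • u by module, e1]; abel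
      rw [this, norm_smul, norm_neg, Real.norm_of_nonneg ht.le]
      calc t * ‖u - V‖ ≤ t * (ε / (2 * t)) := by gcongr
        _ = _ := by field_simp
    have : d (x + t • u) = Metric.infDist (x + t • u) A := rfl
    linarith

/-- the midpoint estimate -/
lemma mid_aux [CompleteSpace X] [UniformConvexSpace X] {s C : ℝ} (hs1 : 1 < s) (hC : 0 ≤ C)
    (hpow : ∀ τ : ℝ, 0 ≤ τ → modSmooth X τ ≤ C * τ ^ s) {A : Set X} {R : ℝ} (hR : 0 < R)
    (hP : ProximallySmooth A R) {x y : X} (hx : x ∈ A) (hy : y ∈ A) (hxy : ‖x - y‖ / R < 1 / 4) :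
    ∃ z ∈ A, ‖z - midpoint ℝ x y‖ ≤ C * 4 ^ s * ‖x - y‖ * (‖x - y‖ / R) ^ (s - 1) := by
  have hne : A.Nonempty := ⟨x, hx⟩
  set m := midpoint ℝ x y with hm
  set l := ‖x - y‖ with hl
  have hl0 : 0 ≤ l := norm_nonneg _
  rw [div_lt_iff₀ hR] at hxy
  set δ := Metric.infDist m A with hδ
  rcases (show 0 ≤ δ from Metric.infDist_nonneg).eq_or_lt with h0 | h0
  · refine ⟨m, (hP.1.mem_iff_infDist_zero hne).2 h0.symm, ?_⟩
    rw [sub_self, norm_zero]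
    positivity
  set v := (1 / 2 : ℝ) • (x - y) with hv
  have hvn : ‖v‖ = l / 2 := by
    rw [hv, norm_smul, Real.norm_of_nonneg (by norm_num)]; ring
  have hmx : m + v = x := by rw [hm, hv, midpoint_eq_smul_add, invOf_eq_inv]; module
  have hmy : m - v = y := by rw [hm, hv, midpoint_eq_smul_add, invOf_eq_inv]; module
  have hδl : δ ≤ l / 2 := by
    rw [← hvn]
    refine (Metric.infDist_le_dist_of_mem hx).trans ?_
    rw [dist_eq_norm, ← hmx, sub_add_cancel_left, norm_neg]
  have hdc : Continuous (fun z => Metric.infDist z A) := Metric.continuous_infDist_pt A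
  have hopen : IsOpen {z : X | 0 < Metric.infDist z A ∧ Metric.infDist z A < R} :=
    (isOpen_lt continuous_const hdc).inter (isOpen_lt hdc continuous_const)
  obtain ⟨a, ha, hma, -⟩ := near_aux hP.1 hne h0
    ((hP.2.differentiableOn one_ne_zero).differentiableAt (hopen.mem_nhds ⟨h0, by linarith⟩))
  refine ⟨a, ha, ?_⟩
  rw [norm_sub_rev, hma]
  have hray := ray_aux hP hne h0 (t := R / 4) (by positivity) (by linarith) ha hma
  rw [← hδ] at hray hma ⊢
  set u := (1 / δ) • (m - a) with hu
  have hun : ‖u‖ = 1 := by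
    rw [hu, norm_smul, hma, Real.norm_of_nonneg (by positivity)]; field_simp
  have hgoal : m + (R / 4 / δ) • (m - a) = m + (R / 4) • u := by
    rw [hu, smul_smul]; congr 2; ring
  rw [hgoal] at hray
  have h1 : δ + R / 4 ≤ ‖(R / 4) • u - v‖ := by
    rw [← hray]
    refine (Metric.infDist_le_dist_of_mem hx).trans ?_
    rw [dist_eq_norm, ← hmx]
    exact le_of_eq (by congr 1; abel)
  have h2 : δ + R / 4 ≤ ‖(R / 4) • u + v‖ := by
    rw [← hray]
    refine (Metric.infDist_le_dist_of_mem hy).trans ?_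
    rw [dist_eq_norm, ← hmy]
    exact le_of_eq (by congr 1; abel)
  set w := (4 / R) • v with hw
  have hwn : ‖w‖ = 2 * (l / R) := by
    rw [hw, norm_smul, hvn, Real.norm_of_nonneg (by positivity)]; ring
  have hvw : v = (R / 4) • w := by
    rw [hw, smul_smul, show R / 4 * (4 / R) = 1 by field_simp, one_smul]
  rw [hvw, ← smul_sub, norm_smul, Real.norm_of_nonneg (by positivity)] at h1
  rw [hvw, ← smul_add, norm_smul, Real.norm_of_nonneg (by positivity)] at h2
  have h3 : (‖u + w‖ + ‖u - w‖) / 2 - 1 ≤ modSmooth X ‖w‖ := by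
    refine le_csSup ⟨‖w‖, ?_⟩ ⟨u, w, hun, rfl, rfl⟩
    rintro _ ⟨x', y', hx', hy', rfl⟩
    have := norm_add_le x' y'
    have := norm_sub_le x' y'
    linarith
  have h4 := h3.trans (hpow ‖w‖ (norm_nonneg _))
  have h5 : δ ≤ R / 4 * (C * ‖w‖ ^ s) := by nlinarith
  refine h5.trans ?_
  have hq : 0 ≤ l / R := by positivity
  rw [hwn, Real.mul_rpow (by norm_num) hq]
  have h24 : (2 : ℝ) ^ s ≤ 4 ^ s := Real.rpow_le_rpow (by norm_num) (by norm_num) (by linarith)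
  have hsplit : R * (l / R) ^ s = l * (l / R) ^ (s - 1) := by
    rcases hq.eq_or_lt with h | h
    · have : l = 0 := by
        rcases div_eq_zero_iff.1 h.symm with h | h
        · exact h
        · exact absurd h hR.ne'
      rw [this, zero_div, Real.zero_rpow (by linarith)]; ring
    · rw [Real.rpow_sub_one h.ne']
      have : l ≠ 0 := fun h' => by simp [h'] at h
      field_simp
  calc R / 4 * (C * (2 ^ s * (l / R) ^ s)) = C * 2 ^ s * (R * (l / R) ^ s) / 4 := by ring
    _ = C * 2 ^ s * (l * (l / R) ^ (s - 1)) / 4 := by rw [hsplit]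
    _ ≤ C * 2 ^ s * (l * (l / R) ^ (s - 1)) := by
        have : 0 ≤ C * 2 ^ s * (l * (l / R) ^ (s - 1)) := by positivity
        linarith
    _ ≤ C * 4 ^ s * (l * (l / R) ^ (s - 1)) := by gcongr
    _ = _ := by ring

/-- recursive midpoint refinement of the segment -/
def midCurve (N : X → X → X) : ℕ → X → X → ℝ → X
  | 0, x, y, t => x + t • (y - x)
  | n + 1, x, y, t =>
    if t ≤ 1 / 2 then midCurve N n x (N x y) (2 * t) else midCurve N n (N x y) y (2 * t - 1)

lemma midCurve_zero (N : X → X → X) (n : ℕ) : ∀ x y : X, midCurve N n x y 0 = x := by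
  induction n with
  | zero => intro x y; simp [midCurve]
  | succ n ih => intro x y; simp [midCurve, ih]

lemma midCurve_one (N : X → X → X) (n : ℕ) : ∀ x y : X, midCurve N n x y 1 = y := by
  induction n with
  | zero => intro x y; simp [midCurve]
  | succ n ih =>
    intro x y
    have h : ¬ ((1 : ℝ) ≤ 1 / 2) := by norm_num
    simp only [midCurve, if_neg h]
    rw [show (2 * 1 - 1 : ℝ) = 1 by norm_num, ih]

lemma midCurve_lower (N : X → X → X) (n : ℕ) (x y : X) {t : ℝ} (h : t ≤ 1 / 2) :
    midCurve N (n + 1) x y t = midCurve N n x (N x y) (2 * t) := by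
  simp only [midCurve, if_pos h]

lemma midCurve_upper (N : X → X → X) (n : ℕ) (x y : X) {t : ℝ} (h : 1 / 2 ≤ t) :
    midCurve N (n + 1) x y t = midCurve N n (N x y) y (2 * t - 1) := by
  rcases h.eq_or_lt with h | h
  · subst h
    rw [midCurve_lower N n x y le_rfl, show (2 * (1 / 2) : ℝ) = 1 by norm_num, midCurve_one,
      sub_self, midCurve_zero]
  · simp only [midCurve, if_neg (not_le.2 h)]

lemma curve_aux [CompleteSpace X] {A : Set X} (hA : IsClosed A) {b q : ℝ} {E G : ℝ → ℝ}
    (hq1 : q < 1) (hE : ∀ l, 0 ≤ l → l < b → E l ≤ (q - 1 / 2) * l)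
    (hG0 : ∀ l, 0 ≤ l → 0 ≤ G l)
    (hq0 : 1 / 2 < q)
    (hG : ∀ l l', 0 ≤ l' → l' ≤ q * l → l < b → 2 * G l' + 2 * E l ≤ G l)
    (hN : ∀ x ∈ A, ∀ y ∈ A, ‖x - y‖ < b → ∃ z ∈ A, ‖z - midpoint ℝ x y‖ ≤ E ‖x - y‖)
    {x y : X} (hx : x ∈ A) (hy : y ∈ A) (hxy : ‖x - y‖ < b) :
    ∃ f : ℝ → X, f 0 = x ∧ f 1 = y ∧ (∀ t ∈ Set.Icc (0 : ℝ) 1, f t ∈ A) ∧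
      (∃ K : ℝ, 0 ≤ K ∧ ∀ t ∈ Set.Icc (0 : ℝ) 1, ∀ t' ∈ Set.Icc (0 : ℝ) 1, t ≤ t' →
        ‖f t' - f t‖ ≤ K * (t' - t)) ∧
      ∀ t ∈ Set.Icc (0 : ℝ) 1, ‖f t - (x + t • (y - x))‖ ≤ G ‖x - y‖ * min t (1 - t) := by
  have hN' : ∀ x y, ∃ z, x ∈ A → y ∈ A → ‖x - y‖ < b →
      z ∈ A ∧ ‖z - midpoint ℝ x y‖ ≤ E ‖x - y‖ := fun x y => by
    by_cases h : x ∈ A ∧ y ∈ A ∧ ‖x - y‖ < b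
    · obtain ⟨z, h1, h2⟩ := hN x h.1 y h.2.1 h.2.2
      exact ⟨z, fun _ _ _ => ⟨h1, h2⟩⟩
    · exact ⟨x, fun h1 h2 h3 => absurd ⟨h1, h2, h3⟩ h⟩
  choose N hN using hN'
  have hleft : ∀ x y : X, ‖x - N x y‖ ≤ ‖x - y‖ / 2 + ‖N x y - midpoint ℝ x y‖ := fun x y => by
    have : x - N x y = (1 / 2 : ℝ) • (x - y) - (N x y - midpoint ℝ x y) := by
      rw [midpoint_eq_smul_add, invOf_eq_inv]; module
    rw [this]
    refine (norm_sub_le _ _).trans ?_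
    rw [norm_smul, Real.norm_of_nonneg (by norm_num)]
    linarith
  have hright : ∀ x y : X, ‖N x y - y‖ ≤ ‖x - y‖ / 2 + ‖N x y - midpoint ℝ x y‖ := fun x y => by
    have : N x y - y = (1 / 2 : ℝ) • (x - y) + (N x y - midpoint ℝ x y) := by
      rw [midpoint_eq_smul_add, invOf_eq_inv]; module
    rw [this]
    refine (norm_add_le _ _).trans ?_
    rw [norm_smul, Real.norm_of_nonneg (by norm_num)]
    linarith
  -- packaged facts
  have hpack : ∀ x ∈ A, ∀ y ∈ A, ‖x - y‖ < b → N x y ∈ A ∧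
      ‖N x y - midpoint ℝ x y‖ ≤ E ‖x - y‖ ∧
      ‖x - N x y‖ ≤ q * ‖x - y‖ ∧ ‖N x y - y‖ ≤ q * ‖x - y‖ ∧
      ‖x - N x y‖ < b ∧ ‖N x y - y‖ < b := by
    intro x hx y hy hxy
    obtain ⟨h1, h2⟩ := hN x y hx hy hxy
    have h3 := hE _ (norm_nonneg (x - y)) hxy
    have h4 := hleft x y
    have h5 := hright x y
    have h6 : q * ‖x - y‖ ≤ ‖x - y‖ := by nlinarith [norm_nonneg (x - y)]
    exact ⟨h1, h2, by linarith, by linarith, by linarith, by linarith⟩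
  -- Lipschitz
  have hLip : ∀ n : ℕ, ∀ x ∈ A, ∀ y ∈ A, ‖x - y‖ < b → ∀ t t', 0 ≤ t → t ≤ t' → t' ≤ 1 →
      ‖midCurve N n x y t' - midCurve N n x y t‖ ≤ (‖x - y‖ + G ‖x - y‖) * (t' - t) := by
    intro n
    induction n with
    | zero =>
      intro x hx y hy hxy t t' h0 h1 h2
      simp only [midCurve]
      rw [show x + t' • (y - x) - (x + t • (y - x)) = (t' - t) • (y - x) by module, norm_smul,
        Real.norm_of_nonneg (by linarith), norm_sub_rev]
      have := hG0 _ (norm_nonneg (x - y))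
      nlinarith
    | succ n ih =>
      intro x hx y hy hxy t t' h0 h1 h2
      obtain ⟨p1, p2, p3, p4, p5, p6⟩ := hpack x hx y hy hxy
      have g1 := hG _ _ (norm_nonneg _) p3 hxy
      have g2 := hG _ _ (norm_nonneg _) p4 hxy
      have l1 := hleft x y
      have l2 := hright x y
      set z := N x y with hz
      have a1 : 2 * (‖x - z‖ + G ‖x - z‖) ≤ ‖x - y‖ + G ‖x - y‖ := by linarith
      have a2 : 2 * (‖z - y‖ + G ‖z - y‖) ≤ ‖x - y‖ + G ‖x - y‖ := by linarith
      have low : ∀ r r', 0 ≤ r → r ≤ r' → r' ≤ 1 / 2 →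
          ‖midCurve N (n + 1) x y r' - midCurve N (n + 1) x y r‖ ≤
            (‖x - y‖ + G ‖x - y‖) * (r' - r) := by
        intro r r' k0 k1 k2
        rw [midCurve_lower N n x y k2, midCurve_lower N n x y (k1.trans k2)]
        refine (ih x hx z p1 p5 (2 * r) (2 * r') (by linarith) (by linarith) (by linarith)).trans ?_
        nlinarith
      have upp : ∀ r r', 1 / 2 ≤ r → r ≤ r' → r' ≤ 1 →
          ‖midCurve N (n + 1) x y r' - midCurve N (n + 1) x y r‖ ≤
            (‖x - y‖ + G ‖x - y‖) * (r' - r) := by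
        intro r r' k0 k1 k2
        rw [midCurve_upper N n x y k0, midCurve_upper N n x y (k0.trans k1)]
        refine (ih z p1 y hy p6 (2 * r - 1) (2 * r' - 1) (by linarith) (by linarith)
          (by linarith)).trans ?_
        nlinarith
      rcases le_total t' (1 / 2) with h | h
      · exact low t t' h0 h1 h
      rcases le_total (1 / 2) t with h' | h'
      · exact upp t t' h' h1 h2
      have b1 := low t (1 / 2) h0 h' le_rfl
      have b2 := upp (1 / 2) t' le_rfl h h2
      have b3 := norm_sub_le_norm_sub_add_norm_sub (midCurve N (n + 1) x y t')
        (midCurve N (n + 1) x y (1 / 2)) (midCurve N (n + 1) x y t)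
      linarith
  -- deviation
  have hDev : ∀ n : ℕ, ∀ x ∈ A, ∀ y ∈ A, ‖x - y‖ < b → ∀ t, 0 ≤ t → t ≤ 1 →
      ‖midCurve N n x y t - (x + t • (y - x))‖ ≤ G ‖x - y‖ * min t (1 - t) := by
    intro n
    induction n with
    | zero =>
      intro x hx y hy hxy t h0 h1
      simp only [midCurve, sub_self, norm_zero]
      exact mul_nonneg (hG0 _ (norm_nonneg _)) (le_min h0 (by linarith))
    | succ n ih =>
      intro x hx y hy hxy t h0 h1
      obtain ⟨p1, p2, p3, p4, p5, p6⟩ := hpack x hx y hy hxy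
      have g1 := hG _ _ (norm_nonneg _) p3 hxy
      have g2 := hG _ _ (norm_nonneg _) p4 hxy
      have q1 := hG0 _ (norm_nonneg (x - N x y))
      have q2 := hG0 _ (norm_nonneg (N x y - y))
      rcases le_total t (1 / 2) with h | h
      · rw [midCurve_lower N n x y h, min_eq_left (by linarith)]
        have k := ih x hx (N x y) p1 p5 (2 * t) (by linarith) (by linarith)
        have e : midCurve N n x (N x y) (2 * t) - (x + t • (y - x)) =
            (midCurve N n x (N x y) (2 * t) - (x + (2 * t) • (N x y - x))) +
              (2 * t) • (N x y - midpoint ℝ x y) := by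
          rw [midpoint_eq_smul_add, invOf_eq_inv]; module
        rw [e]
        refine (norm_add_le _ _).trans ?_
        rw [norm_smul, Real.norm_of_nonneg (by linarith)]
        have m1 := mul_le_mul_of_nonneg_left (min_le_left (2 * t) (1 - 2 * t)) q1
        have m2 := mul_le_mul_of_nonneg_left p2 (show 0 ≤ 2 * t by linarith)
        have m3 := mul_le_mul_of_nonneg_left g1 h0
        linarith
      · rw [midCurve_upper N n x y h, min_eq_right (by linarith)]
        have k := ih (N x y) p1 y hy p6 (2 * t - 1) (by linarith) (by linarith)
        have e : midCurve N n (N x y) y (2 * t - 1) - (x + t • (y - x)) =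
            (midCurve N n (N x y) y (2 * t - 1) - (N x y + (2 * t - 1) • (y - N x y))) +
              (2 * (1 - t)) • (N x y - midpoint ℝ x y) := by
          rw [midpoint_eq_smul_add, invOf_eq_inv]; module
        rw [e]
        refine (norm_add_le _ _).trans ?_
        rw [norm_smul, Real.norm_of_nonneg (by linarith)]
        have m1 := mul_le_mul_of_nonneg_left (min_le_right (2 * t - 1) (1 - (2 * t - 1))) q2
        have m2 := mul_le_mul_of_nonneg_left p2 (show 0 ≤ 2 * (1 - t) by linarith)
        have m3 := mul_le_mul_of_nonneg_left g2 (show 0 ≤ 1 - t by linarith)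
        linarith
  -- Cauchy
  have hCau : ∀ n : ℕ, ∀ x ∈ A, ∀ y ∈ A, ‖x - y‖ < b → ∀ t, 0 ≤ t → t ≤ 1 →
      ‖midCurve N (n + 1) x y t - midCurve N n x y t‖ ≤ G ‖x - y‖ * q ^ n := by
    intro n
    induction n with
    | zero =>
      intro x hx y hy hxy t h0 h1
      refine (hDev 1 x hx y hy hxy t h0 h1).trans ?_
      rw [pow_zero]
      exact mul_le_mul_of_nonneg_left ((min_le_left _ _).trans h1) (hG0 _ (norm_nonneg _))
    | succ n ih =>
      intro x hx y hy hxy t h0 h1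
      obtain ⟨p1, p2, p3, p4, p5, p6⟩ := hpack x hx y hy hxy
      have g1 := hG _ _ (norm_nonneg _) p3 hxy
      have g2 := hG _ _ (norm_nonneg _) p4 hxy
      have g3 := hG0 _ (norm_nonneg (x - y))
      have e0 := (norm_nonneg _).trans p2
      have g4 : 1 / 2 * G ‖x - y‖ ≤ q * G ‖x - y‖ := by gcongr
      have qn : 0 ≤ q ^ n := pow_nonneg (by linarith) n
      rcases le_total t (1 / 2) with h | h
      · rw [midCurve_lower N (n + 1) x y h, midCurve_lower N n x y h]
        refine (ih x hx _ p1 p5 (2 * t) (by linarith) (by linarith)).trans ?_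
        calc _ ≤ (q * G ‖x - y‖) * q ^ n := mul_le_mul_of_nonneg_right (by linarith) qn
          _ = _ := by ring
      · rw [midCurve_upper N (n + 1) x y h, midCurve_upper N n x y h]
        refine (ih _ p1 y hy p6 (2 * t - 1) (by linarith) (by linarith)).trans ?_
        calc _ ≤ (q * G ‖x - y‖) * q ^ n := mul_le_mul_of_nonneg_right (by linarith) qn
          _ = _ := by ring
  -- distance to A
  have hDist : ∀ n : ℕ, ∀ x ∈ A, ∀ y ∈ A, ‖x - y‖ < b → ∀ t, 0 ≤ t → t ≤ 1 →
      Metric.infDist (midCurve N n x y t) A ≤ ‖x - y‖ * q ^ n := by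
    intro n
    induction n with
    | zero =>
      intro x hx y hy hxy t h0 h1
      refine (Metric.infDist_le_dist_of_mem hx).trans ?_
      simp only [midCurve]
      rw [dist_eq_norm, add_sub_cancel_left, norm_smul, Real.norm_of_nonneg h0, norm_sub_rev]
      nlinarith [norm_nonneg (x - y)]
    | succ n ih =>
      intro x hx y hy hxy t h0 h1
      obtain ⟨p1, p2, p3, p4, p5, p6⟩ := hpack x hx y hy hxy
      have qn : 0 ≤ q ^ n := pow_nonneg (by linarith) n
      rcases le_total t (1 / 2) with h | h
      · rw [midCurve_lower N n x y h]
        refine (ih x hx _ p1 p5 (2 * t) (by linarith) (by linarith)).trans ?_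
        rw [pow_succ]
        nlinarith
      · rw [midCurve_upper N n x y h]
        refine (ih _ p1 y hy p6 (2 * t - 1) (by linarith) (by linarith)).trans ?_
        rw [pow_succ]
        nlinarith
  have hlim : ∀ t, ∃ z, t ∈ Set.Icc (0 : ℝ) 1 →
      Filter.Tendsto (fun n => midCurve N n x y t) Filter.atTop (nhds z) := fun t => by
    by_cases ht : t ∈ Set.Icc (0 : ℝ) 1
    · have : CauchySeq (fun n => midCurve N n x y t) :=
        cauchySeq_of_le_geometric q (G ‖x - y‖) hq1 fun n => by
          rw [dist_comm, dist_eq_norm]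
          exact hCau n x hx y hy hxy t ht.1 ht.2
      obtain ⟨z, hz⟩ := cauchySeq_tendsto_of_complete this
      exact ⟨z, fun _ => hz⟩
    · exact ⟨0, fun h => absurd h ht⟩
  choose f hf using hlim
  refine ⟨f, ?_, ?_, ?_, ⟨‖x - y‖ + G ‖x - y‖,
    add_nonneg (norm_nonneg _) (hG0 _ (norm_nonneg _)), ?_⟩, ?_⟩
  · have := hf 0 (by simp)
    simp only [midCurve_zero] at this
    exact (tendsto_nhds_unique this tendsto_const_nhds)
  · have := hf 1 (by simp)
    simp only [midCurve_one] at this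
    exact (tendsto_nhds_unique this tendsto_const_nhds)
  · intro t ht
    rw [hA.mem_iff_infDist_zero ⟨x, hx⟩]
    refine le_antisymm ?_ Metric.infDist_nonneg
    have t1 := ((Metric.continuous_infDist_pt A).tendsto _).comp (hf t ht)
    have t2 := (tendsto_pow_atTop_nhds_zero_of_lt_one (by linarith) hq1).const_mul ‖x - y‖
    rw [mul_zero] at t2
    exact le_of_tendsto_of_tendsto' t1 t2 fun n => hDist n x hx y hy hxy t ht.1 ht.2
  · intro t ht t' ht' htt
    exact le_of_tendsto' ((hf t' ht').sub (hf t ht)).norm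
      fun n => hLip n x hx y hy hxy t t' ht.1 htt ht'.2
  · intro t ht
    exact le_of_tendsto' ((hf t ht).sub_const _).norm
      fun n => hDev n x hx y hy hxy t ht.1 ht.2

end aux

theorem statement12 (X : Type*) [NormedAddCommGroup X] [NormedSpace ℝ X]
    [CompleteSpace X] [UniformConvexSpace X] (hsm : UnifSmooth X)
    (s : ℝ) (hs1 : 1 < s) (hs2 : s ≤ 2)
    (hpow : ∃ C : ℝ, ∀ τ : ℝ, 0 ≤ τ → modSmooth X τ ≤ C * τ ^ s) :
    ∃ βI LI : ℝ, 0 < βI ∧ 0 < LI ∧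
      ∀ (A : Set X) (R : ℝ), 0 < R → ProximallySmooth A R →
        ∀ x0 ∈ A, ∀ x1 ∈ A, ‖x0 - x1‖ / R < βI →
          ∃ f : ℝ → X, IsCurveIn A x0 x1 f ∧
            BoundedVariationOn f (Set.Icc 0 1) ∧
            f '' Set.Icc 0 1 ⊆
              convexHull ℝ ({x0, x1} ∪
                Metric.closedBall (midpoint ℝ x0 x1)
                  (LI * ‖x0 - x1‖ * (‖x0 - x1‖ / R) ^ (s - 1))) := by
  obtain ⟨C0, hC0⟩ := hpow
  have hC1 : ∀ τ : ℝ, 0 ≤ τ → modSmooth X τ ≤ max C0 1 * τ ^ s := fun τ hτ =>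
    (hC0 τ hτ).trans (mul_le_mul_of_nonneg_right (le_max_left _ _) (Real.rpow_nonneg hτ s))
  have hCm : 0 < max C0 1 := lt_of_lt_of_le one_pos (le_max_right _ _)
  set C : ℝ := max C0 1 * 4 ^ s with hCdef
  have hC : 0 < C := by positivity
  have hs0 : 0 < s := by linarith
  set q : ℝ := 2 ^ (-(1 + s) / (2 * s)) with hq
  have hq0 : 1 / 2 < q := by
    rw [hq, show (1 / 2 : ℝ) = 2 ^ (-1 : ℝ) by rw [Real.rpow_neg_one]; norm_num]
    refine Real.rpow_lt_rpow_of_exponent_lt (by norm_num) ?_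
    rw [lt_div_iff₀ (by positivity)]
    linarith
  have hq1 : q < 1 := by
    rw [hq]
    refine Real.rpow_lt_one_of_one_lt_of_neg (by norm_num) ?_
    exact div_neg_of_neg_of_pos (by linarith) (by positivity)
  have hqp : 0 < q := by linarith
  have hθ : 2 * q ^ s < 1 := by
    have : (2 : ℝ) * q ^ s = 2 ^ ((1 - s) / 2) := by
      rw [hq, ← Real.rpow_mul (by norm_num)]
      nth_rewrite 1 [← Real.rpow_one (2 : ℝ)]
      rw [← Real.rpow_add (by norm_num)]
      congr 1
      field_simp
      ring
    rw [this]
    exact Real.rpow_lt_one_of_one_lt_of_neg (by norm_num) (by linarith)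
  set L : ℝ := 2 * C / (1 - 2 * q ^ s) with hL
  have hL0 : 0 < L := div_pos (by positivity) (by linarith)
  have hLe : L * (1 - 2 * q ^ s) = 2 * C := by
    rw [hL]; exact div_mul_cancel₀ _ (by linarith)
  set β : ℝ := min (1 / 4) (((q - 1 / 2) / C) ^ (1 / (s - 1))) with hβ
  have hqC : 0 < (q - 1 / 2) / C := div_pos (by linarith) hC
  have hβ0 : 0 < β := lt_min (by norm_num) (Real.rpow_pos_of_pos hqC _)
  have hs1' : 0 < s - 1 := by linarith
  refine ⟨β, L, hβ0, hL0, ?_⟩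
  intro A R hR hP x0 hx0 x1 hx1 hlt
  set E : ℝ → ℝ := fun l => C * l * (l / R) ^ (s - 1) with hE
  set G : ℝ → ℝ := fun l => L * l * (l / R) ^ (s - 1) with hG
  have hG0 : ∀ l, 0 ≤ l → 0 ≤ G l := fun l hl => by simp only [hG]; positivity
  obtain ⟨f, hf0, hf1, hfA, ⟨K, hK, hfK⟩, hdev⟩ := curve_aux (E := E) (G := G) (b := β * R) (q := q)
    hP.1 hq1
    (by
      intro l hl hlb
      have h1 : l / R ≤ ((q - 1 / 2) / C) ^ (1 / (s - 1)) :=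
        ((div_lt_iff₀ hR).2 hlb).le.trans (min_le_right _ _)
      have h2 : (l / R) ^ (s - 1) ≤ (q - 1 / 2) / C := by
        calc _ ≤ (((q - 1 / 2) / C) ^ (1 / (s - 1))) ^ (s - 1) :=
              Real.rpow_le_rpow (by positivity) h1 hs1'.le
          _ = _ := by
            rw [← Real.rpow_mul hqC.le, one_div_mul_cancel hs1'.ne', Real.rpow_one]
      calc C * l * (l / R) ^ (s - 1) ≤ C * l * ((q - 1 / 2) / C) := by gcongr
        _ = _ := by field_simp)
    hG0 hq0
    (by
      intro l l' hl' hll _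
      have hl : 0 ≤ l := by
        by_contra! h
        nlinarith
      have h1 : G l' ≤ q ^ s * G l := by
        calc L * l' * (l' / R) ^ (s - 1) ≤ L * (q * l) * ((q * l) / R) ^ (s - 1) := by
              gcongr
          _ = q ^ s * (L * l * (l / R) ^ (s - 1)) := by
            rw [mul_div_assoc, Real.mul_rpow hqp.le (by positivity), Real.rpow_sub_one hqp.ne']
            field_simp
      have h2 : G l * (1 - 2 * q ^ s) = 2 * E l := by
        calc L * l * (l / R) ^ (s - 1) * (1 - 2 * q ^ s)
            = L * (1 - 2 * q ^ s) * l * (l / R) ^ (s - 1) := by ring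
          _ = 2 * E l := by rw [hLe]; simp only [hE]; ring
      linarith)
    (by
      intro x hx y hy hxy
      exact mid_aux hs1 hCm.le hC1 hR hP hx hy
        (((div_lt_iff₀ hR).2 hxy).trans_le (min_le_left _ _)))
    hx0 hx1 ((div_lt_iff₀ hR).1 hlt)
  have hlip : LipschitzOnWith (Real.toNNReal K) f (Set.Icc 0 1) := by
    refine LipschitzOnWith.of_dist_le_mul fun t ht t' ht' => ?_
    rw [Real.coe_toNNReal K hK]
    rcases le_total t t' with h | h
    · rw [dist_comm, dist_eq_norm, dist_comm t t', Real.dist_eq, abs_of_nonneg (by linarith)]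
      exact hfK t ht t' ht' h
    · rw [dist_eq_norm, Real.dist_eq, abs_of_nonneg (by linarith)]
      exact hfK t' ht' t ht h
  refine ⟨f, ⟨hlip.continuousOn, hf0, hf1, ?_⟩, ?_, ?_⟩
  · rintro _ ⟨t, ht, rfl⟩
    exact hfA t ht
  · have := hlip.locallyBoundedVariationOn 0 1 (by simp) (by simp)
    rwa [Set.inter_self] at this
  · rintro _ ⟨t, ht, rfl⟩
    have hd := hdev t ht
    have hGl : L * ‖x0 - x1‖ * (‖x0 - x1‖ / R) ^ (s - 1) = G ‖x0 - x1‖ := rfl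
    rw [hGl]
    have hGn := hG0 _ (norm_nonneg (x0 - x1))
    set m := midpoint ℝ x0 x1 with hm
    set e := f t - (x0 + t • (x1 - x0)) with he
    set S : Set X := {x0, x1} ∪ Metric.closedBall m (G ‖x0 - x1‖) with hS
    have hcv : Convex ℝ (convexHull ℝ S) := convex_convexHull ℝ S
    have hm0 : x0 ∈ convexHull ℝ S := subset_convexHull ℝ S (by simp [hS])
    have hm1 : x1 ∈ convexHull ℝ S := subset_convexHull ℝ S (by simp [hS])
    have main : ∀ r : ℝ, 0 ≤ r → ‖e‖ ≤ G ‖x0 - x1‖ * r →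
        m + (2 * r)⁻¹ • e ∈ convexHull ℝ S ∧ (2 * r) • (m + (2 * r)⁻¹ • e) = (2 * r) • m + e := by
      intro r hr her
      rcases hr.eq_or_lt with h | h
      · have : e = 0 := by
          rw [← norm_le_zero_iff]
          simpa [← h] using her
        rw [this]
        refine ⟨subset_convexHull ℝ S (Or.inr ?_), by simp⟩
        simpa using hGn
      · constructor
        · refine subset_convexHull ℝ S (Or.inr ?_)
          rw [Metric.mem_closedBall, dist_eq_norm, add_sub_cancel_left, norm_smul,
            Real.norm_of_nonneg (by positivity), inv_mul_le_iff₀ (by positivity)]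
          nlinarith [mul_nonneg hGn h.le]
        · rw [smul_add, smul_smul, mul_inv_cancel₀ (by positivity), one_smul]
    rcases le_total t (1 / 2) with h | h
    · obtain ⟨k1, k2⟩ := main t ht.1 (hd.trans (by gcongr; exact min_le_left _ _))
      have : f t = (1 - 2 * t) • x0 + (2 * t) • (m + (2 * t)⁻¹ • e) := by
        rw [k2, hm, he, midpoint_eq_smul_add, invOf_eq_inv]; module
      rw [this]
      exact hcv hm0 k1 (by linarith) (by linarith [ht.1]) (by ring)
    · obtain ⟨k1, k2⟩ := main (1 - t) (by linarith [ht.2])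
        (hd.trans (by gcongr; exact min_le_right _ _))
      have : f t = (1 - 2 * (1 - t)) • x1 + (2 * (1 - t)) • (m + (2 * (1 - t))⁻¹ • e) := by
        rw [k2, hm, he, midpoint_eq_smul_add, invOf_eq_inv]; module
      rw [this]
      exact hcv hm1 k1 (by linarith) (by linarith [ht.2]) (by ring)
end
end
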